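/- Let N ≥ 1, m > 1, q ∈ (0,1), σ > 0, and let u_{0,1}, u_{0,2} ∈ L^∞(ℝ^N) be non-negative with u_{0,1}(x) ≤ u_{0,2}(x) for a.e. x ∈ ℝ^N. If u_1 and u_2 are non-negative weak solutions of ∂_t u = Δ(u^m) − |x|^σ u^q with initial conditions u_{0,1} and u_{0,2} respectively, then u_1(t,x) ≤ u_2(t,x) for a.e. (t,x) ∈ (0,∞)×ℝ^N (comparison principle). -/

import Mathlib

open MeasureTheory Set

noncomputable section

/-- A non-negative weak solution of `∂ₜ u = Δ(uᵐ) − w(x) u^q` on `(0,∞)×ℝᴺ`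
with initial condition `u₀`, in the sense of Definition 1.1 of the paper:
`u` is a bounded non-negative measurable function, and there is a measurable
vector field `g` (the weak spatial gradient of `uᵐ`) which is locally square
integrable on `(0,T)×ℝᴺ`, satisfies the weak derivative identity against test
functions in `C_c^1((0,T)×ℝᴺ)`, and satisfies the weak formulation of the
equation against test functions in `C_c^1([0,T)×ℝᴺ)`. -/
def IsWeakSolution (N : ℕ) (m q : ℝ) (w : EuclideanSpace ℝ (Fin N) → ℝ)
    (u0 : EuclideanSpace ℝ (Fin N) → ℝ)
    (u : ℝ → EuclideanSpace ℝ (Fin N) → ℝ) : Prop :=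
  Measurable (Function.uncurry u) ∧
  (∀ t x, 0 ≤ u t x) ∧
  (∃ C : ℝ, ∀ t x, u t x ≤ C) ∧
  ∃ g : ℝ → EuclideanSpace ℝ (Fin N) → EuclideanSpace ℝ (Fin N),
    Measurable (Function.uncurry g) ∧
    ∀ T > (0:ℝ),
      (∀ K : Set (EuclideanSpace ℝ (Fin N)), IsCompact K →
        ∫⁻ s in Ioo (0:ℝ) T, ∫⁻ x in K, ENNReal.ofReal (‖g s x‖ ^ 2) < ⊤) ∧
      (∀ ζ : ℝ × EuclideanSpace ℝ (Fin N) → ℝ, ContDiff ℝ 1 ζ →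
        HasCompactSupport ζ → (∀ s x, s ∉ Ioo (0:ℝ) T → ζ (s, x) = 0) →
        ∀ i : Fin N,
          (∫ s in Ioo (0:ℝ) T, ∫ x,
              (u s x) ^ m * fderiv ℝ ζ (s, x) (0, EuclideanSpace.single i 1))
            = - ∫ s in Ioo (0:ℝ) T, ∫ x, g s x i * ζ (s, x)) ∧
      (∀ ζ : ℝ × EuclideanSpace ℝ (Fin N) → ℝ, ContDiff ℝ 1 ζ →
        HasCompactSupport ζ → (∀ s x, T ≤ s → ζ (s, x) = 0) →
        ∫ s in Ioo (0:ℝ) T, ∫ x,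
            ((u0 x - u s x) * fderiv ℝ ζ (s, x) (1, 0)
              + fderiv ℝ ζ (s, x) (0, g s x)
              + w x * (u s x) ^ q * ζ (s, x)) = 0)

/-- `u₀` is a non-negative function in `L^∞(ℝᴺ)`. -/
def IsBddNonneg (N : ℕ) (u0 : EuclideanSpace ℝ (Fin N) → ℝ) : Prop :=
  Measurable u0 ∧ (∀ x, 0 ≤ u0 x) ∧ ∃ C : ℝ, ∀ x, u0 x ≤ C

/-- The solution `u` vanishes in finite time. -/
def VanishesInFiniteTime (N : ℕ) (u : ℝ → EuclideanSpace ℝ (Fin N) → ℝ) : Prop :=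
  ∃ Te : ℝ, 0 < Te ∧ ∀ᵐ t : ℝ, Te ≤ t → ∀ᵐ x : EuclideanSpace ℝ (Fin N), u t x = 0

/-- The support of `u(t)` is contained in `B(0,R)` for a.e. `t > 0`. -/
def SupportLocalized (N : ℕ) (R : ℝ) (u : ℝ → EuclideanSpace ℝ (Fin N) → ℝ) : Prop :=
  ∀ᵐ t : ℝ, 0 < t → ∀ᵐ x : EuclideanSpace ℝ (Fin N), R ≤ ‖x‖ → u t x = 0

set_option linter.unusedSectionVars false
open Filter Topology ENNReal

section generic
variable {Z E : Type*} [NormedAddCommGroup Z] [NormedSpace ℝ Z] [FiniteDimensional ℝ Z]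
  [MeasurableSpace Z] [BorelSpace Z] {μ : Measure Z} [μ.IsAddHaarMeasure]
  [NormedAddCommGroup E] [InnerProductSpace ℝ E] [FiniteDimensional ℝ E]
  [MeasurableSpace E] [BorelSpace E]



lemma pm_cs {α : Type*} [MeasurableSpace α] {ν : Measure α} {a b : α → E}
    (ha : AEStronglyMeasurable a ν) (hb : AEStronglyMeasurable b ν) :
    ‖∫ z, inner ℝ (a z) (b z) ∂ν‖ₑ ^ 2 ≤ (∫⁻ z, ‖a z‖ₑ ^ 2 ∂ν) * ∫⁻ z, ‖b z‖ₑ ^ 2 ∂ν := by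
  have h1 : ‖∫ z, inner ℝ (a z) (b z) ∂ν‖ₑ ≤ ∫⁻ z, ‖a z‖ₑ * ‖b z‖ₑ ∂ν := by
    refine (enorm_integral_le_lintegral_enorm _).trans (lintegral_mono fun z => ?_)
    rw [← enorm_norm (a z), ← enorm_norm (b z), ← enorm_mul]
    refine enorm_le_iff_norm_le.2 ?_
    rw [norm_mul, norm_norm, norm_norm]
    exact norm_inner_le_norm _ _
  have h2 := ENNReal.lintegral_mul_le_Lp_mul_Lq ν (p := 2) (q := 2) (by constructor <;> norm_num)
    ha.enorm hb.enorm
  have h3 : ∀ x : ℝ≥0∞, (x ^ (1 / (2:ℝ))) ^ 2 = x := fun x => by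
    rw [← ENNReal.rpow_natCast, ← ENNReal.rpow_mul]; norm_num
  calc _ ≤ (∫⁻ z, ‖a z‖ₑ * ‖b z‖ₑ ∂ν) ^ 2 := by gcongr
    _ ≤ _ := by
      refine (pow_le_pow_left' h2 2).trans ?_
      rw [mul_pow, h3, h3]
      simp only [ENNReal.rpow_ofNat, le_refl]

lemma pm_transl {p : ℝ≥0∞} (hp1 : 1 ≤ p) (hp : p ≠ ⊤) {w : Z → E} (hw : MemLp w p μ) :
    Tendsto (fun q : Z => eLpNorm (fun z => w (z + q) - w z) p μ) (𝓝 0) (𝓝 0) := by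
  have : Fact (1 ≤ p) := ⟨hp1⟩
  let G : Z → C(Z, Z) := fun q => ⟨fun z => z + q, by fun_prop⟩
  have hG : Continuous G := by
    have : Continuous (fun a : Z × Z => a.2 + a.1) := by fun_prop
    exact (ContinuousMap.curry ⟨_, this⟩).continuous
  have hm : ∀ q, MeasurePreserving (G q) μ μ := fun q => measurePreserving_add_right μ q
  have h := Filter.Tendsto.compMeasurePreservingLp (l := 𝓝 (0:Z)) (f := fun _ => hw.toLp w)
    tendsto_const_nhds (hG.tendsto 0) hm (hm 0) hp
  rw [Lp.tendsto_Lp_iff_tendsto_eLpNorm'] at h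
  refine h.congr fun q => eLpNorm_congr_ae ?_
  have e1 : ∀ q, (Lp.compMeasurePreserving (G q) (hm q) (hw.toLp w) : Z → E) =ᵐ[μ]
      fun z => w (z + q) := fun q => 
    (Lp.coeFn_compMeasurePreserving _ (hm q)).trans
      ((hm q).quasiMeasurePreserving.ae_eq_comp hw.coeFn_toLp)
  filter_upwards [e1 q, e1 0] with z h1 h2
  rw [Pi.sub_apply, h1, h2, add_zero]


lemma pm_sq {α : Type*} [MeasurableSpace α] {ν : Measure α} (hν : ν univ ≤ 1) {a : α → ℝ≥0∞}
    (ha : AEMeasurable a ν) : (∫⁻ z, a z ∂ν) ^ 2 ≤ ∫⁻ z, a z ^ 2 ∂ν := by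
  have h2 := ENNReal.lintegral_mul_le_Lp_mul_Lq ν (p := 2) (q := 2) (by constructor <;> norm_num)
    ha (aemeasurable_const (b := 1))
  have h3 : ∀ x : ℝ≥0∞, (x ^ (1 / (2:ℝ))) ^ 2 = x := fun x => by
    rw [← ENNReal.rpow_natCast, ← ENNReal.rpow_mul]; norm_num
  have h4 := pow_le_pow_left' h2 2
  rw [mul_pow, h3, h3] at h4
  simp only [ENNReal.rpow_ofNat, Pi.mul_apply, mul_one, lintegral_const, one_pow, one_mul] at h4
  exact h4.trans (mul_le_of_le_one_right' hν)

lemma pm_moll {g : Z → E} (hgm : Measurable g) (hg : MemLp g 2 μ) (φ : ℕ → ContDiffBump (0:Z))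
    (hφ : Tendsto (fun n => (φ n).rOut) atTop (𝓝 0)) :
    Tendsto (fun n => ∫⁻ z, ‖(∫ y, (φ n).normed μ y • g (z - y) ∂μ) - g z‖ₑ ^ 2 ∂μ)
      atTop (𝓝 0) := by
  have ht := pm_transl (by norm_num) (by norm_num) hg
  rw [ENNReal.tendsto_nhds_zero] at ht ⊢
  intro ε hε
  obtain ⟨η, hη0, hη⟩ : ∃ η : ℝ≥0∞, 0 < η ∧ η ^ 2 ≤ ε := by
    refine ⟨ε ^ (1/2 : ℝ), ?_, ?_⟩
    · exact ENNReal.rpow_pos_of_nonneg hε (by norm_num)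
    · rw [← ENNReal.rpow_natCast, ← ENNReal.rpow_mul]; norm_num
  obtain ⟨δ, hδ, hball⟩ := Metric.eventually_nhds_iff_ball.1 (ht η hη0)
  filter_upwards [hφ.eventually (gt_mem_nhds hδ)] with n hn
  set ψ := (φ n).normed μ with hψ
  have hψc : Continuous ψ := (φ n).continuous_normed
  have hint : ∀ z, Integrable (fun y => ψ y • g (z - y)) μ := by
    intro z
    have h1 : LocallyIntegrable g μ := hg.locallyIntegrable (by norm_num)
    have h2 := ((φ n).hasCompactSupport_normed (μ := μ)).convolutionExists_left
      (ContinuousLinearMap.lsmul ℝ ℝ) hψc h1 z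
    exact h2
  let ν := μ.withDensity (fun y => ‖ψ y‖ₑ)
  have hψe : Measurable (fun y => ‖ψ y‖ₑ) := hψc.measurable.enorm
  have hν : ν univ ≤ 1 := by
    rw [withDensity_apply _ MeasurableSet.univ, Measure.restrict_univ]
    have h := (φ n).integral_normed (μ := μ)
    rw [← ofReal_integral_norm_eq_lintegral_enorm (φ n).integrable_normed]
    simp only [Real.norm_eq_abs, abs_of_nonneg ((φ n).nonneg_normed _), h]
    simp
  have key : ∀ z, ‖(∫ y, ψ y • g (z - y) ∂μ) - g z‖ₑ ^ 2
      ≤ ∫⁻ y, ‖ψ y‖ₑ * ‖g (z - y) - g z‖ₑ ^ 2 ∂μ := by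
    intro z
    have e1 : (∫ y, ψ y • g (z - y) ∂μ) - g z = ∫ y, ψ y • (g (z - y) - g z) ∂μ := by
      simp only [smul_sub]
      rw [integral_sub (hint z) ((φ n).integrable_normed.smul_const _), integral_smul_const,
        (φ n).integral_normed, one_smul]
    have m1 : Measurable fun y => ‖g (z - y) - g z‖ₑ :=
      ((hgm.comp (measurable_const.sub measurable_id)).sub measurable_const).enorm
    rw [e1]
    calc _ ≤ (∫⁻ y, ‖g (z - y) - g z‖ₑ ∂ν) ^ 2 := by
          gcongr
          refine (enorm_integral_le_lintegral_enorm _).trans ?_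
          rw [lintegral_withDensity_eq_lintegral_mul _ hψe m1]
          simp [enorm_smul]
      _ ≤ ∫⁻ y, ‖g (z - y) - g z‖ₑ ^ 2 ∂ν := pm_sq hν m1.aemeasurable
      _ = _ := by
          rw [lintegral_withDensity_eq_lintegral_mul _ hψe (m1.pow_const 2)]
          rfl
  calc _ ≤ ∫⁻ z, ∫⁻ y, ‖ψ y‖ₑ * ‖g (z - y) - g z‖ₑ ^ 2 ∂μ ∂μ := lintegral_mono key
    _ = ∫⁻ y, ∫⁻ z, ‖ψ y‖ₑ * ‖g (z - y) - g z‖ₑ ^ 2 ∂μ ∂μ := by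
        refine lintegral_lintegral_swap (Measurable.aemeasurable ?_)
        exact (hψe.comp measurable_snd).mul ((((hgm.comp (measurable_fst.sub measurable_snd)).sub
          (hgm.comp measurable_fst)).enorm).pow_const 2)
    _ ≤ ∫⁻ y, ‖ψ y‖ₑ * ε ∂μ := by
        refine lintegral_mono fun y => ?_
        by_cases hy : ψ y = 0
        · simp [hy]
        have hy2 : y ∈ Metric.ball (0:Z) (φ n).rOut := by
          rw [← (φ n).support_normed_eq (μ := μ)]; exact hy
        rw [lintegral_const_mul' _ _ (by simp)]
        gcongr
        refine le_trans ?_ hη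
        have h1 := hball (-y) (by simp at hy2 ⊢; linarith)
        rw [eLpNorm_eq_lintegral_rpow_enorm_toReal (by norm_num) (by norm_num)] at h1
        have h4 := pow_le_pow_left' h1 2
        refine le_trans (le_of_eq ?_) h4
        rw [← ENNReal.rpow_natCast _ 2, ← ENNReal.rpow_mul]
        norm_num [sub_eq_add_neg]
    _ ≤ ε := by
        rw [lintegral_mul_const _ hψe]
        have : ∫⁻ y, ‖ψ y‖ₑ ∂μ ≤ 1 := by
          rwa [withDensity_apply _ MeasurableSet.univ, Measure.restrict_univ] at hν
        exact mul_le_of_le_one_left' this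

/-- Partial gradient along `ι`. -/
def gx (ι : E →L[ℝ] Z) (F : Z → ℝ) (z : Z) : E :=
  (InnerProductSpace.toDual ℝ E).symm ((fderiv ℝ F z).comp ι)

lemma inner_gx (ι : E →L[ℝ] Z) (F : Z → ℝ) (z : Z) (v : E) :
    inner ℝ (gx ι F z) v = fderiv ℝ F z (ι v) := by
  simp [gx]

lemma continuous_gx (ι : E →L[ℝ] Z) {F : Z → ℝ} (hF : ContDiff ℝ 1 F) :
    Continuous (gx ι F) := by
  have : Continuous (fderiv ℝ F) := hF.continuous_fderiv (by norm_num)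
  exact (LinearIsometryEquiv.continuous _).comp (this.clm_comp continuous_const)

lemma gx_zero (ι : E →L[ℝ] Z) {F : Z → ℝ} {z : Z} (h : z ∉ tsupport F) : gx ι F z = 0 := by
  have : fderiv ℝ F z = 0 := by
    by_contra h'
    exact h (support_fderiv_subset ℝ h')
  simp [gx, this]

/-- Admissible pairs: limits of test functions with partial gradients. -/
def Adm (μ : Measure Z) (ι : E →L[ℝ] Z) (Ψ : Z → ℝ) (G : Z → E) : Prop :=
  ∃ K : Set Z, IsCompact K ∧ ∃ M : ℝ, ∃ P : ℕ → Z → ℝ, (∀ n, ContDiff ℝ 1 (P n)) ∧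
    (∀ n z, z ∉ K → P n z = 0) ∧ (∀ n z, |P n z| ≤ M) ∧
    (∀ᵐ z ∂μ, Tendsto (fun n => P n z) atTop (𝓝 (Ψ z))) ∧
    MemLp G 2 μ ∧
    Tendsto (fun n => ∫⁻ z, ‖gx ι (P n) z - G z‖ₑ ^ 2 ∂μ) atTop (𝓝 0)


lemma pm_convD {u Ψ : Z → ℝ} (hu : LocallyIntegrable u μ) (hΨ : ContDiff ℝ 1 Ψ)
    (hc : HasCompactSupport Ψ) :
    ContDiff ℝ 1 (fun z => ∫ y, u y * Ψ (z - y) ∂μ) ∧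
    ∀ z v, fderiv ℝ (fun z => ∫ y, u y * Ψ (z - y) ∂μ) z v
      = ∫ y, u y * fderiv ℝ Ψ (z - y) v ∂μ := by
  have e : (fun z => ∫ y, u y * Ψ (z - y) ∂μ)
      = convolution u Ψ (ContinuousLinearMap.lsmul ℝ ℝ) μ := by
    ext z; simp [convolution_def]
  rw [e]
  refine ⟨hc.contDiff_convolution_right _ hu hΨ, fun z v => ?_⟩
  rw [(hc.hasFDerivAt_convolution_right (ContinuousLinearMap.lsmul ℝ ℝ) hu hΨ z).fderiv,
    convolution_precompR_apply _ hu (hc.fderiv ℝ) (hΨ.continuous_fderiv (by norm_num))]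
  simp [convolution_def]

lemma pm_bump : ∃ φ : ℕ → ContDiffBump (0:Z), Tendsto (fun n => (φ n).rOut) atTop (𝓝 0) ∧
    (∀ n, (φ n).rOut ≤ 2 * (φ n).rIn) ∧ ∀ n, (φ n).rOut ≤ 1 := by
  have hp : ∀ n : ℕ, (0:ℝ) < 1 / ((n:ℝ) + 1) := fun n => by positivity
  refine ⟨fun n => ⟨1 / ((n:ℝ) + 1) / 2, 1 / ((n:ℝ) + 1), by have := hp n; linarith,
    by have := hp n; linarith⟩, tendsto_one_div_add_atTop_nhds_zero_nat, fun n => ?_, fun n => ?_⟩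
  · simp only; linarith
  · simp only; rw [div_le_one (by positivity)]; simp

lemma pm_locint {u : Z → ℝ} (hm : Measurable u) {M : ℝ} (hM : ∀ z, |u z| ≤ M) :
    LocallyIntegrable u μ := by
  have : MemLp u ⊤ μ := memLp_top_of_bound hm.aestronglyMeasurable M (ae_of_all _ hM)
  exact this.locallyIntegrable (by norm_num)

lemma adm_of_weak {ι : E →L[ℝ] Z} {U : Z → ℝ} {g : Z → E} {K : Set Z} {M : ℝ}
    (hU : Measurable U) (hM : ∀ z, |U z| ≤ M) (hK : IsCompact K) (hUK : ∀ z, z ∉ K → U z = 0)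
    (hgm : Measurable g) (hg : MemLp g 2 μ)
    (hw : ∀ ζ : Z → ℝ, ContDiff ℝ 1 ζ → HasCompactSupport ζ → ∀ v : E,
      ∫ z, U z * fderiv ℝ ζ z (ι v) ∂μ = - ∫ z, inner ℝ (g z) v * ζ z ∂μ) :
    Adm μ ι U g := by
  obtain ⟨φ, hφ0, hφ2, hφ1⟩ := pm_bump (Z := Z)
  have hUl : LocallyIntegrable U μ := pm_locint hU hM
  have hM0 : 0 ≤ M := (abs_nonneg _).trans (hM 0)
  have hη : ∀ n, ContDiff ℝ 1 ((φ n).normed μ) := fun n => (φ n).contDiff_normed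
  have hηc : ∀ n, HasCompactSupport ((φ n).normed μ) := fun n => (φ n).hasCompactSupport_normed
  have hcv := fun n => pm_convD hUl (hη n) (hηc n)
  refine ⟨Metric.cthickening 1 K, hK.cthickening, M,
    fun n z => ∫ y, U y * (φ n).normed μ (z - y) ∂μ, fun n => (hcv n).1, ?_, ?_, ?_, hg, ?_⟩
  · intro n z hz
    refine integral_eq_zero_of_ae (ae_of_all _ fun y => ?_)
    show _ = (0:ℝ)
    by_cases hy : y ∈ K
    · have : (φ n).normed μ (z - y) = 0 := by
        by_contra h
        have h2 : z - y ∈ Metric.ball (0:Z) (φ n).rOut := by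
          rw [← (φ n).support_normed_eq (μ := μ)]; exact h
        apply hz
        apply Metric.mem_cthickening_of_dist_le z y 1 K hy
        rw [dist_eq_norm]
        have := hφ1 n
        simp at h2; linarith
      simp [this]
    · simp [hUK y hy]
  · intro n z
    rw [← Real.norm_eq_abs]
    have hi : Integrable (fun y => (φ n).normed μ (z - y)) μ :=
      (φ n).integrable_normed.comp_sub_left z
    calc _ ≤ ∫ y, M * (φ n).normed μ (z - y) ∂μ := by
          refine norm_integral_le_of_norm_le (hi.const_mul M) (ae_of_all _ fun y => ?_)
          rw [norm_mul, Real.norm_eq_abs, Real.norm_eq_abs, abs_of_nonneg ((φ n).nonneg_normed _)]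
          exact mul_le_mul_of_nonneg_right (hM y) ((φ n).nonneg_normed _)
      _ = M := by
          rw [integral_const_mul, integral_sub_left_eq_self (fun y => (φ n).normed μ y) μ z,
            (φ n).integral_normed, mul_one]
  · have := ContDiffBump.ae_convolution_tendsto_right_of_locallyIntegrable (μ := μ) hφ0
      (Eventually.of_forall hφ2) hUl
    filter_upwards [this] with z hz
    refine hz.congr fun n => ?_
    rw [convolution_eq_swap]
    simp [mul_comm]
  · refine (pm_moll hgm hg φ hφ0).congr fun n => lintegral_congr fun z => ?_
    congr 2; congr 1
    have hgl : LocallyIntegrable g μ := hg.locallyIntegrable (by norm_num)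
    have hint : Integrable (fun y => (φ n).normed μ y • g (z - y)) μ :=
      (hηc n).convolutionExists_left (ContinuousLinearMap.lsmul ℝ ℝ) (hη n).continuous hgl z
    refine ext_inner_right ℝ fun v => ?_
    rw [inner_gx, (hcv n).2, ← integral_sub_left_eq_self _ μ z]
    have hint2 := hint.comp_sub_left z
    simp only [_root_.sub_sub_cancel] at hint2 ⊢
    rw [← real_inner_comm, ← integral_inner hint2]
    have h1 := hw (fun y => (φ n).normed μ (z - y)) ((hη n).comp (by fun_prop))
      ((hηc n).comp_homeomorph (Homeomorph.subLeft z)) v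
    have h2 : ∀ y, fderiv ℝ (fun y => (φ n).normed μ (z - y)) y (ι v)
        = - fderiv ℝ ((φ n).normed μ) (z - y) (ι v) := by
      intro y
      have := (((hη n).differentiable (by norm_num)) (z - y)).hasFDerivAt.comp y
        ((hasFDerivAt_id y).const_sub z)
      have h3 : fderiv ℝ (fun y => (φ n).normed μ (z - y)) y = _ := this.fderiv
      rw [h3]; simp
    simp only [h2, mul_neg, integral_neg, neg_inj] at h1
    rw [h1]
    congr 1; ext y
    rw [inner_smul_right, real_inner_comm, mul_comm]

lemma l2_add {a b : ℕ → Z → E} (ha : ∀ n, AEStronglyMeasurable (a n) μ)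
    (h1 : Tendsto (fun n => ∫⁻ z, ‖a n z‖ₑ ^ 2 ∂μ) atTop (𝓝 0))
    (h2 : Tendsto (fun n => ∫⁻ z, ‖b n z‖ₑ ^ 2 ∂μ) atTop (𝓝 0)) :
    Tendsto (fun n => ∫⁻ z, ‖a n z + b n z‖ₑ ^ 2 ∂μ) atTop (𝓝 0) := by
  have h : Tendsto (fun n => 2 * (∫⁻ z, ‖a n z‖ₑ ^ 2 ∂μ + ∫⁻ z, ‖b n z‖ₑ ^ 2 ∂μ)) atTop (𝓝 0) := by
    simpa using ENNReal.Tendsto.const_mul (a := 2) (h1.add h2) (Or.inr (by norm_num))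
  refine tendsto_of_tendsto_of_tendsto_of_le_of_le tendsto_const_nhds h (fun n => bot_le)
    fun n => ?_
  simp only
  rw [← lintegral_add_left' ((ha n).enorm.pow_const 2), ← lintegral_const_mul' _ _ (by norm_num)]
  refine lintegral_mono fun z => ?_
  calc ‖a n z + b n z‖ₑ ^ 2 ≤ (‖a n z‖ₑ + ‖b n z‖ₑ) ^ 2 := by gcongr; exact enorm_add_le _ _
    _ ≤ _ := by
      have := ENNReal.rpow_add_le_mul_rpow_add_rpow (‖a n z‖ₑ) (‖b n z‖ₑ) (p := 2) (by norm_num)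
      norm_num at this
      exact this

lemma l2_smul {c : ℕ → Z → ℝ} {a : ℕ → Z → E} {C : ℝ} (hc : ∀ n z, |c n z| ≤ C)
    (h1 : Tendsto (fun n => ∫⁻ z, ‖a n z‖ₑ ^ 2 ∂μ) atTop (𝓝 0)) :
    Tendsto (fun n => ∫⁻ z, ‖c n z • a n z‖ₑ ^ 2 ∂μ) atTop (𝓝 0) := by
  have h : Tendsto (fun n => (ENNReal.ofReal C) ^ 2 * (∫⁻ z, ‖a n z‖ₑ ^ 2 ∂μ)) atTop (𝓝 0) := by
    simpa using ENNReal.Tendsto.const_mul (a := (ENNReal.ofReal C) ^ 2) h1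
      (Or.inr (ENNReal.pow_ne_top ENNReal.ofReal_ne_top))
  refine tendsto_of_tendsto_of_tendsto_of_le_of_le tendsto_const_nhds h (fun n => bot_le)
    fun n => ?_
  simp only
  rw [← lintegral_const_mul' _ _ (ENNReal.pow_ne_top ENNReal.ofReal_ne_top)]
  refine lintegral_mono fun z => ?_
  rw [enorm_smul, mul_pow]
  gcongr
  rw [Real.enorm_eq_ofReal_abs]
  exact ENNReal.ofReal_le_ofReal (hc n z)

lemma l2_dct {c : ℕ → Z → ℝ} {c0 : Z → ℝ} {w : Z → E} {C : ℝ} (hw : MemLp w 2 μ)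
    (hcm : ∀ n, AEStronglyMeasurable (c n) μ) (hc0 : AEStronglyMeasurable c0 μ)
    (hc : ∀ n z, |c n z| ≤ C) (hc0b : ∀ᵐ z ∂μ, |c0 z| ≤ C)
    (h : ∀ᵐ z ∂μ, Tendsto (fun n => c n z) atTop (𝓝 (c0 z))) :
    Tendsto (fun n => ∫⁻ z, ‖(c n z - c0 z) • w z‖ₑ ^ 2 ∂μ) atTop (𝓝 0) := by
  have hC : ENNReal.ofReal (2 * C) ^ 2 ≠ ⊤ := ENNReal.pow_ne_top ENNReal.ofReal_ne_top
  have hfin : ∫⁻ z, ‖w z‖ₑ ^ 2 ∂μ ≠ ⊤ := by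
    have := hw.eLpNorm_lt_top
    have h2 := lintegral_rpow_enorm_lt_top_of_eLpNorm_lt_top (by norm_num) (by norm_num) this
    simpa using h2.ne
  have key := tendsto_lintegral_of_dominated_convergence' (μ := μ)
    (F := fun n z => ‖(c n z - c0 z) • w z‖ₑ ^ 2) (f := fun _ => 0)
    (fun z => ENNReal.ofReal (2 * C) ^ 2 * ‖w z‖ₑ ^ 2)
    (fun n => ((((hcm n).sub hc0).smul hw.1).enorm).pow_const 2) ?_ ?_ ?_
  · simpa using key
  · intro n
    filter_upwards [hc0b] with z hz
    rw [enorm_smul, mul_pow]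
    gcongr
    rw [Real.enorm_eq_ofReal_abs]
    refine ENNReal.ofReal_le_ofReal ?_
    have := hc n z
    have h3 := abs_sub (c n z) (c0 z)
    linarith
  · rw [lintegral_const_mul' _ _ hC]
    exact ENNReal.mul_ne_top hC hfin
  · filter_upwards [h] with z hz
    have h1 : Tendsto (fun n => (c n z - c0 z) • w z) atTop (𝓝 ((c0 z - c0 z) • w z)) :=
      (hz.sub_const _).smul_const _
    have h2 := (continuous_enorm.tendsto _).comp h1
    have h3 := ((ENNReal.continuous_pow 2).tendsto _).comp h2
    simpa [Function.comp_def] using h3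

lemma gx_cpt_memLp (ι : E →L[ℝ] Z) {φ : Z → ℝ} (h : ContDiff ℝ 1 φ) (hc : HasCompactSupport φ) :
    HasCompactSupport (gx ι φ) ∧ MemLp (gx ι φ) 2 μ := by
  have : HasCompactSupport (gx ι φ) :=
    HasCompactSupport.intro hc fun z hz => gx_zero ι hz
  exact ⟨this, (continuous_gx ι h).memLp_of_hasCompactSupport this⟩

lemma Adm.sub {ι : E →L[ℝ] Z} {Ψ₁ Ψ₂ : Z → ℝ} {G₁ G₂ : Z → E} (h₁ : Adm μ ι Ψ₁ G₁)
    (h₂ : Adm μ ι Ψ₂ G₂) : Adm μ ι (fun z => Ψ₁ z - Ψ₂ z) (fun z => G₁ z - G₂ z) := by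
  obtain ⟨K, hK, M, P, hP, hPK, hPM, hPt, hG, hGt⟩ := h₁
  obtain ⟨K', hK', M', P', hP', hPK', hPM', hPt', hG', hGt'⟩ := h₂
  refine ⟨K ∪ K', hK.union hK', M + M', fun n z => P n z - P' n z, fun n => (hP n).sub (hP' n),
    fun n z hz => ?_, fun n z => ?_, ?_, hG.sub hG', ?_⟩
  · rw [mem_union, not_or] at hz
    show P n z - P' n z = 0
    rw [hPK n z hz.1, hPK' n z hz.2, sub_zero]
  · exact (abs_sub _ _).trans (add_le_add (hPM n z) (hPM' n z))
  · filter_upwards [hPt, hPt'] with z h1 h2 using h1.sub h2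
  · have h3 := l2_smul (c := fun _ _ => -1) (C := 1) (by simp) hGt'
    refine (l2_add (fun n => ((continuous_gx ι (hP n)).aestronglyMeasurable.sub hG.1)) hGt
      h3).congr fun n => lintegral_congr fun z => ?_
    congr 2
    have : gx ι (fun z => P n z - P' n z) z = gx ι (P n) z - gx ι (P' n) z := by
      refine ext_inner_right ℝ fun v => ?_
      rw [inner_sub_left, inner_gx, inner_gx, inner_gx,
        fderiv_fun_sub ((hP n).differentiable (by norm_num) z)
          ((hP' n).differentiable (by norm_num) z)]
      simp
    rw [this, neg_smul, one_smul, Pi.sub_apply, sub_sub_sub_comm]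
    abel

lemma Adm.comp {ι : E →L[ℝ] Z} {Ψ : Z → ℝ} {G : Z → E} (h : Adm μ ι Ψ G) {p : ℝ → ℝ}
    {φ : Z → ℝ} (hp : ContDiff ℝ 1 p) (hφ : ContDiff ℝ 1 φ) (hc : HasCompactSupport φ) :
    Adm μ ι (fun z => p (Ψ z) * φ z)
      (fun z => (deriv p (Ψ z) * φ z) • G z + p (Ψ z) • gx ι φ z) := by
  obtain ⟨K, hK, M, P, hP, hPK, hPM, hPt, hG, hGt⟩ := h
  have hp' : Continuous (deriv p) := hp.continuous_deriv (by norm_num)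
  obtain ⟨A, hA⟩ := (isCompact_Icc (a := -M) (b := M)).exists_bound_of_continuousOn
    hp.continuous.continuousOn
  obtain ⟨A', hA'⟩ := (isCompact_Icc (a := -M) (b := M)).exists_bound_of_continuousOn
    hp'.continuousOn
  obtain ⟨B, hB⟩ := hφ.continuous.bounded_above_of_compact_support hc
  have hMem : ∀ n z, P n z ∈ Icc (-M) M := fun n z => abs_le.1 (hPM n z)
  have hMem0 : ∀ᵐ z ∂μ, Ψ z ∈ Icc (-M) M := by
    filter_upwards [hPt] with z hz
    exact isClosed_Icc.mem_of_tendsto hz (Eventually.of_forall fun n => hMem n z)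
  have hΨ : AEMeasurable Ψ μ :=
    aemeasurable_of_tendsto_metrizable_ae atTop (fun n => (hP n).continuous.aemeasurable) hPt
  have hpΨ : AEStronglyMeasurable (fun z => p (Ψ z)) μ :=
    (hp.continuous.measurable.comp_aemeasurable hΨ).aestronglyMeasurable
  have hpΨ' : AEStronglyMeasurable (fun z => deriv p (Ψ z)) μ :=
    (hp'.measurable.comp_aemeasurable hΨ).aestronglyMeasurable
  have hgφ := (gx_cpt_memLp (μ := μ) ι hφ hc).2
  have hB0 : 0 ≤ B := (norm_nonneg _).trans (hB 0)
  have hA0 : 0 ≤ A := (norm_nonneg _).trans (hA _ (hMem 0 0))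
  have hA0' : 0 ≤ A' := (norm_nonneg _).trans (hA' _ (hMem 0 0))
  have hc1 : ∀ n z, |deriv p (P n z) * φ z| ≤ A' * B := fun n z => by
    rw [abs_mul]
    exact mul_le_mul (hA' _ (hMem n z)) (hB z) (abs_nonneg _) hA0'
  refine ⟨tsupport φ, hc, A * B, fun n z => p (P n z) * φ z, fun n => (hp.comp (hP n)).mul hφ,
    fun n z hz => ?_, fun n z => ?_, ?_, ?_, ?_⟩
  · show p (P n z) * φ z = 0
    rw [image_eq_zero_of_notMem_tsupport hz, mul_zero]
  · rw [abs_mul]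
    exact mul_le_mul (hA _ (hMem n z)) (hB z) (abs_nonneg _) hA0
  · filter_upwards [hPt] with z hz
    exact ((hp.continuous.tendsto _).comp hz).mul_const _
  · refine MemLp.add (MemLp.of_le_mul (c := A' * B) hG ?_ ?_)
      (MemLp.of_le_mul (c := A) hgφ ?_ ?_)
    · exact (hpΨ'.mul hφ.continuous.aestronglyMeasurable).smul hG.1
    · filter_upwards [hMem0] with z hz
      rw [norm_smul, norm_mul]
      exact mul_le_mul_of_nonneg_right (mul_le_mul (hA' _ hz) (hB z) (norm_nonneg _) hA0')
        (norm_nonneg _)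
    · exact hpΨ.smul hgφ.1
    · filter_upwards [hMem0] with z hz
      rw [norm_smul]
      exact mul_le_mul_of_nonneg_right (hA _ hz) (norm_nonneg _)
  · have m1 : ∀ n, AEStronglyMeasurable (fun z => deriv p (P n z)) μ := fun n =>
      (hp'.comp (hP n).continuous).aestronglyMeasurable
    have m2 : ∀ n, AEStronglyMeasurable (fun z => p (P n z)) μ := fun n =>
      (hp.continuous.comp (hP n).continuous).aestronglyMeasurable
    have t1 := l2_smul hc1 hGt
    have t2 := l2_dct (C := A' * B) (c0 := fun z => deriv p (Ψ z) * φ z) hG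
      (fun n => (m1 n).mul hφ.continuous.aestronglyMeasurable)
      (hpΨ'.mul hφ.continuous.aestronglyMeasurable) hc1
      (by
        filter_upwards [hMem0] with z hz
        rw [abs_mul]
        exact mul_le_mul (hA' _ hz) (hB z) (abs_nonneg _) hA0')
      (by
        filter_upwards [hPt] with z hz
        exact ((hp'.tendsto _).comp hz).mul_const _)
    have t3 := l2_dct (C := A) (c0 := fun z => p (Ψ z)) hgφ m2 hpΨ (fun n z => hA _ (hMem n z))
      (by filter_upwards [hMem0] with z hz using hA _ hz)
      (by filter_upwards [hPt] with z hz using (hp.continuous.tendsto _).comp hz)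
    have s1 : ∀ n, AEStronglyMeasurable
        (fun z => (deriv p (P n z) * φ z) • (gx ι (P n) z - G z)) μ := fun n =>
      ((m1 n).mul hφ.continuous.aestronglyMeasurable).smul
        ((continuous_gx ι (hP n)).aestronglyMeasurable.sub hG.1)
    have s2 : ∀ n, AEStronglyMeasurable
        (fun z => (deriv p (P n z) * φ z - deriv p (Ψ z) * φ z) • G z) μ := fun n =>
      (((m1 n).mul hφ.continuous.aestronglyMeasurable).sub
        (hpΨ'.mul hφ.continuous.aestronglyMeasurable)).smul hG.1
    refine (l2_add s1 t1 (l2_add s2 t2 t3)).congr fun n => lintegral_congr fun z => ?_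
    congr 2
    have : gx ι (fun z => p (P n z) * φ z) z
        = (deriv p (P n z) * φ z) • gx ι (P n) z + p (P n z) • gx ι φ z := by
      refine ext_inner_right ℝ fun v => ?_
      have d1 : HasFDerivAt (fun z => p (P n z)) (deriv p (P n z) • fderiv ℝ (P n) z) z :=
        ((hp.differentiable (by norm_num) (P n z)).hasDerivAt).comp_hasFDerivAt z
          ((hP n).differentiable (by norm_num) z).hasFDerivAt
      have d2 := HasFDerivAt.fun_mul d1 (hφ.differentiable (by norm_num) z).hasFDerivAt
      rw [inner_add_left, inner_smul_left, inner_smul_left, inner_gx, inner_gx, inner_gx,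
        HasFDerivAt.fderiv d2]
      simp; ring
    simp only [this, sub_smul, smul_sub]
    rw [← add_assoc, sub_add_sub_cancel, add_sub_add_comm]

lemma pm_cutoff {K Ω : Set Z} (hK : IsCompact K) (hΩ : IsOpen Ω) (h : K ⊆ Ω) :
    ∃ χ : Z → ℝ, ContDiff ℝ 1 χ ∧ HasCompactSupport χ ∧ tsupport χ ⊆ Ω ∧ (∀ z ∈ K, χ z = 1) ∧
      ∀ z, χ z ∈ Icc (0:ℝ) 1 := by
  obtain ⟨L, hL, hKL, hLΩ⟩ := exists_compact_between hK hΩ h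
  obtain ⟨f, hf0, hf1, hf⟩ := exists_contMDiffMap_zero_one_of_isClosed (n := 1)
    (modelWithCornersSelf ℝ Z) (isOpen_interior (s := L)).isClosed_compl hK.isClosed
    (disjoint_compl_left_iff_subset.2 hKL)
  have hs : tsupport f ⊆ L := by
    refine closure_minimal (fun z hz => ?_) hL.isClosed
    by_contra hzL
    exact hz (hf0 (fun h => hzL (interior_subset h)))
  exact ⟨f, f.contMDiff.contDiff, HasCompactSupport.of_support_subset_isCompact hL
    (subset_tsupport _ |>.trans hs), hs.trans hLΩ, fun z hz => hf1 hz, hf⟩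

lemma pm_int1 {u ψ : Z → ℝ} (hu : LocallyIntegrable u μ) (hψ : Continuous ψ)
    (hc : HasCompactSupport ψ) : Integrable (fun z => u z * ψ z) μ := by
  simpa [mul_comm] using hu.integrable_smul_left_of_hasCompactSupport hψ hc

lemma l2loc_locint {g : Z → E} (h : ∀ K, IsCompact K → MemLp g 2 (μ.restrict K)) :
    LocallyIntegrable g μ := by
  rw [locallyIntegrable_iff]
  intro K hK
  have : Fact (μ K < ⊤) := ⟨hK.measure_lt_top⟩
  exact (h K hK).integrable (by norm_num)

lemma fderiv_cpt {ψ : Z → ℝ} (h : ContDiff ℝ 1 ψ) (hc : HasCompactSupport ψ) (e : Z) :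
    Continuous (fun z => fderiv ℝ ψ z e) ∧ HasCompactSupport (fun z => fderiv ℝ ψ z e) :=
  ⟨(h.continuous_fderiv (by norm_num)).clm_apply continuous_const, hc.fderiv_apply ℝ e⟩

/-- `g` is the weak gradient of the bounded function `U` on `Ω`. -/
def WG (μ : Measure Z) (ι : E →L[ℝ] Z) (Ω : Set Z) (U : Z → ℝ) (g : Z → E) : Prop :=
  Measurable U ∧ (∃ M, ∀ z, |U z| ≤ M) ∧ Measurable g ∧
  (∀ K, IsCompact K → MemLp g 2 (μ.restrict K)) ∧
  ∀ ζ : Z → ℝ, ContDiff ℝ 1 ζ → HasCompactSupport ζ → tsupport ζ ⊆ Ω → ∀ v : E,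
      ∫ z, U z * fderiv ℝ ζ z (ι v) ∂μ = - ∫ z, inner ℝ (g z) v * ζ z ∂μ

lemma WG.loc {ι : E →L[ℝ] Z} {Ω : Set Z} {U : Z → ℝ} {g : Z → E} (h : WG μ ι Ω U g)
    {χ : Z → ℝ} (hχ : ContDiff ℝ 1 χ) (hc : HasCompactSupport χ) (hs : tsupport χ ⊆ Ω) :
    Adm μ ι (fun z => χ z * U z) (fun z => χ z • g z + U z • gx ι χ z) := by
  obtain ⟨hU, ⟨M, hM⟩, hg, hgl, hw⟩ := h
  obtain ⟨B, hB⟩ := hχ.continuous.bounded_above_of_compact_support hc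
  have hB0 : 0 ≤ B := (norm_nonneg _).trans (hB 0)
  have hgχ := gx_cpt_memLp (μ := μ) ι hχ hc
  have hUl : LocallyIntegrable U μ := pm_locint hU hM
  refine adm_of_weak (K := tsupport χ) (M := B * M) ?_ ?_ hc ?_ ?_ ?_ ?_
  · exact hχ.continuous.measurable.mul hU
  · intro z
    rw [abs_mul]
    exact mul_le_mul (hB z) (hM z) (abs_nonneg _) hB0
  · intro z hz
    rw [image_eq_zero_of_notMem_tsupport hz, zero_mul]
  · exact (hχ.continuous.measurable.smul hg).add
      (hU.smul (continuous_gx ι hχ).measurable)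
  · refine MemLp.add ?_ (MemLp.of_le_mul (c := M) hgχ.2 ?_ ?_)
    · have e : (fun z => χ z • g z) = (tsupport χ).indicator (fun z => χ z • g z) := by
        symm
        rw [indicator_eq_self]
        intro z hz
        by_contra h
        apply hz
        simp only [image_eq_zero_of_notMem_tsupport h, zero_smul]
      rw [e, memLp_indicator_iff_restrict (isClosed_tsupport χ).measurableSet]
      refine MemLp.of_le_mul (c := B) (hgl _ hc)
        (hχ.continuous.measurable.smul hg).aestronglyMeasurable (ae_of_all _ fun z => ?_)
      rw [norm_smul]
      exact mul_le_mul_of_nonneg_right (hB z) (norm_nonneg _)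
    · exact (hU.smul (continuous_gx ι hχ).measurable).aestronglyMeasurable
    · refine ae_of_all _ fun z => ?_
      rw [norm_smul]
      exact mul_le_mul_of_nonneg_right (hM z) (norm_nonneg _)
  · intro ζ hζ hζc v
    have h1 := hw (fun z => χ z * ζ z) (hχ.mul hζ) hζc.mul_left
      ((tsupport_mul_subset_left).trans hs) v
    have hd : ∀ z, fderiv ℝ (fun z => χ z * ζ z) z (ι v)
        = χ z * fderiv ℝ ζ z (ι v) + inner ℝ (gx ι χ z) v * ζ z := by
      intro z
      rw [inner_gx, fderiv_fun_mul (hχ.differentiable (by norm_num) z)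
        (hζ.differentiable (by norm_num) z)]
      simp; ring
    have hζ' := fderiv_cpt hζ hζc (ι v)
    have i1 : Integrable (fun z => U z * (χ z * fderiv ℝ ζ z (ι v))) μ :=
      pm_int1 hUl (hχ.continuous.mul hζ'.1) hζ'.2.mul_left
    have i2 : Integrable (fun z => U z * (inner ℝ (gx ι χ z) v * ζ z)) μ :=
      pm_int1 hUl (((continuous_gx ι hχ).inner continuous_const).mul hζ.continuous) hζc.mul_left
    have hgv : LocallyIntegrable (fun z => inner ℝ (g z) v) μ := by
      rw [locallyIntegrable_iff]
      intro K hK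
      exact ((locallyIntegrable_iff.1 (l2loc_locint hgl)) K hK).inner_const v
    have i3 : Integrable (fun z => inner ℝ (g z) v * (χ z * ζ z)) μ :=
      pm_int1 hgv (hχ.continuous.mul hζ.continuous) hζc.mul_left
    simp only [hd, mul_add] at h1
    rw [integral_add i1 i2] at h1
    have e2 : ∫ z, inner ℝ (χ z • g z + U z • gx ι χ z) v * ζ z ∂μ
        = ∫ z, inner ℝ (g z) v * (χ z * ζ z) ∂μ
          + ∫ z, U z * (inner ℝ (gx ι χ z) v * ζ z) ∂μ := by
      rw [← integral_add i3 i2]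
      congr 1; ext z
      rw [inner_add_left, inner_smul_left, inner_smul_left]
      simp; ring
    rw [e2]
    have e1 : ∫ z, χ z * U z * fderiv ℝ ζ z (ι v) ∂μ
        = ∫ z, U z * (χ z * fderiv ℝ ζ z (ι v)) ∂μ := by
      congr 1; ext z; ring
    rw [e1]; linarith

lemma adm_main {ι : E →L[ℝ] Z} {Ω : Set Z} (hΩ : IsOpen Ω) {U₁ U₂ : Z → ℝ} {g₁ g₂ : Z → E}
    (h₁ : WG μ ι Ω U₁ g₁) (h₂ : WG μ ι Ω U₂ g₂) {p : ℝ → ℝ} {φ : Z → ℝ} (hp : ContDiff ℝ 1 p)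
    (hφ : ContDiff ℝ 1 φ) (hc : HasCompactSupport φ) (hs : tsupport φ ⊆ Ω) :
    Adm μ ι (fun z => p (U₁ z - U₂ z) * φ z)
      (fun z => (deriv p (U₁ z - U₂ z) * φ z) • (g₁ z - g₂ z) + p (U₁ z - U₂ z) • gx ι φ z) := by
  obtain ⟨χ, hχ, hχc, hχs, hχ1, -⟩ := pm_cutoff hc hΩ hs
  have h := ((h₁.loc hχ hχc hχs).sub (h₂.loc hχ hχc hχs)).comp hp hφ hc
  have h1 : ∀ z, z ∈ tsupport φ → χ z = 1 := hχ1
  have hg : ∀ z, φ z ≠ 0 → gx ι χ z = 0 := by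
    intro z hz
    have : χ =ᶠ[𝓝 z] fun _ => 1 := by
      filter_upwards [hφ.continuous.isOpen_support.mem_nhds hz] with y hy
      exact h1 y (subset_tsupport _ hy)
    refine ext_inner_right ℝ fun v => ?_
    rw [inner_gx, this.fderiv_eq]
    simp
  convert h using 2 with z z
  · by_cases hz : z ∈ tsupport φ
    · rw [h1 z hz, one_mul, one_mul]
    · rw [image_eq_zero_of_notMem_tsupport hz, mul_zero, mul_zero]
  · by_cases hz : z ∈ tsupport φ
    · by_cases hz' : φ z = 0
      · simp [hz', h1 z hz]
      · simp [h1 z hz, hg z hz']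
    · simp [gx_zero ι hz, image_eq_zero_of_notMem_tsupport hz]

lemma adm_diff {ι : E →L[ℝ] Z} {G w : Z → E} {K : Set Z} (hK : IsCompact K) {P : Z → ℝ}
    (hP : ContDiff ℝ 1 P) (hPK : ∀ z, z ∉ K → P z = 0) (hG : AEStronglyMeasurable G μ)
    (hG0 : ∀ᵐ z ∂μ, z ∉ K → G z = 0) (hw : AEStronglyMeasurable w μ) :
    ‖∫ z, inner ℝ (w z) (gx ι P z - G z) ∂μ‖ₑ ^ 2
      ≤ (∫⁻ z in K, ‖w z‖ₑ ^ 2 ∂μ) * ∫⁻ z, ‖gx ι P z - G z‖ₑ ^ 2 ∂μ := by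
  have hgP : ∀ z, z ∉ K → gx ι P z = 0 := fun z hz =>
    gx_zero ι fun h => hz (closure_minimal (fun y hy => by
      by_contra hyK; exact hy (hPK y hyK)) hK.isClosed h)
  have e : ∫ z, inner ℝ (w z) (gx ι P z - G z) ∂μ
      = ∫ z in K, inner ℝ (w z) (gx ι P z - G z) ∂μ := by
    symm
    refine setIntegral_eq_integral_of_ae_compl_eq_zero ?_
    filter_upwards [hG0] with z hz hzK
    rw [hgP z hzK, hz hzK, sub_zero, inner_zero_right]
  rw [e]
  refine (pm_cs hw.restrict
    ((continuous_gx ι hP).aestronglyMeasurable.sub hG).restrict).trans ?_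
  refine mul_le_mul_right ?_ _
  exact lintegral_mono' Measure.restrict_le_self le_rfl

lemma adm_G0 {ι : E →L[ℝ] Z} {G : Z → E} {K : Set Z} (hK : IsCompact K) {P : ℕ → Z → ℝ}
    (hP : ∀ n, ContDiff ℝ 1 (P n)) (hPK : ∀ n z, z ∉ K → P n z = 0) (hG : MemLp G 2 μ)
    (ht : Tendsto (fun n => ∫⁻ z, ‖gx ι (P n) z - G z‖ₑ ^ 2 ∂μ) atTop (𝓝 0)) :
    ∀ᵐ z ∂μ, z ∉ K → G z = 0 := by
  have hgP : ∀ n z, z ∉ K → gx ι (P n) z = 0 := fun n z hz =>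
    gx_zero ι fun h => hz (closure_minimal (fun y hy => by
      by_contra hyK; exact hy (hPK n y hyK)) hK.isClosed h)
  have h0 : ∫⁻ z in Kᶜ, ‖G z‖ₑ ^ 2 ∂μ ≤ 0 := by
    refine ge_of_tendsto' ht fun n => ?_
    calc _ = ∫⁻ z in Kᶜ, ‖gx ι (P n) z - G z‖ₑ ^ 2 ∂μ := by
          refine setLIntegral_congr_fun hK.isClosed.measurableSet.compl fun z hz => ?_
          simp only [hgP n z hz, zero_sub, enorm_neg]
      _ ≤ _ := by
        gcongr
        exact Measure.restrict_le_self
  rw [nonpos_iff_eq_zero, lintegral_eq_zero_iff' (hG.1.restrict.enorm.pow_const 2)] at h0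
  have := (ae_restrict_iff' hK.isClosed.measurableSet.compl).1 h0
  filter_upwards [this] with z hz hzK
  have := hz hzK
  simpa using this

lemma adm_zero {ι : E →L[ℝ] Z} {Ψ : Z → ℝ} {G : Z → E} (h : Adm μ ι Ψ G) (v : E) :
    ∫ z, inner ℝ v (G z) ∂μ = 0 := by
  obtain ⟨K, hK, M, P, hP, hPK, hPM, hPt, hG, hGt⟩ := h
  have hG0 := adm_G0 hK hP hPK hG hGt
  have hPc : ∀ n, HasCompactSupport (P n) := fun n => HasCompactSupport.intro hK (hPK n)
  have hz : ∀ n, ∫ z, inner ℝ v (gx ι (P n) z) ∂μ = 0 := by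
    intro n
    have hd := fderiv_cpt (hP n) (hPc n) (ι v)
    have := integral_mul_fderiv_eq_neg_fderiv_mul_of_integrable (μ := μ) (f := fun _ => (1:ℝ))
      (g := P n) (v := ι v) (by simp) (by simpa using hd.1.integrable_of_hasCompactSupport hd.2)
      (by simpa using (hP n).continuous.integrable_of_hasCompactSupport (hPc n))
      (fun _ _ => by fun_prop) (fun z _ => (hP n).differentiable (by norm_num) z)
    simp at this
    rw [← this]
    congr 1; ext z
    rw [real_inner_comm, inner_gx]
  have hGi : Integrable (fun z => inner ℝ v (G z)) μ := by
    have e : (fun z => inner ℝ v (G z)) =ᵐ[μ] K.indicator (fun z => inner ℝ v (G z)) := by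
      filter_upwards [hG0] with z hz
      by_cases hzK : z ∈ K
      · simp [hzK]
      · simp [hzK, hz hzK]
    rw [integrable_congr e, integrable_indicator_iff hK.isClosed.measurableSet]
    have := locallyIntegrable_iff.1 (hG.locallyIntegrable (by norm_num)) K hK
    exact Integrable.const_inner v this
  have hle : ∀ n, ‖∫ z, inner ℝ v (G z) ∂μ‖ₑ ^ 2 ≤
      (∫⁻ z in K, ‖v‖ₑ ^ 2 ∂μ) * ∫⁻ z, ‖gx ι (P n) z - G z‖ₑ ^ 2 ∂μ := by
    intro n
    have := adm_diff (ι := ι) (w := fun _ => v) hK (hP n) (hPK n) hG.1 hG0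
      aestronglyMeasurable_const
    refine le_trans (le_of_eq ?_) this
    have hi : Integrable (fun z => inner ℝ v (gx ι (P n) z)) μ :=
      ((continuous_const.inner (continuous_gx ι (hP n)))).integrable_of_hasCompactSupport
        (HasCompactSupport.intro (hPc n) fun z hz => by simp [gx_zero ι hz])
    simp only [inner_sub_right]
    rw [integral_sub hi hGi, hz n, zero_sub, enorm_neg]
  have hlim : Tendsto (fun n => (∫⁻ z in K, ‖v‖ₑ ^ 2 ∂μ) * ∫⁻ z, ‖gx ι (P n) z - G z‖ₑ ^ 2 ∂μ)
      atTop (𝓝 0) := by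
    have := ENNReal.Tendsto.const_mul (a := ∫⁻ z in K, ‖v‖ₑ ^ 2 ∂μ) hGt (Or.inr (by
      rw [lintegral_const, Measure.restrict_apply_univ]
      exact ENNReal.mul_ne_top (by simp) hK.measure_lt_top.ne))
    simpa using this
  have := ge_of_tendsto' hlim hle
  simpa using this

lemma l2loc_shift {g : Z → E} (h : ∀ K, IsCompact K → MemLp g 2 (μ.restrict K)) (a : Z) :
    ∀ K, IsCompact K → MemLp (fun z => g (z + a)) 2 (μ.restrict K) := by
  intro K hK
  have hS : IsCompact ((fun z => z + a) '' K) := hK.image (by fun_prop)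
  have hp : (fun z => z + a) ⁻¹' ((fun z => z + a) '' K) = K :=
    preimage_image_eq K (add_left_injective a)
  have hmp := (measurePreserving_add_right μ a).restrict_preimage hS.isClosed.measurableSet
  rw [hp] at hmp
  exact (h _ hS).comp_measurePreserving hmp

lemma l2_inner_int {w G : Z → E} {K : Set Z} (hK : IsCompact K)
    (hw : MemLp w 2 (μ.restrict K)) (hG : MemLp G 2 μ) (hG0 : ∀ᵐ z ∂μ, z ∉ K → G z = 0) :
    Integrable (fun z => inner ℝ (w z) (G z)) μ := by
  have e : (fun z => inner ℝ (w z) (G z)) =ᵐ[μ] K.indicator (fun z => inner ℝ (w z) (G z)) := by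
    filter_upwards [hG0] with z hz
    by_cases hzK : z ∈ K
    · simp [hzK]
    · simp [hzK, hz hzK]
  rw [integrable_congr e, integrable_indicator_iff hK.isClosed.measurableSet]
  have hG' : MemLp G 2 (μ.restrict K) := hG.restrict K
  refine Integrable.mono' (hw.norm.integrable_mul hG'.norm) (hw.1.inner hG'.1)
    (ae_of_all _ fun z => ?_)
  exact norm_inner_le_norm _ _

lemma lb_int {f Ψ : Z → ℝ} {K : Set Z} {C : ℝ} (hf : AEStronglyMeasurable f μ)
    (hfC : ∀ z ∈ K, |f z| ≤ C) (hΨ : Integrable Ψ μ) (hΨ0 : ∀ᵐ z ∂μ, z ∉ K → Ψ z = 0) :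
    Integrable (fun z => f z * Ψ z) μ ∧ |∫ z, f z * Ψ z ∂μ| ≤ C * ∫ z, |Ψ z| ∂μ := by
  have hb : ∀ᵐ z ∂μ, ‖f z * Ψ z‖ ≤ C * |Ψ z| := by
    filter_upwards [hΨ0] with z hz
    by_cases hzK : z ∈ K
    · rw [norm_mul]
      exact mul_le_mul_of_nonneg_right (hfC z hzK) (abs_nonneg _)
    · simp [hz hzK]
  refine ⟨Integrable.mono' (hΨ.abs.const_mul C) (hf.mul hΨ.1) hb, ?_⟩
  rw [← integral_const_mul]
  exact norm_integral_le_of_norm_le (hΨ.abs.const_mul C) hb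

/-- Weak form of the equation `∂_e u = div g - f`. -/
def WE (μ : Measure Z) (ι : E →L[ℝ] Z) (e : Z) (u : Z → ℝ) (g : Z → E) (f : Z → ℝ) : Prop :=
  Measurable u ∧ (∃ M, ∀ z, |u z| ≤ M) ∧ Measurable g ∧
  (∀ K, IsCompact K → MemLp g 2 (μ.restrict K)) ∧ Measurable f ∧
  (∀ K, IsCompact K → ∃ C, ∀ z ∈ K, |f z| ≤ C) ∧
  ∀ ζ : Z → ℝ, ContDiff ℝ 1 ζ → HasCompactSupport ζ →
      ∫ z, u z * fderiv ℝ ζ z e ∂μ = ∫ z, inner ℝ (g z) (gx ι ζ z) ∂μ + ∫ z, f z * ζ z ∂μ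

lemma fderiv_sub_shift (P : Z → ℝ) (a y : Z) :
    fderiv ℝ (fun y => P (y - a)) y = fderiv ℝ P (y - a) := by
  simp only [sub_eq_add_neg]
  exact fderiv_comp_add_right (-a)

lemma deriv_shift {u P : Z → ℝ} (hu : LocallyIntegrable u μ) (hP : ContDiff ℝ 1 P)
    (hc : HasCompactSupport P) (e : Z) (r : ℝ) :
    HasDerivAt (fun r : ℝ => ∫ z, u (z + r • e) * P z ∂μ)
      (- ∫ y, u y * fderiv ℝ P (y - r • e) e ∂μ) r := by
  have h1 : (fun r : ℝ => ∫ z, u (z + r • e) * P z ∂μ)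
      = fun r : ℝ => (fun z => ∫ y, u y * (fun w => P (-w)) (z - y) ∂μ) (r • e) := by
    ext r
    rw [← integral_sub_right_eq_self _ (r • e)]
    congr 1; ext y
    simp
  have hcn : HasCompactSupport (fun w => P (-w)) := hc.comp_homeomorph (Homeomorph.neg Z)
  have hPn : ContDiff ℝ 1 (fun w => P (-w)) := hP.comp contDiff_neg
  obtain ⟨k1, k2⟩ := pm_convD hu hPn hcn
  rw [h1]
  have h2 : HasDerivAt (fun r : ℝ => r • e) e r := by
    simpa using (hasDerivAt_id r).smul_const e
  have h3 := (k1.differentiable (by norm_num) (r • e)).hasFDerivAt.comp_hasDerivAt r h2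
  rw [k2] at h3
  refine HasDerivAt.congr_deriv h3 ?_
  rw [← integral_neg]
  congr 1; ext y
  have : fderiv ℝ (fun w => P (-w)) (r • e - y) e = - fderiv ℝ P (y - r • e) e := by
    have d := ((hP.differentiable (by norm_num)) (-(r • e - y))).hasFDerivAt.comp (r • e - y)
      ((hasFDerivAt_id (r • e - y)).neg)
    have d' : fderiv ℝ (fun w => P (-w)) (r • e - y) = _ := d.fderiv
    rw [d']; simp
  rw [this, mul_neg]

lemma WE.deriv1 {ι : E →L[ℝ] Z} {e : Z} {u : Z → ℝ} {g : Z → E} {f : Z → ℝ}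
    (h : WE μ ι e u g f) {P : Z → ℝ} (hP : ContDiff ℝ 1 P)
    (hc : HasCompactSupport P) (r : ℝ) :
    HasDerivAt (fun r : ℝ => ∫ z, u (z + r • e) * P z ∂μ)
      (- (∫ z, inner ℝ (g (z + r • e)) (gx ι P z) ∂μ + ∫ z, f (z + r • e) * P z ∂μ)) r := by
  obtain ⟨hu, ⟨M, hM⟩, hg, hgl, hf, hfl, hw⟩ := h
  have h1 := deriv_shift (pm_locint (μ := μ) hu hM) hP hc e r
  have h2 := hw (fun y => P (y - r • e)) (hP.comp (by fun_prop))
    (hc.comp_homeomorph (Homeomorph.subRight (r • e)))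
  have h3 : ∀ y, gx ι (fun y => P (y - r • e)) y = gx ι P (y - r • e) := by
    intro y; simp [gx, fderiv_sub_shift]
  simp only [fderiv_sub_shift, h3] at h2
  rw [h2] at h1
  convert h1 using 3
  · rw [← integral_sub_right_eq_self _ (r • e)]
    simp
  · rw [← integral_sub_right_eq_self _ (r • e)]
    simp

lemma WE.deriv {ι : E →L[ℝ] Z} {e : Z} {u : Z → ℝ} {g : Z → E} {f : Z → ℝ}
    (h : WE μ ι e u g f) {Ψ : Z → ℝ} {G : Z → E} (hA : Adm μ ι Ψ G) (r₀ : ℝ) :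
    HasDerivAt (fun r : ℝ => ∫ z, u (z + r • e) * Ψ z ∂μ)
      (- (∫ z, inner ℝ (g (z + r₀ • e)) (G z) ∂μ + ∫ z, f (z + r₀ • e) * Ψ z ∂μ)) r₀ := by
  have hWE := h
  obtain ⟨hu, ⟨M, hM⟩, hg, hgl, hf, hfl, hw⟩ := h
  obtain ⟨K, hK, N, P, hP, hPK, hPN, hPt, hG, hGt⟩ := hA
  have hPc : ∀ n, HasCompactSupport (P n) := fun n => HasCompactSupport.intro hK (hPK n)
  have hG0 := adm_G0 hK hP hPK hG hGt
  have hKm : MeasurableSet K := hK.isClosed.measurableSet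
  -- the limit function
  have hΨm : AEMeasurable Ψ μ :=
    aemeasurable_of_tendsto_metrizable_ae atTop (fun n => (hP n).continuous.aemeasurable) hPt
  have hΨ0 : ∀ᵐ z ∂μ, z ∉ K → Ψ z = 0 := by
    filter_upwards [hPt] with z hz hzK
    refine tendsto_nhds_unique hz ?_
    simp only [hPK _ z hzK]
    exact tendsto_const_nhds
  have hΨb : ∀ᵐ z ∂μ, |Ψ z| ≤ N := by
    filter_upwards [hPt] with z hz
    exact le_of_tendsto' hz.abs (fun n => hPN n z)
  have hIK : Integrable (K.indicator fun _ => (2 * N)) μ :=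
    (integrable_indicator_iff hKm).2 (integrableOn_const hK.measure_lt_top.ne)
  have hN0 : 0 ≤ N := (abs_nonneg _).trans (hPN 0 0)
  have hΨi : Integrable Ψ μ := by
    refine Integrable.mono' hIK hΨm.aestronglyMeasurable ?_
    filter_upwards [hΨ0, hΨb] with z h1 h2
    by_cases hz : z ∈ K
    · simp only [hz, indicator_of_mem, Real.norm_eq_abs]; linarith
    · simp [hz, h1 hz]
  have hPi : ∀ n, Integrable (P n) μ := fun n =>
    (hP n).continuous.integrable_of_hasCompactSupport (hPc n)
  have hδ : Tendsto (fun n => ∫ z, |P n z - Ψ z| ∂μ) atTop (𝓝 0) := by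
    have := tendsto_integral_of_dominated_convergence (μ := μ)
      (F := fun n z => |P n z - Ψ z|) (f := fun _ => 0) (K.indicator fun _ => (2 * N))
      (fun n => ((hPi n).sub hΨi).abs.1) hIK ?_ ?_
    · simpa using this
    · intro n
      filter_upwards [hΨ0, hΨb] with z h1 h2
      by_cases hz : z ∈ K
      · simp only [hz, indicator_of_mem, Real.norm_eq_abs, abs_abs]
        have := abs_sub (P n z) (Ψ z)
        have := hPN n z
        linarith
      · simp [hz, h1 hz, hPK n z hz]
    · filter_upwards [hPt] with z hz
      simpa using (hz.sub_const (Ψ z)).abs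
  -- the enlarged compact set
  obtain ⟨K', hK', hKK'⟩ : ∃ K' : Set Z, IsCompact K' ∧
      ∀ r ∈ Metric.ball r₀ 1, ∀ z ∈ K, z + r • e ∈ K' := by
    refine ⟨(fun a : ℝ × Z => a.2 + a.1 • e) '' (Metric.closedBall r₀ 1 ×ˢ K),
      ((isCompact_closedBall _ _).prod hK).image (by fun_prop), fun r hr z hz => ?_⟩
    exact ⟨(r, z), ⟨Metric.ball_subset_closedBall hr, hz⟩, rfl⟩
  have hmove : ∀ {f : Z → ℝ}, Measurable f → (∀ K, IsCompact K → ∃ C, ∀ z ∈ K, |f z| ≤ C) →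
      ∃ C, ∀ r ∈ Metric.ball r₀ 1, ∀ n,
        |∫ z, f (z + r • e) * P n z ∂μ - ∫ z, f (z + r • e) * Ψ z ∂μ|
          ≤ C * ∫ z, |P n z - Ψ z| ∂μ := by
    intro f hf hfl
    obtain ⟨C, hC⟩ := hfl K' hK'
    refine ⟨C, fun r hr n => ?_⟩
    have hfm : AEStronglyMeasurable (fun z => f (z + r • e)) μ :=
      (hf.comp (measurable_id.add_const _)).aestronglyMeasurable
    have hfC : ∀ z ∈ K, |f (z + r • e)| ≤ C := fun z hz => hC _ (hKK' r hr z hz)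
    have i1 := (lb_int hfm hfC (hPi n) (ae_of_all _ (hPK n))).1
    have i2 := (lb_int hfm hfC hΨi hΨ0).1
    have i3 := (lb_int hfm hfC ((hPi n).sub hΨi) (by
      filter_upwards [hΨ0] with z hz hzK
      simp [hz hzK, hPK n z hzK])).2
    rw [← integral_sub i1 i2]
    simpa [mul_sub] using i3
  obtain ⟨Cf, hCf⟩ := hmove hf hfl
  obtain ⟨Cu, hCu⟩ := hmove hu (fun K _ => ⟨M, fun z _ => hM z⟩)
  set D := ∫⁻ z in K', ‖g z‖ₑ ^ 2 ∂μ with hD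
  have hDfin : D ≠ ⊤ := by
    have h2 := lintegral_rpow_enorm_lt_top_of_eLpNorm_lt_top (by norm_num) (by norm_num)
      (hgl K' hK').eLpNorm_lt_top
    simpa using h2.ne
  have hDr : ∀ r ∈ Metric.ball r₀ 1, ∫⁻ z in K, ‖g (z + r • e)‖ₑ ^ 2 ∂μ ≤ D := by
    intro r hr
    rw [hD, ← lintegral_indicator hKm, ← lintegral_indicator hK'.isClosed.measurableSet,
      ← lintegral_add_right_eq_self (μ := μ) (K'.indicator fun z => ‖g z‖ₑ ^ 2) (r • e)]
    refine lintegral_mono fun z => ?_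
    by_cases hz : z ∈ K
    · simp [hz, hKK' r hr z hz]
    · simp [hz]
  set ε := fun n => ∫⁻ z, ‖gx ι (P n) z - G z‖ₑ ^ 2 ∂μ with hε
  have hAb : ∀ r ∈ Metric.ball r₀ 1, ∀ n, ‖∫ z, inner ℝ (g (z + r • e)) (gx ι (P n) z) ∂μ
      - ∫ z, inner ℝ (g (z + r • e)) (G z) ∂μ‖ₑ ^ 2 ≤ D * ε n := by
    intro r hr n
    have hgK := l2loc_shift hgl (r • e) K hK
    have i1 := l2_inner_int (G := gx ι (P n)) hK hgK (gx_cpt_memLp ι (hP n) (hPc n)).2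
      (ae_of_all _ fun z hz => gx_zero ι fun h => hz (closure_minimal (fun y hy => by
      by_contra hyK; exact hy (hPK n y hyK)) hK.isClosed h))
    have i2 := l2_inner_int hK hgK hG hG0
    rw [← integral_sub i1 i2]
    simp only [← inner_sub_right]
    refine (adm_diff hK (hP n) (hPK n) hG.1 hG0
      (hg.comp (measurable_id.add_const _)).aestronglyMeasurable).trans ?_
    gcongr
    exact hDr r hr
  have hDε : Tendsto (fun n => D * ε n) atTop (𝓝 0) := by
    simpa using ENNReal.Tendsto.const_mul hGt (Or.inr hDfin)
  have hs : Tendsto (fun n => √((D * ε n).toReal) + Cf * ∫ z, |P n z - Ψ z| ∂μ) atTop (𝓝 0) := by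
    have h1 : Tendsto (fun n => (D * ε n).toReal) atTop (𝓝 0) := by
      have := (ENNReal.tendsto_toReal ENNReal.zero_ne_top).comp hDε
      rw [ENNReal.toReal_zero] at this
      exact this
    have h2 := (Real.continuous_sqrt.tendsto _).comp h1
    simpa [Function.comp_def] using h2.add (hδ.const_mul Cf)
  refine hasDerivAt_of_tendstoUniformlyOn (l := atTop) (s := Metric.ball r₀ 1)
    (f := fun n r => ∫ z, u (z + r • e) * P n z ∂μ)
    (f' := fun n r => - (∫ z, inner ℝ (g (z + r • e)) (gx ι (P n) z) ∂μ
      + ∫ z, f (z + r • e) * P n z ∂μ))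
    (g' := fun r => - (∫ z, inner ℝ (g (z + r • e)) (G z) ∂μ + ∫ z, f (z + r • e) * Ψ z ∂μ))
    Metric.isOpen_ball ?_ (Eventually.of_forall fun n r _ => hWE.deriv1 (hP n) (hPc n) r) ?_
    (Metric.mem_ball_self one_pos)
  · rw [Metric.tendstoUniformlyOn_iff]
    intro η hη
    filter_upwards [hs.eventually (gt_mem_nhds hη), hDε.eventually (gt_mem_nhds one_pos)]
      with n hn hn1 r hr
    refine lt_of_le_of_lt ?_ hn
    have k1 : |∫ z, inner ℝ (g (z + r • e)) (gx ι (P n) z) ∂μ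
      - ∫ z, inner ℝ (g (z + r • e)) (G z) ∂μ| ≤ √((D * ε n).toReal) := by
      apply Real.le_sqrt_of_sq_le
      have := ENNReal.toReal_mono (hn1.trans ENNReal.one_lt_top).ne (hAb r hr n)
      simpa using this
    have k2 := hCf r hr n
    rw [dist_eq_norm, Real.norm_eq_abs]
    rw [abs_le] at k1 k2 ⊢
    constructor <;> linarith [k1.1, k1.2, k2.1, k2.2]
  · intro r hr
    rw [tendsto_iff_norm_sub_tendsto_zero]
    refine squeeze_zero (fun n => norm_nonneg _) (fun n => hCu r hr n) ?_
    simpa using hδ.const_mul Cu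

lemma WE.chain {ι : E →L[ℝ] Z} {e : Z} {u : Z → ℝ} {g : Z → E} {f : Z → ℝ}
    (h : WE μ ι e u g f) {b π φ : Z → ℝ} {G : Z → E}
    (hφ : ContDiff ℝ 1 φ) (hc : HasCompactSupport φ) (hφ0 : ∀ z, 0 ≤ φ z)
    (hA : Adm μ ι (fun z => π z * φ z) G) (hb : Measurable b) {B : ℝ} (hB : ∀ z, |b z| ≤ B)
    (hπ : Measurable π) {B' : ℝ} (hπB : ∀ z, |π z| ≤ B') (c : ℝ)
    (hcv : ∀ (r : ℝ) z, c * (u (z + r • e) - u z) * π z ≤ b (z + r • e) - b z) :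
    ∫ z, b z * fderiv ℝ φ z e ∂μ
      = c * (∫ z, inner ℝ (g z) (G z) ∂μ + ∫ z, f z * (π z * φ z) ∂μ) := by
  have h1 := h.deriv hA 0
  have h2 := deriv_shift (pm_locint (μ := μ) hb hB) hφ hc e 0
  obtain ⟨hu, ⟨M, hM⟩, -⟩ := h
  have hbi : ∀ r : ℝ, Integrable (fun z => b (z + r • e) * φ z) μ := fun r =>
    pm_int1 (pm_locint (hb.comp (measurable_id.add_const _)) (fun z => hB _)) hφ.continuous hc
  have hui : ∀ r : ℝ, Integrable (fun z => u (z + r • e) * (π z * φ z)) μ := fun r => by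
    have : Integrable (fun z => (u (z + r • e) * π z) * φ z) μ :=
      pm_int1 (pm_locint (M := M * B') ((hu.comp (measurable_id.add_const _)).mul hπ)
        (fun z => by
          rw [abs_mul]
          exact mul_le_mul (hM _) (hπB z) (abs_nonneg _) ((abs_nonneg _).trans (hM 0))))
        hφ.continuous hc
    simpa [mul_assoc] using this
  have h3 := h2.sub (h1.const_mul c)
  have hmin : IsLocalMin (fun r : ℝ => ∫ z, b (z + r • e) * φ z ∂μ
      - c * ∫ z, u (z + r • e) * (π z * φ z) ∂μ) 0 := by
    refine Eventually.of_forall fun r => ?_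
    simp only
    rw [← integral_const_mul, ← integral_const_mul, ← integral_sub (hbi _) ((hui _).const_mul c),
      ← integral_sub (hbi _) ((hui _).const_mul c)]
    refine integral_mono ((hbi _).sub ((hui _).const_mul c))
      ((hbi _).sub ((hui _).const_mul c)) fun z => ?_
    have := mul_le_mul_of_nonneg_right (hcv r z) (hφ0 z)
    simp only [zero_smul, add_zero]
    nlinarith
  have h4 := hmin.hasDerivAt_eq_zero h3
  simp only [zero_smul, add_zero, sub_zero] at h4
  linarith

lemma mono_int {k : ℝ → ℝ} (hk : Continuous k) (hm : MonotoneOn k (Ici 0)) {x y : ℝ}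
    (hx : 0 ≤ x) (hy : 0 ≤ y) : (y - x) * k x ≤ ∫ r in x..y, k r := by
  rcases le_total x y with h | h
  · have := intervalIntegral.integral_mono_on (μ := volume) h
      (_root_.intervalIntegrable_const (c := k x)) (hk.intervalIntegrable x y)
      (fun r hr => hm hx (hx.trans hr.1) hr.1)
    simpa using this
  · rw [intervalIntegral.integral_symm]
    have := intervalIntegral.integral_mono_on (μ := volume) h (hk.intervalIntegrable y x)
      (_root_.intervalIntegrable_const (c := k x))
      (fun r hr => hm (hy.trans hr.1) hx hr.2)
    simp at this
    linarith

/-- Partial Laplacian. -/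
def lapx {n : ℕ} (ι : E →L[ℝ] Z) (b : OrthonormalBasis (Fin n) ℝ E) (φ : Z → ℝ) (z : Z) : ℝ :=
  ∑ i, fderiv ℝ (fun z => fderiv ℝ φ z (ι (b i))) z (ι (b i))

lemma ad_deriv {p : ℝ → ℝ} (hp : ContDiff ℝ 1 p) :
    ContDiff ℝ 1 (fun x => ∫ r in (0:ℝ)..x, p r) ∧ deriv (fun x => ∫ r in (0:ℝ)..x, p r) = p := by
  have hd : ∀ x, HasDerivAt (fun x => ∫ r in (0:ℝ)..x, p r) (p x) x := fun x =>
    intervalIntegral.integral_hasDerivAt_right (hp.continuous.intervalIntegrable _ _)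
      (hp.continuous.stronglyMeasurableAtFilter _ _) hp.continuous.continuousAt
  have e : deriv (fun x => ∫ r in (0:ℝ)..x, p r) = p := funext fun x => (hd x).deriv
  refine ⟨?_, e⟩
  rw [contDiff_one_iff_deriv]
  exact ⟨fun x => (hd x).differentiableAt, by rw [e]; exact hp.continuous⟩

lemma kato_p {n : ℕ} {ι : E →L[ℝ] Z} (b : OrthonormalBasis (Fin n) ℝ E) {e₁ e₂ : Z} {Ω : Set Z}
    (hΩ : IsOpen Ω)
    {u₁ u₂ f₁ f₂ : Z → ℝ} {g₁ g₂ : Z → E} {m M : ℝ} (hm : 1 < m)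
    (h₁ : WE μ ι e₁ u₁ g₁ f₁) (h₂ : WE μ ι e₂ u₂ g₂ f₂)
    (hu₁ : ∀ z, u₁ z ∈ Icc 0 M) (hu₂ : ∀ z, u₂ z ∈ Icc 0 M)
    (w₁ : WG μ ι Ω (fun z => u₁ z ^ m) g₁) (w₂ : WG μ ι Ω (fun z => u₂ z ^ m) g₂)
    (hi₁ : ∀ (r : ℝ) z, u₁ (z + r • e₂) = u₁ z) (hi₂ : ∀ (r : ℝ) z, u₂ (z + r • e₁) = u₂ z)
    (hf : ∀ z ∈ Ω, u₂ z ≤ u₁ z → f₂ z ≤ f₁ z)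
    {p : ℝ → ℝ} (hp : ContDiff ℝ 1 p) (hpm : Monotone p) (hp0 : ∀ x ≤ 0, p x = 0)
    (hp1 : ∀ x, p x ∈ Icc (0:ℝ) 1)
    {φ : Z → ℝ} (hφ : ContDiff ℝ 2 φ) (hc : HasCompactSupport φ) (hs : tsupport φ ⊆ Ω)
    (hφ0 : ∀ z, 0 ≤ φ z) :
    0 ≤ ∫ z, (∫ r in (0:ℝ)..u₁ z, p (r ^ m - u₂ z ^ m)) * fderiv ℝ φ z e₁ ∂μ
      + ∫ z, (- ∫ r in M..u₂ z, p (u₁ z ^ m - r ^ m)) * fderiv ℝ φ z e₂ ∂μ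
      + ∫ z, (∫ r in (0:ℝ)..(u₁ z ^ m - u₂ z ^ m), p r) * lapx ι b φ z ∂μ := by
  have hm0 : 0 ≤ m := by linarith
  have hφ1 : ContDiff ℝ 1 φ := hφ.of_le (by norm_num)
  have hcr : Continuous (fun r : ℝ => r ^ m) := Real.continuous_rpow_const hm0
  set D : Z → ℝ := fun z => u₁ z ^ m - u₂ z ^ m with hD
  have hDm : Measurable D := w₁.1.sub w₂.1
  have hA := adm_main hΩ w₁ w₂ hp hφ1 hc hs
  set G : Z → E := fun z => (deriv p (D z) * φ z) • (g₁ z - g₂ z) + p (D z) • gx ι φ z with hG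
  have hGm : MemLp G 2 μ := by obtain ⟨_, _, _, _, _, _, _, _, h, _⟩ := hA; exact h
  have hG0 : ∀ z, z ∉ tsupport φ → G z = 0 := fun z hz => by
    simp [hG, image_eq_zero_of_notMem_tsupport hz, gx_zero ι hz]
  have hum₁ := h₁.1
  have hum₂ := h₂.1
  have hM0 : 0 ≤ M := (hu₁ 0).1.trans (hu₁ 0).2
  have hpa : ∀ x, ‖p x‖ ≤ 1 := fun x => by
    rw [Real.norm_eq_abs, abs_of_nonneg (hp1 x).1]; exact (hp1 x).2
  -- chain rule 1
  have c1 := h₁.chain (b := fun z => ∫ r in (0:ℝ)..u₁ z, p (r ^ m - u₂ z ^ m)) (B := M)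
    (π := fun z => p (D z)) (B' := 1) hφ1 hc hφ0 hA
    (by
      have : Continuous (fun a : ℝ × ℝ => ∫ r in (0:ℝ)..a.1, p (r ^ m - a.2 ^ m)) := by
        have h5 : Continuous (Function.uncurry fun (a : ℝ × ℝ) (r : ℝ) => p (r ^ m - a.2 ^ m)) :=
          hp.continuous.comp ((hcr.comp continuous_snd).sub
          (hcr.comp (continuous_snd.comp continuous_fst)))
        exact intervalIntegral.continuous_parametric_intervalIntegral_of_continuous (μ := volume)
          h5 continuous_fst
      exact this.measurable.comp (hum₁.prodMk hum₂))
    (fun z => by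
      have := intervalIntegral.norm_integral_le_of_norm_le_const (a := 0) (b := u₁ z)
        (f := fun r : ℝ => p (r ^ m - u₂ z ^ m)) (C := 1) (fun r _ => hpa _)
      rw [Real.norm_eq_abs, sub_zero, abs_of_nonneg (hu₁ z).1, one_mul] at this
      exact this.trans (hu₁ z).2)
    (hp.continuous.measurable.comp hDm) (fun z => hpa _) 1
    (fun r z => by
      have hk : Continuous fun r : ℝ => p (r ^ m - u₂ z ^ m) :=
        hp.continuous.comp (hcr.sub continuous_const)
      simp only [hi₂]
      have h3 := intervalIntegral.integral_interval_sub_left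
        (hk.intervalIntegrable (μ := volume) 0 (u₁ (z + r • e₁)))
        (hk.intervalIntegrable 0 (u₁ z))
      rw [h3, one_mul]
      refine mono_int hk (fun x hx y hy hxy => hpm ?_) (hu₁ _).1 (hu₁ _).1
      exact sub_le_sub_right (Real.rpow_le_rpow hx hxy hm0) _)
  have c2 := h₂.chain (b := fun z => - ∫ r in M..u₂ z, p (u₁ z ^ m - r ^ m)) (B := M)
    (π := fun z => p (D z)) (B' := 1) hφ1 hc hφ0 hA
    (by
      have : Continuous (fun a : ℝ × ℝ => ∫ r in M..a.1, p (a.2 ^ m - r ^ m)) := by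
        have h5 : Continuous (Function.uncurry fun (a : ℝ × ℝ) (r : ℝ) => p (a.2 ^ m - r ^ m)) :=
          hp.continuous.comp ((hcr.comp (continuous_snd.comp continuous_fst)).sub
          (hcr.comp continuous_snd))
        exact intervalIntegral.continuous_parametric_intervalIntegral_of_continuous (μ := volume)
          h5 continuous_fst
      exact (this.measurable.comp (hum₂.prodMk hum₁)).neg)
    (fun z => by
      have := intervalIntegral.norm_integral_le_of_norm_le_const (a := M) (b := u₂ z)
        (f := fun r => p (u₁ z ^ m - r ^ m)) (C := 1) (fun r _ => hpa _)
      rw [Real.norm_eq_abs, abs_sub_comm, abs_of_nonneg (sub_nonneg.2 (hu₂ z).2), one_mul] at this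
      rw [abs_neg]
      have := (hu₂ z).1
      linarith)
    (hp.continuous.measurable.comp hDm) (fun z => hpa _) (-1)
    (fun r z => by
      have hk : Continuous fun r : ℝ => p (u₁ z ^ m - r ^ m) :=
        hp.continuous.comp (continuous_const.sub hcr)
      simp only [hi₁]
      have h3 := intervalIntegral.integral_interval_sub_left
        (hk.intervalIntegrable (μ := volume) M (u₂ (z + r • e₂)))
        (hk.intervalIntegrable M (u₂ z))
      have h4 := mono_int (k := fun r => - p (u₁ z ^ m - r ^ m)) hk.neg
        (fun x hx y hy hxy => neg_le_neg (hpm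
          (sub_le_sub_left (Real.rpow_le_rpow hx hxy hm0) _))) (hu₂ z).1 (hu₂ (z + r • e₂)).1
      rw [intervalIntegral.integral_neg, ← h3] at h4
      simp only [hD]
      linarith)
  -- integrability
  have l₁ := w₁.2.2.2.1 _ hc
  have l₂ := w₂.2.2.2.1 _ hc
  have l : MemLp (fun z => g₁ z - g₂ z) 2 (μ.restrict (tsupport φ)) := l₁.sub l₂
  have i1 := l2_inner_int hc l₁ hGm (ae_of_all _ hG0)
  have i2 := l2_inner_int hc l₂ hGm (ae_of_all _ hG0)
  have hH : MemLp (fun z => p (D z) • gx ι φ z) 2 μ := by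
    refine MemLp.of_le_mul (c := 1) (gx_cpt_memLp ι hφ1 hc).2
      ((hp.continuous.measurable.comp hDm).smul (continuous_gx ι hφ1).measurable).aestronglyMeasurable
      (ae_of_all _ fun z => ?_)
    rw [norm_smul]
    exact mul_le_mul_of_nonneg_right (hpa _) (norm_nonneg _)
  have i3 := l2_inner_int hc l hH (ae_of_all _ fun z hz => by simp [gx_zero ι hz])
  have s1 : ∫ z, inner ℝ (g₁ z - g₂ z) (p (D z) • gx ι φ z) ∂μ
      ≤ ∫ z, inner ℝ (g₁ z) (G z) ∂μ - ∫ z, inner ℝ (g₂ z) (G z) ∂μ := by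
    rw [← integral_sub i1 i2]
    refine integral_mono i3 (i1.sub i2) fun z => ?_
    simp only [← inner_sub_left]
    rw [hG, inner_add_right, inner_smul_right (𝕜 := ℝ) _ (g₁ z - g₂ z), real_inner_self_eq_norm_sq]
    have : 0 ≤ deriv p (D z) := hpm.deriv_nonneg
    have := mul_nonneg (mul_nonneg this (hφ0 z)) (sq_nonneg ‖g₁ z - g₂ z‖)
    linarith
  have s2 : ∫ z, f₂ z * (p (D z) * φ z) ∂μ ≤ ∫ z, f₁ z * (p (D z) * φ z) ∂μ := by
    have hi : Integrable (fun z => p (D z) * φ z) μ := pm_int1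
      (pm_locint (M := 1) (hp.continuous.measurable.comp hDm) (fun z => hpa _)) hφ.continuous hc
    obtain ⟨C₁, hC₁⟩ := h₁.2.2.2.2.2.1 _ hc
    obtain ⟨C₂, hC₂⟩ := h₂.2.2.2.2.2.1 _ hc
    have hz : ∀ᵐ z ∂μ, z ∉ tsupport φ → p (D z) * φ z = 0 := ae_of_all _ fun z hz => by
      simp [image_eq_zero_of_notMem_tsupport hz]
    refine integral_mono (lb_int h₂.2.2.2.2.1.aestronglyMeasurable hC₂ hi hz).1
      (lb_int h₁.2.2.2.2.1.aestronglyMeasurable hC₁ hi hz).1 fun z => ?_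
    by_cases hz : z ∈ tsupport φ
    · rcases le_total (u₂ z) (u₁ z) with h | h
      · exact mul_le_mul_of_nonneg_right (hf z (hs hz) h) (mul_nonneg (hp1 _).1 (hφ0 z))
      · have : D z ≤ 0 := sub_nonpos.2 (Real.rpow_le_rpow (hu₁ z).1 h hm0)
        simp [hp0 _ this]
    · simp [image_eq_zero_of_notMem_tsupport hz]
  -- integration by parts
  obtain ⟨hPc, hPd⟩ := ad_deriv hp
  set P : ℝ → ℝ := fun x => ∫ r in (0:ℝ)..x, p r with hP
  obtain ⟨M₁, hM₁⟩ := w₁.2.1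
  obtain ⟨M₂, hM₂⟩ := w₂.2.1
  have hPb : ∀ z, |P (D z)| ≤ M₁ + M₂ := fun z => by
    have := intervalIntegral.norm_integral_le_of_norm_le_const (a := 0) (b := D z)
        (f := p) (C := 1) (fun r _ => hpa _)
    rw [Real.norm_eq_abs, sub_zero, one_mul] at this
    exact this.trans ((abs_sub _ _).trans (add_le_add (hM₁ z) (hM₂ z)))
  have hPl : LocallyIntegrable (fun z => P (D z)) μ :=
    pm_locint (hPc.continuous.measurable.comp hDm) hPb
  have hφi : ∀ i, ContDiff ℝ 1 (fun z => fderiv ℝ φ z (ι (b i))) := fun i =>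
    (hφ.fderiv_right (m := 1) (by norm_num)).clm_apply contDiff_const
  have hφc : ∀ i, HasCompactSupport (fun z => fderiv ℝ φ z (ι (b i))) := fun i =>
    hc.fderiv_apply ℝ _
  have hφs : ∀ i, tsupport (fun z => fderiv ℝ φ z (ι (b i))) ⊆ tsupport φ := fun i =>
    tsupport_fderiv_apply_subset ℝ _
  have j1 : ∀ i, Integrable (fun z => inner ℝ (g₁ z - g₂ z)
      ((p (D z) * fderiv ℝ φ z (ι (b i))) • b i)) μ := by
    intro i
    refine l2_inner_int hc l ?_ (ae_of_all _ fun z hz => by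
      rw [image_eq_zero_of_notMem_tsupport (fun h => hz (hφs i h)), mul_zero, zero_smul])
    have hk : MemLp (fun z => fderiv ℝ φ z (ι (b i))) 2 μ :=
      (hφi i).continuous.memLp_of_hasCompactSupport (hφc i)
    refine MemLp.of_le_mul (c := 1) hk ?_ (ae_of_all _ fun z => ?_)
    · exact ((((hp.continuous.measurable.comp hDm).mul
        (hφi i).continuous.measurable)).smul_const _).aestronglyMeasurable
    · rw [norm_smul, norm_mul, b.norm_eq_one, mul_one]
      exact mul_le_mul_of_nonneg_right (hpa _) (norm_nonneg _)
  have j2 : ∀ i, Integrable (fun z => P (D z) *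
      fderiv ℝ (fun z => fderiv ℝ φ z (ι (b i))) z (ι (b i))) μ := fun i =>
    pm_int1 hPl (fderiv_cpt (hφi i) (hφc i) _).1 (fderiv_cpt (hφi i) (hφc i) _).2
  have hi : ∀ i, ∫ z, inner ℝ (g₁ z - g₂ z) ((p (D z) * fderiv ℝ φ z (ι (b i))) • b i) ∂μ
      = - ∫ z, P (D z) * fderiv ℝ (fun z => fderiv ℝ φ z (ι (b i))) z (ι (b i)) ∂μ := by
    intro i
    have h0 := adm_zero (adm_main hΩ w₁ w₂ hPc (hφi i) (hφc i) ((hφs i).trans hs)) (b i)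
    rw [hPd] at h0
    rw [eq_neg_iff_add_eq_zero, ← integral_add (j1 i) (j2 i), ← h0]
    congr 1; ext z
    rw [inner_add_right, inner_smul_right, inner_smul_right, inner_smul_right, real_inner_comm,
      real_inner_comm (gx ι _ z), inner_gx]
  have s3 : ∫ z, inner ℝ (g₁ z - g₂ z) (p (D z) • gx ι φ z) ∂μ
      = - ∫ z, P (D z) * lapx ι b φ z ∂μ := by
    have e1 : ∀ z, inner ℝ (g₁ z - g₂ z) (p (D z) • gx ι φ z)
        = ∑ i, inner ℝ (g₁ z - g₂ z) ((p (D z) * fderiv ℝ φ z (ι (b i))) • b i) := by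
      intro z
      rw [inner_smul_right, ← b.sum_inner_mul_inner, Finset.mul_sum]
      refine Finset.sum_congr rfl fun i _ => ?_
      rw [inner_smul_right, real_inner_comm (gx ι φ z), inner_gx]
      ring
    simp only [e1, lapx, Finset.mul_sum]
    rw [integral_finsetSum _ (fun i _ => j1 i), integral_finsetSum _ (fun i _ => j2 i),
      ← Finset.sum_neg_distrib]
    exact Finset.sum_congr rfl fun i _ => hi i
  rw [c1, c2]
  linarith

/-- Smooth approximations of the Heaviside function. -/
def pst (n : ℕ) (x : ℝ) : ℝ := Real.smoothTransition (n * x)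

lemma pst_contDiff (n : ℕ) : ContDiff ℝ 1 (pst n) :=
  Real.smoothTransition.contDiff.comp (contDiff_const.mul contDiff_id)

lemma pst_mem (n : ℕ) (x : ℝ) : pst n x ∈ Icc (0:ℝ) 1 :=
  ⟨Real.smoothTransition.nonneg _, Real.smoothTransition.le_one _⟩

lemma pst_nonpos (n : ℕ) {x : ℝ} (h : x ≤ 0) : pst n x = 0 :=
  Real.smoothTransition.zero_of_nonpos (mul_nonpos_of_nonneg_of_nonpos n.cast_nonneg h)

lemma pst_mono (n : ℕ) : Monotone (pst n) := fun _ _ h =>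
  Real.smoothTransition.monotone (mul_le_mul_of_nonneg_left h n.cast_nonneg)

lemma pst_norm (n : ℕ) (x : ℝ) : ‖pst n x‖ ≤ 1 := by
  rw [Real.norm_eq_abs, abs_of_nonneg (pst_mem n x).1]; exact (pst_mem n x).2

lemma pst_tendsto {x : ℝ} (h : 0 < x) : Tendsto (fun n => pst n x) atTop (𝓝 1) := by
  refine tendsto_const_nhds.congr' ?_
  obtain ⟨k, hk⟩ := exists_nat_ge (1 / x)
  filter_upwards [eventually_ge_atTop k] with n hn
  refine (Real.smoothTransition.one_of_one_le ?_).symm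
  rw [div_le_iff₀ h] at hk
  exact hk.trans (mul_le_mul_of_nonneg_right (by exact_mod_cast hn) h.le)

lemma lim_int {a b : ℝ} (hab : a ≤ b) {h : ℝ → ℝ} (hc : Continuous h)
    (hp : ∀ r ∈ Ioo a b, 0 < h r) :
    Tendsto (fun n => ∫ r in a..b, pst n (h r)) atTop (𝓝 (b - a)) := by
  have : b - a = ∫ r in a..b, (1:ℝ) := by simp
  rw [this]
  refine intervalIntegral.tendsto_integral_filter_of_dominated_convergence (fun _ => 1) ?_ ?_ ?_ ?_
  · exact Eventually.of_forall fun n =>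
      ((pst_contDiff n).continuous.comp hc).aestronglyMeasurable
  · exact Eventually.of_forall fun n => ae_of_all _ fun r _ => pst_norm n _
  · exact _root_.intervalIntegrable_const
  · have : ∀ᵐ r : ℝ, r ≠ b := by simp [ae_iff]
    filter_upwards [this] with r hr hm
    rw [uIoc_of_le hab] at hm
    exact pst_tendsto (hp r ⟨hm.1, lt_of_le_of_ne hm.2 hr⟩)

lemma rpow_strict {m x y : ℝ} (hm : 1 < m) (hx : 0 ≤ x) (h : x < y) : x ^ m < y ^ m :=
  Real.rpow_lt_rpow hx h (by linarith)

lemma int_zero_of {a b : ℝ} {f : ℝ → ℝ} (h : ∀ r ∈ uIcc a b, f r = 0) :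
    ∫ r in a..b, f r = 0 := by
  rw [intervalIntegral.integral_congr (g := fun _ => 0) h]; simp

lemma lim_b1 {m x y : ℝ} (hm : 1 < m) (hx : 0 ≤ x) (hy : 0 ≤ y) :
    Tendsto (fun n => ∫ r in (0:ℝ)..x, pst n (r ^ m - y ^ m)) atTop (𝓝 (max (x - y) 0)) := by
  have hm0 : 0 ≤ m := by linarith
  have hcr : Continuous (fun r : ℝ => r ^ m) := Real.continuous_rpow_const hm0
  have hz : ∀ n {a : ℝ}, 0 ≤ a → a ≤ y → ∫ r in (0:ℝ)..a, pst n (r ^ m - y ^ m) = 0 := by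
    intro n a ha hay
    refine int_zero_of fun r hr => ?_
    rw [uIcc_of_le ha] at hr
    exact pst_nonpos n (sub_nonpos.2 (Real.rpow_le_rpow hr.1 (hr.2.trans hay) hm0))
  rcases le_total x y with h | h
  · rw [max_eq_right (by linarith)]
    simp only [hz _ hx h]
    exact tendsto_const_nhds
  · rw [max_eq_left (by linarith)]
    refine (lim_int (h := fun r => r ^ m - y ^ m) h (hcr.sub continuous_const) (fun r hr => ?_)).congr fun n => ?_
    · exact sub_pos.2 (rpow_strict hm hy hr.1)
    · have hk : Continuous fun r : ℝ => pst n (r ^ m - y ^ m) :=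
        (pst_contDiff n).continuous.comp (hcr.sub continuous_const)
      have := intervalIntegral.integral_add_adjacent_intervals
        (hk.intervalIntegrable (μ := volume) 0 y) (hk.intervalIntegrable y x)
      rw [hz n hy le_rfl, zero_add] at this
      exact this

lemma lim_b2 {m x y M : ℝ} (hm : 1 < m) (hx : 0 ≤ x) (hy : 0 ≤ y) (hxM : x ≤ M) (hyM : y ≤ M) :
    Tendsto (fun n => - ∫ r in M..y, pst n (x ^ m - r ^ m)) atTop (𝓝 (max (x - y) 0)) := by
  have hm0 : 0 ≤ m := by linarith
  have hcr : Continuous (fun r : ℝ => r ^ m) := Real.continuous_rpow_const hm0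
  have hz : ∀ n {a : ℝ}, a ≤ M → x ≤ a → ∫ r in a..M, pst n (x ^ m - r ^ m) = 0 := by
    intro n a ha hay
    refine int_zero_of fun r hr => ?_
    rw [uIcc_of_le ha] at hr
    exact pst_nonpos n (sub_nonpos.2 (Real.rpow_le_rpow hx (hay.trans hr.1) hm0))
  simp only [← intervalIntegral.integral_symm]
  rcases le_total x y with h | h
  · rw [max_eq_right (by linarith)]
    simp only [hz _ hyM h]
    exact tendsto_const_nhds
  · rw [max_eq_left (by linarith)]
    refine (lim_int (h := fun r => x ^ m - r ^ m) h (continuous_const.sub hcr) (fun r hr => ?_)).congr fun n => ?_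
    · exact sub_pos.2 (rpow_strict hm (hy.trans hr.1.le) hr.2)
    · have hk : Continuous fun r : ℝ => pst n (x ^ m - r ^ m) :=
        (pst_contDiff n).continuous.comp (continuous_const.sub hcr)
      have := intervalIntegral.integral_add_adjacent_intervals
        (hk.intervalIntegrable (μ := volume) y x) (hk.intervalIntegrable x M)
      rw [hz n hxM le_rfl, add_zero] at this
      exact this

lemma lim_b3 (d : ℝ) :
    Tendsto (fun n => ∫ r in (0:ℝ)..d, pst n r) atTop (𝓝 (max d 0)) := by
  rcases le_total d 0 with h | h
  · rw [max_eq_right h]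
    have hz : ∀ n, ∫ r in (0:ℝ)..d, pst n r = 0 := by
      intro n
      refine int_zero_of fun r hr => ?_
      rw [uIcc_of_ge h] at hr
      exact pst_nonpos n hr.2
    simp only [hz]
    exact tendsto_const_nhds
  · rw [max_eq_left h]
    simpa using lim_int h continuous_id (fun r hr => hr.1)

lemma dct_mul {b : ℕ → Z → ℝ} {β ψ : Z → ℝ} {C : ℝ} (hb : ∀ n, Measurable (b n))
    (hC : ∀ n z, |b n z| ≤ C) (hl : ∀ z, Tendsto (fun n => b n z) atTop (𝓝 (β z)))
    (hψ : Continuous ψ) (hc : HasCompactSupport ψ) :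
    Tendsto (fun n => ∫ z, b n z * ψ z ∂μ) atTop (𝓝 (∫ z, β z * ψ z ∂μ)) := by
  refine tendsto_integral_of_dominated_convergence (fun z => C * ‖ψ z‖) ?_ ?_ ?_ ?_
  · exact fun n => ((hb n).mul hψ.measurable).aestronglyMeasurable
  · exact ((hψ.integrable_of_hasCompactSupport hc).norm).const_mul C
  · intro n
    refine ae_of_all _ fun z => ?_
    rw [norm_mul]
    exact mul_le_mul_of_nonneg_right (hC n z) (norm_nonneg _)
  · exact ae_of_all _ fun z => (hl z).mul_const _

lemma lapx_cpt {n : ℕ} (ι : E →L[ℝ] Z) (b : OrthonormalBasis (Fin n) ℝ E) {φ : Z → ℝ}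
    (hφ : ContDiff ℝ 2 φ) (hc : HasCompactSupport φ) :
    Continuous (lapx ι b φ) ∧ HasCompactSupport (lapx ι b φ) := by
  have hφi : ∀ i, ContDiff ℝ 1 (fun z => fderiv ℝ φ z (ι (b i))) := fun i =>
    (hφ.fderiv_right (m := 1) (by norm_num)).clm_apply contDiff_const
  have hφc : ∀ i, HasCompactSupport (fun z => fderiv ℝ φ z (ι (b i))) := fun i =>
    hc.fderiv_apply ℝ _
  have h := fun i => fderiv_cpt (hφi i) (hφc i) (ι (b i))
  refine ⟨continuous_finsetSum _ fun i _ => (h i).1, ?_⟩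
  refine HasCompactSupport.intro hc fun z hz => ?_
  refine Finset.sum_eq_zero fun i _ => ?_
  have h1 : tsupport (fun z => fderiv ℝ φ z (ι (b i))) ⊆ tsupport φ :=
    tsupport_fderiv_apply_subset ℝ _
  have h2 : tsupport (fun z => fderiv ℝ (fun z => fderiv ℝ φ z (ι (b i))) z (ι (b i))) ⊆ _ :=
    tsupport_fderiv_apply_subset ℝ _
  exact image_eq_zero_of_notMem_tsupport (f := fun z =>
    fderiv ℝ (fun z => fderiv ℝ φ z (ι (b i))) z (ι (b i))) (fun h => hz (h1 (h2 h)))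

lemma kato {n : ℕ} {ι : E →L[ℝ] Z} (b : OrthonormalBasis (Fin n) ℝ E) {e₁ e₂ : Z} {Ω : Set Z}
    (hΩ : IsOpen Ω)
    {u₁ u₂ f₁ f₂ : Z → ℝ} {g₁ g₂ : Z → E} {m M : ℝ} (hm : 1 < m)
    (h₁ : WE μ ι e₁ u₁ g₁ f₁) (h₂ : WE μ ι e₂ u₂ g₂ f₂)
    (hu₁ : ∀ z, u₁ z ∈ Icc 0 M) (hu₂ : ∀ z, u₂ z ∈ Icc 0 M)
    (w₁ : WG μ ι Ω (fun z => u₁ z ^ m) g₁) (w₂ : WG μ ι Ω (fun z => u₂ z ^ m) g₂)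
    (hi₁ : ∀ (r : ℝ) z, u₁ (z + r • e₂) = u₁ z) (hi₂ : ∀ (r : ℝ) z, u₂ (z + r • e₁) = u₂ z)
    (hf : ∀ z ∈ Ω, u₂ z ≤ u₁ z → f₂ z ≤ f₁ z)
    {φ : Z → ℝ} (hφ : ContDiff ℝ 2 φ) (hc : HasCompactSupport φ) (hs : tsupport φ ⊆ Ω)
    (hφ0 : ∀ z, 0 ≤ φ z) :
    0 ≤ ∫ z, max (u₁ z - u₂ z) 0 * fderiv ℝ φ z e₁ ∂μ
      + ∫ z, max (u₁ z - u₂ z) 0 * fderiv ℝ φ z e₂ ∂μ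
      + ∫ z, max (u₁ z ^ m - u₂ z ^ m) 0 * lapx ι b φ z ∂μ := by
  have hm0 : 0 ≤ m := by linarith
  have hφ1 : ContDiff ℝ 1 φ := hφ.of_le (by norm_num)
  have hcr : Continuous (fun r : ℝ => r ^ m) := Real.continuous_rpow_const hm0
  have hDm : Measurable (fun z => u₁ z ^ m - u₂ z ^ m) := w₁.1.sub w₂.1
  have hum₁ := h₁.1
  have hum₂ := h₂.1
  obtain ⟨M₁, hM₁⟩ := w₁.2.1
  obtain ⟨M₂, hM₂⟩ := w₂.2.1
  have t1 := dct_mul (μ := μ) (b := fun n z => ∫ r in (0:ℝ)..u₁ z, pst n (r ^ m - u₂ z ^ m))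
    (β := fun z => max (u₁ z - u₂ z) 0) (C := M)
    (fun n => by
      have : Continuous (fun a : ℝ × ℝ => ∫ r in (0:ℝ)..a.1, pst n (r ^ m - a.2 ^ m)) := by
        have h5 : Continuous (Function.uncurry fun (a : ℝ × ℝ) (r : ℝ) =>
            pst n (r ^ m - a.2 ^ m)) :=
          (pst_contDiff n).continuous.comp ((hcr.comp continuous_snd).sub
          (hcr.comp (continuous_snd.comp continuous_fst)))
        exact intervalIntegral.continuous_parametric_intervalIntegral_of_continuous (μ := volume)
          h5 continuous_fst
      exact this.measurable.comp (hum₁.prodMk hum₂))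
    (fun n z => by
      have := intervalIntegral.norm_integral_le_of_norm_le_const (a := 0) (b := u₁ z)
        (f := fun r : ℝ => pst n (r ^ m - u₂ z ^ m)) (C := 1) (fun r _ => pst_norm n _)
      rw [Real.norm_eq_abs, sub_zero, abs_of_nonneg (hu₁ z).1, one_mul] at this
      exact this.trans (hu₁ z).2)
    (fun z => lim_b1 hm (hu₁ z).1 (hu₂ z).1)
    (fderiv_cpt hφ1 hc e₁).1 (fderiv_cpt hφ1 hc e₁).2
  have t2 := dct_mul (μ := μ) (b := fun n z => - ∫ r in M..u₂ z, pst n (u₁ z ^ m - r ^ m))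
    (β := fun z => max (u₁ z - u₂ z) 0) (C := M)
    (fun n => by
      have : Continuous (fun a : ℝ × ℝ => ∫ r in M..a.1, pst n (a.2 ^ m - r ^ m)) := by
        have h5 : Continuous (Function.uncurry fun (a : ℝ × ℝ) (r : ℝ) =>
            pst n (a.2 ^ m - r ^ m)) :=
          (pst_contDiff n).continuous.comp ((hcr.comp (continuous_snd.comp continuous_fst)).sub
          (hcr.comp continuous_snd))
        exact intervalIntegral.continuous_parametric_intervalIntegral_of_continuous (μ := volume)
          h5 continuous_fst
      exact (this.measurable.comp (hum₂.prodMk hum₁)).neg)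
    (fun n z => by
      have := intervalIntegral.norm_integral_le_of_norm_le_const (a := M) (b := u₂ z)
        (f := fun r : ℝ => pst n (u₁ z ^ m - r ^ m)) (C := 1) (fun r _ => pst_norm n _)
      rw [Real.norm_eq_abs, abs_sub_comm, abs_of_nonneg (sub_nonneg.2 (hu₂ z).2), one_mul] at this
      rw [abs_neg]
      have := (hu₂ z).1
      linarith)
    (fun z => lim_b2 hm (hu₁ z).1 (hu₂ z).1 (hu₁ z).2 (hu₂ z).2)
    (fderiv_cpt hφ1 hc e₂).1 (fderiv_cpt hφ1 hc e₂).2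
  have t3 := dct_mul (μ := μ) (b := fun n z => ∫ r in (0:ℝ)..(u₁ z ^ m - u₂ z ^ m), pst n r)
    (β := fun z => max (u₁ z ^ m - u₂ z ^ m) 0) (C := M₁ + M₂)
    (fun n => (ad_deriv (pst_contDiff n)).1.continuous.measurable.comp hDm)
    (fun n z => by
      have := intervalIntegral.norm_integral_le_of_norm_le_const (a := 0) (b := u₁ z ^ m - u₂ z ^ m)
        (f := pst n) (C := 1) (fun r _ => pst_norm n _)
      rw [Real.norm_eq_abs, sub_zero, one_mul] at this
      exact this.trans ((abs_sub _ _).trans (add_le_add (hM₁ z) (hM₂ z))))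
    (fun z => lim_b3 _) (lapx_cpt ι b hφ hc).1 (lapx_cpt ι b hφ hc).2
  refine ge_of_tendsto' ((t1.add t2).add t3) fun k => ?_
  exact kato_p b hΩ hm h₁ h₂ hu₁ hu₂ w₁ w₂ hi₁ hi₂ hf (pst_contDiff k) (pst_mono k)
    (fun x hx => pst_nonpos k hx) (pst_mem k) hφ hc hs hφ0

section transfer
variable {Y : Type*} [NormedAddCommGroup Y] [NormedSpace ℝ Y] [FiniteDimensional ℝ Y]
  [MeasurableSpace Y] [BorelSpace Y] {ν : Measure Y} [ν.IsAddHaarMeasure]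

lemma l2loc_map (κ : Z ≃L[ℝ] Y) (hκ : MeasurePreserving κ μ ν) {g : Y → E}
    (h : ∀ K, IsCompact K → MemLp g 2 (ν.restrict K)) :
    ∀ K, IsCompact K → MemLp (fun z => g (κ z)) 2 (μ.restrict K) := by
  intro K hK
  have hS : IsCompact (κ '' K) := hK.image κ.continuous
  have hp : κ ⁻¹' (κ '' K) = K := preimage_image_eq K κ.injective
  have hmp := hκ.restrict_preimage hS.isClosed.measurableSet
  rw [hp] at hmp
  exact (h _ hS).comp_measurePreserving hmp

lemma fderiv_symm (κ : Z ≃L[ℝ] Y) {ζ : Z → ℝ} (hζ : ContDiff ℝ 1 ζ) (z v : Z) :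
    fderiv ℝ (fun y => ζ (κ.symm y)) (κ z) (κ v) = fderiv ℝ ζ z v := by
  have h1 : HasFDerivAt ζ (fderiv ℝ ζ z) (κ.symm (κ z)) := by
    rw [κ.symm_apply_apply]
    exact (hζ.differentiable (by norm_num) z).hasFDerivAt
  have h2 := h1.comp (κ z) κ.symm.hasFDerivAt
  have h3 : fderiv ℝ (fun y => ζ (κ.symm y)) (κ z) = _ := h2.fderiv
  rw [h3]
  simp

lemma symm_test (κ : Z ≃L[ℝ] Y) {ζ : Z → ℝ} (hζ : ContDiff ℝ 1 ζ) (hc : HasCompactSupport ζ) :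
    ContDiff ℝ 1 (fun y => ζ (κ.symm y)) ∧ HasCompactSupport (fun y => ζ (κ.symm y)) :=
  ⟨hζ.comp κ.symm.contDiff, hc.comp_homeomorph κ.symm.toHomeomorph⟩

lemma WE.map (κ : Z ≃L[ℝ] Y) (hκ : MeasurePreserving κ μ ν) {ι : E →L[ℝ] Z} {ι' : E →L[ℝ] Y}
    {e : Z} {e' : Y} (he : κ e = e') (hι : ∀ v, κ (ι v) = ι' v) {u : Y → ℝ} {g : Y → E} {f : Y → ℝ}
    (h : WE ν ι' e' u g f) :
    WE μ ι e (fun z => u (κ z)) (fun z => g (κ z)) (fun z => f (κ z)) := by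
  obtain ⟨hu, ⟨M, hM⟩, hg, hgl, hf, hfb, hw⟩ := h
  have hκm := hκ.measurable
  refine ⟨hu.comp hκm, ⟨M, fun z => hM _⟩, hg.comp hκm, l2loc_map κ hκ hgl, hf.comp hκm, ?_, ?_⟩
  · intro K hK
    obtain ⟨C, hC⟩ := hfb _ (hK.image κ.continuous)
    exact ⟨C, fun z hz => hC _ (mem_image_of_mem _ hz)⟩
  · intro ζ hζ hc
    obtain ⟨hζ', hc'⟩ := symm_test κ hζ hc
    have he' : MeasurableEmbedding κ := κ.toHomeomorph.measurableEmbedding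
    have := hw _ hζ' hc'
    rw [← hκ.integral_comp he', ← hκ.integral_comp he', ← hκ.integral_comp he'] at this
    have hgx : ∀ z, gx ι' (fun y => ζ (κ.symm y)) (κ z) = gx ι ζ z := fun z => by
      refine ext_inner_right ℝ fun v => ?_
      rw [inner_gx, inner_gx, ← hι, fderiv_symm κ hζ]
    simpa only [← he, fderiv_symm κ hζ, hgx, κ.symm_apply_apply] using this

lemma WG.map (κ : Z ≃L[ℝ] Y) (hκ : MeasurePreserving κ μ ν) {ι : E →L[ℝ] Z} {ι' : E →L[ℝ] Y}
    (hι : ∀ v, κ (ι v) = ι' v) {Ω : Set Y} {Ω' : Set Z} (hΩ : ∀ z ∈ Ω', κ z ∈ Ω)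
    {u : Y → ℝ} {g : Y → E}
    (h : WG ν ι' Ω u g) : WG μ ι Ω' (fun z => u (κ z)) (fun z => g (κ z)) := by
  obtain ⟨hu, ⟨M, hM⟩, hg, hgl, hw⟩ := h
  have hκm := hκ.measurable
  refine ⟨hu.comp hκm, ⟨M, fun z => hM _⟩, hg.comp hκm, l2loc_map κ hκ hgl, ?_⟩
  intro ζ hζ hc hs v
  obtain ⟨hζ', hc'⟩ := symm_test κ hζ hc
  have he' : MeasurableEmbedding κ := κ.toHomeomorph.measurableEmbedding
  have hs' : tsupport (fun y => ζ (κ.symm y)) ⊆ Ω := by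
    intro y hy
    have h1 := tsupport_comp_subset_preimage ζ κ.symm.continuous hy
    have := hΩ _ (hs h1)
    rwa [κ.apply_symm_apply] at this
  have := hw _ hζ' hc' hs' v
  rw [← hκ.integral_comp he', ← hκ.integral_comp he'] at this
  simpa only [← hι, fderiv_symm κ hζ, κ.symm_apply_apply] using this

end transfer

lemma l2loc_lift {g : Z → E} (h : ∀ K, IsCompact K → MemLp g 2 (μ.restrict K)) :
    ∀ K, IsCompact K → MemLp (fun z : ℝ × Z => g z.2) 2
      (((volume : Measure ℝ).prod μ).restrict K) := by
  intro K hK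
  have h1 : IsCompact (Prod.fst '' K) := hK.image continuous_fst
  have h2 : IsCompact (Prod.snd '' K) := hK.image continuous_snd
  have : IsFiniteMeasure ((volume : Measure ℝ).restrict (Prod.fst '' K)) :=
    ⟨by simpa using h1.measure_lt_top⟩
  have h3 := (h _ h2).comp_snd ((volume : Measure ℝ).restrict (Prod.fst '' K))
  rw [Measure.prod_restrict] at h3
  have hKs : K ⊆ (Prod.fst '' K) ×ˢ (Prod.snd '' K) := fun z hz =>
    ⟨mem_image_of_mem _ hz, mem_image_of_mem _ hz⟩
  exact h3.mono_measure (Measure.restrict_mono hKs le_rfl)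

lemma fderiv_slice {ζ : ℝ × Z → ℝ} (hζ : ContDiff ℝ 1 ζ) (r : ℝ) (z v : Z) :
    fderiv ℝ (fun y => ζ (r, y)) z v = fderiv ℝ ζ (r, z) (0, v) := by
  have h1 : HasFDerivAt ζ (fderiv ℝ ζ (r, z)) (r, z) :=
    (hζ.differentiable (by norm_num) _).hasFDerivAt
  have h2 := h1.comp z (hasFDerivAt_prodMk_right r z)
  have h3 : fderiv ℝ (fun y => ζ (r, y)) z = _ := h2.fderiv
  rw [h3]
  simp

lemma slice_test {ζ : ℝ × Z → ℝ} (hζ : ContDiff ℝ 1 ζ) (hc : HasCompactSupport ζ) (r : ℝ) :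
    ContDiff ℝ 1 (fun y => ζ (r, y)) ∧ HasCompactSupport (fun y => ζ (r, y)) := by
  refine ⟨hζ.comp (contDiff_const.prodMk contDiff_id), ?_⟩
  refine HasCompactSupport.intro (hc.image continuous_snd) fun y hy => ?_
  exact image_eq_zero_of_notMem_tsupport fun h => hy (mem_image_of_mem Prod.snd h)

lemma WE.lift {ι : E →L[ℝ] Z} {e : Z} {u : Z → ℝ} {g : Z → E} {f : Z → ℝ} (h : WE μ ι e u g f) :
    WE ((volume : Measure ℝ).prod μ) ((ContinuousLinearMap.inr ℝ ℝ Z).comp ι) ((0:ℝ), e)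
      (fun z => u z.2) (fun z => g z.2) (fun z => f z.2) := by
  obtain ⟨hu, ⟨M, hM⟩, hg, hgl, hf, hfb, hw⟩ := h
  have hfb' : ∀ K : Set (ℝ × Z), IsCompact K → ∃ C, ∀ z ∈ K, |f z.2| ≤ C := by
    intro K hK
    obtain ⟨C, hC⟩ := hfb _ (hK.image continuous_snd)
    exact ⟨C, fun z hz => hC _ (mem_image_of_mem _ hz)⟩
  refine ⟨hu.comp measurable_snd, ⟨M, fun z => hM _⟩, hg.comp measurable_snd, l2loc_lift hgl,
    hf.comp measurable_snd, hfb', ?_⟩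
  intro ζ hζ hc
  have i1 : Integrable (fun z : ℝ × Z => u z.2 * fderiv ℝ ζ z (0, e))
      ((volume : Measure ℝ).prod μ) :=
    pm_int1 (pm_locint (hu.comp measurable_snd) fun z => hM _) (fderiv_cpt hζ hc _).1
      (fderiv_cpt hζ hc _).2
  have i2 : Integrable (fun z : ℝ × Z => inner ℝ (g z.2)
      (gx ((ContinuousLinearMap.inr ℝ ℝ Z).comp ι) ζ z)) ((volume : Measure ℝ).prod μ) :=
    l2_inner_int hc (l2loc_lift hgl _ hc) (gx_cpt_memLp _ hζ hc).2
      (ae_of_all _ fun z hz => gx_zero _ hz)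
  obtain ⟨C, hC⟩ := hfb' _ hc
  have i3 : Integrable (fun z : ℝ × Z => f z.2 * ζ z) ((volume : Measure ℝ).prod μ) :=
    (lb_int (hf.comp measurable_snd).aestronglyMeasurable hC
      (hζ.continuous.integrable_of_hasCompactSupport hc)
      (ae_of_all _ fun z hz => image_eq_zero_of_notMem_tsupport hz)).1
  rw [integral_prod _ i1, integral_prod _ i2, integral_prod _ i3,
    ← integral_add i2.integral_prod_left i3.integral_prod_left]
  congr 1
  ext r
  obtain ⟨hζ', hc'⟩ := slice_test hζ hc r
  have := hw _ hζ' hc'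
  have hgx : ∀ z, gx ι (fun y => ζ (r, y)) z = gx ((ContinuousLinearMap.inr ℝ ℝ Z).comp ι) ζ (r, z)
      := fun z => by
    refine ext_inner_right ℝ fun v => ?_
    rw [inner_gx, inner_gx, fderiv_slice hζ]
    simp
  simpa only [fderiv_slice hζ, hgx] using this

lemma WG.lift {ι : E →L[ℝ] Z} {Ω : Set Z} {u : Z → ℝ} {g : Z → E} (h : WG μ ι Ω u g) :
    WG ((volume : Measure ℝ).prod μ) ((ContinuousLinearMap.inr ℝ ℝ Z).comp ι) (Prod.snd ⁻¹' Ω)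
      (fun z => u z.2) (fun z => g z.2) := by
  obtain ⟨hu, ⟨M, hM⟩, hg, hgl, hw⟩ := h
  refine ⟨hu.comp measurable_snd, ⟨M, fun z => hM _⟩, hg.comp measurable_snd, l2loc_lift hgl, ?_⟩
  intro ζ hζ hc hs v
  have i1 : Integrable (fun z : ℝ × Z => u z.2 *
      fderiv ℝ ζ z (((ContinuousLinearMap.inr ℝ ℝ Z).comp ι) v)) ((volume : Measure ℝ).prod μ) :=
    pm_int1 (pm_locint (hu.comp measurable_snd) fun z => hM _) (fderiv_cpt hζ hc _).1
      (fderiv_cpt hζ hc _).2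
  have i2 : Integrable (fun z : ℝ × Z => inner ℝ (g z.2) v * ζ z)
      ((volume : Measure ℝ).prod μ) := by
    have hk : MemLp (fun z : ℝ × Z => ζ z • v) 2 ((volume : Measure ℝ).prod μ) :=
      (hζ.continuous.smul continuous_const).memLp_of_hasCompactSupport hc.smul_right
    have := l2_inner_int hc (l2loc_lift hgl _ hc) hk
      (ae_of_all _ fun z hz => by rw [image_eq_zero_of_notMem_tsupport hz, zero_smul])
    simpa only [inner_smul_right, mul_comm] using this
  rw [integral_prod _ i1, integral_prod _ i2, ← integral_neg]
  congr 1
  ext r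
  obtain ⟨hζ', hc'⟩ := slice_test hζ hc r
  have hs' : tsupport (fun y => ζ (r, y)) ⊆ Ω := by
    intro y hy
    exact hs (tsupport_comp_subset_preimage ζ (f := fun y => (r, y)) (by fun_prop) hy)
  have := hw _ hζ' hc' hs' v
  simp only [fderiv_slice hζ] at this
  exact this

section shear
variable {η : Measure E} [η.IsAddHaarMeasure]

/-- First shear. -/
def kap1 : (ℝ × (ℝ × E)) ≃L[ℝ] (ℝ × (ℝ × E)) where
  toFun z := (z.1 + z.2.1, z.2)
  map_add' x y := by ext <;> simp; ring
  map_smul' c x := by ext <;> simp; ring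
  invFun z := (z.1 - z.2.1, z.2)
  left_inv x := by simp
  right_inv x := by simp
  continuous_toFun := by fun_prop
  continuous_invFun := by fun_prop

/-- Second shear. -/
def kap2 : (ℝ × (ℝ × E)) ≃L[ℝ] (ℝ × (ℝ × E)) where
  toFun z := (z.2.1, (z.2.1 + z.1, z.2.2))
  map_add' x y := by ext <;> simp; ring
  map_smul' c x := by ext <;> simp; ring
  invFun z := (z.2.1 - z.1, (z.1, z.2.2))
  left_inv x := by simp
  right_inv x := by simp
  continuous_toFun := by fun_prop
  continuous_invFun := by fun_prop

lemma kap1_mp : MeasurePreserving (kap1 (E := E)) ((volume : Measure ℝ).prod ((volume : Measure ℝ).prod η))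
    ((volume : Measure ℝ).prod ((volume : Measure ℝ).prod η)) := by
  have h1 : MeasurePreserving (fun p : (ℝ × E) × ℝ => (id p.1, p.2 + p.1.1))
      (((volume : Measure ℝ).prod η).prod volume) (((volume : Measure ℝ).prod η).prod volume) :=
    (MeasurePreserving.id _).skew_product (g := fun (y : ℝ × E) (r : ℝ) => r + y.1) (by fun_prop)
      (ae_of_all _ fun (y : ℝ × E) => (measurePreserving_add_right volume y.1).map_eq)
  exact Measure.measurePreserving_swap.comp (h1.comp Measure.measurePreserving_swap)

lemma kap2_mp : MeasurePreserving (kap2 (E := E)) ((volume : Measure ℝ).prod ((volume : Measure ℝ).prod η))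
    ((volume : Measure ℝ).prod ((volume : Measure ℝ).prod η)) := by
  have h1 : MeasurePreserving (fun p : (ℝ × E) × ℝ => (id p.1, p.1.1 - p.2))
      (((volume : Measure ℝ).prod η).prod volume) (((volume : Measure ℝ).prod η).prod volume) :=
    (MeasurePreserving.id _).skew_product (g := fun (y : ℝ × E) (r : ℝ) => y.1 - r) (by fun_prop)
      (ae_of_all _ fun (y : ℝ × E) => (Measure.measurePreserving_sub_left volume y.1).map_eq)
  have h2 : MeasurePreserving (fun p : ℝ × (ℝ × E) => (id p.1, (p.2.1 + p.1, p.2.2)))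
      ((volume : Measure ℝ).prod ((volume : Measure ℝ).prod η))
      ((volume : Measure ℝ).prod ((volume : Measure ℝ).prod η)) :=
    (MeasurePreserving.id _).skew_product (g := fun (r : ℝ) (y : ℝ × E) => (y.1 + r, y.2)) (by fun_prop)
      (ae_of_all _ fun r => ((measurePreserving_add_right volume r).prod
        (MeasurePreserving.id η)).map_eq)
  have h3 := (Measure.measurePreserving_swap.comp (h1.comp Measure.measurePreserving_swap)).comp h2
  convert h3 using 1
  ext z <;> simp [kap2]

end shear

lemma tr_cont {u ψ : Z → ℝ} {M : ℝ} (hu : Measurable u) (hM : ∀ z, |u z| ≤ M)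
    (hψ : Continuous ψ) (hc : HasCompactSupport ψ) (e : Z) :
    Tendsto (fun r : ℝ => ∫ z, |u (z + r • e) - u z| * |ψ z| ∂μ) (𝓝 0) (𝓝 0) := by
  obtain ⟨χ, hχ, hχc, -, hχ1, -⟩ := pm_cutoff (hc.isCompact.cthickening (r := ‖e‖)) isOpen_univ
    (subset_univ _)
  obtain ⟨B, hB⟩ := hc.exists_bound_of_continuous hψ
  have hi : Integrable (fun z => u z * χ z) μ :=
    pm_int1 (pm_locint hu hM) hχ.continuous hχc
  have h1 := pm_transl (p := 1) le_rfl (by norm_num) (memLp_one_iff_integrable.2 hi)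
  have h2 : Tendsto (fun r : ℝ => r • e) (𝓝 0) (𝓝 0) := by
    have : Continuous (fun r : ℝ => r • e) := by fun_prop
    simpa using this.tendsto 0
  have h3 := h1.comp h2
  have hi' : ∀ q, Integrable (fun z => u (z + q) * χ (z + q) - u z * χ z) μ := fun q =>
    (hi.comp_add_right q).sub hi
  have h4 : Tendsto (fun r : ℝ => B * ∫ z, |u (z + r • e) * χ (z + r • e) - u z * χ z| ∂μ)
      (𝓝 0) (𝓝 0) := by
    have := ((ENNReal.tendsto_toReal ENNReal.zero_ne_top).comp h3).const_mul B
    simp only [ENNReal.toReal_zero, mul_zero] at this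
    refine this.congr fun r => ?_
    simp only [Function.comp]
    rw [eLpNorm_one_eq_lintegral_enorm, ← integral_norm_eq_lintegral_enorm (hi' _).1]
    rfl
  refine tendsto_of_tendsto_of_tendsto_of_le_of_le' tendsto_const_nhds h4 ?_ ?_
  · exact Eventually.of_forall fun r => integral_nonneg fun z => by positivity
  · filter_upwards [Metric.ball_mem_nhds (0:ℝ) one_pos] with r hr
    rw [← integral_const_mul]
    refine integral_mono_of_nonneg (ae_of_all _ fun z => by positivity)
      ((hi' _).abs.const_mul B) (ae_of_all _ fun z => ?_)
    show |u (z + r • e) - u z| * |ψ z| ≤ B * |u (z + r • e) * χ (z + r • e) - u z * χ z|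
    by_cases hz : z ∈ tsupport ψ
    · have e1 : χ z = 1 := hχ1 _ (Metric.self_subset_cthickening _ hz)
      have e2 : χ (z + r • e) = 1 := by
        refine hχ1 _ (Metric.mem_cthickening_of_dist_le _ z _ _ hz ?_)
        rw [dist_eq_norm, add_sub_cancel_left, norm_smul]
        have : ‖r‖ ≤ 1 := (mem_ball_zero_iff.1 hr).le
        exact mul_le_of_le_one_left (norm_nonneg _) this
      rw [e1, e2, mul_one, mul_one, mul_comm]
      exact mul_le_mul_of_nonneg_right (hB z) (abs_nonneg _)
    · rw [image_eq_zero_of_notMem_tsupport hz, abs_zero, mul_zero]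
      have : 0 ≤ B := (norm_nonneg _).trans (hB z)
      positivity

lemma tr_cont2 {u a ψ : Z → ℝ} {M M' : ℝ} (hu : Measurable u) (hM : ∀ z, |u z| ≤ M)
    (ha : Measurable a) (hM' : ∀ z, |a z| ≤ M')
    (hψ : Continuous ψ) (hc : HasCompactSupport ψ) (e : Z) :
    Tendsto (fun r : ℝ => ∫ z, max (a z - u (z + r • e)) 0 * ψ z ∂μ) (𝓝 0)
      (𝓝 (∫ z, max (a z - u z) 0 * ψ z ∂μ)) := by
  rw [tendsto_iff_norm_sub_tendsto_zero]
  have hb : ∀ q, Measurable (fun z => max (a z - u (z + q)) 0) := fun q =>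
    (ha.sub (hu.comp (measurable_id.add_const q))).max measurable_const
  have hbb : ∀ q z, |max (a z - u (z + q)) 0| ≤ M' + M := fun q z => by
    have h1 := abs_le.1 (hM (z + q))
    have h2 := abs_le.1 (hM' z)
    rw [abs_of_nonneg (le_max_right _ _)]
    exact max_le (by linarith) (by linarith)
  have hi : ∀ q, Integrable (fun z => max (a z - u (z + q)) 0 * ψ z) μ := fun q =>
    pm_int1 (pm_locint (hb q) (hbb q)) hψ hc
  have hi0 : Integrable (fun z => max (a z - u z) 0 * ψ z) μ := by simpa using hi 0
  have hd : ∀ q, Integrable (fun z => |u (z + q) - u z| * |ψ z|) μ := fun q =>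
    pm_int1 (pm_locint (M := M + M) ((hu.comp (measurable_id.add_const q)).sub hu).abs (fun z => by
      rw [abs_abs]
      exact (abs_sub _ _).trans (add_le_add (hM _) (hM _)))) hψ.abs hc.abs
  refine squeeze_zero (fun _ => norm_nonneg _) (fun r => ?_) (tr_cont (μ := μ) hu hM hψ hc e)
  rw [← integral_sub (hi _) hi0]
  refine norm_integral_le_of_norm_le (hd _) (ae_of_all _ fun z => ?_)
  rw [← sub_mul, norm_mul]
  refine mul_le_mul_of_nonneg_right ?_ (norm_nonneg _)
  refine (abs_max_sub_max_le_abs _ _ _).trans ?_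
  rw [_root_.sub_sub_sub_cancel_left, abs_sub_comm]

section R4
variable {η : Measure E} [η.IsAddHaarMeasure]

lemma lapx_slice {n : ℕ} (ι : E →L[ℝ] Z) (b : OrthonormalBasis (Fin n) ℝ E) {ρ : ℝ → ℝ} {Φ : Z → ℝ}
    (hρ : ContDiff ℝ 2 ρ) (hΦ : ContDiff ℝ 2 Φ) (r : ℝ) (y : Z) :
    lapx ((ContinuousLinearMap.inr ℝ ℝ Z).comp ι) b (fun z : ℝ × Z => ρ z.1 * Φ z.2) (r, y)
      = ρ r * lapx ι b Φ y := by
  have hφ : ContDiff ℝ 2 (fun z : ℝ × Z => ρ z.1 * Φ z.2) :=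
    (hρ.comp contDiff_fst).mul (hΦ.comp contDiff_snd)
  have hd : ∀ r y (v : Z), fderiv ℝ (fun z : ℝ × Z => ρ z.1 * Φ z.2) (r, y) (0, v)
      = ρ r * fderiv ℝ Φ y v := by
    intro r y v
    rw [← fderiv_slice (hφ.of_le (by norm_num))]
    show fderiv ℝ (fun y => ρ r * Φ y) y v = _
    rw [fderiv_const_mul (hΦ.differentiable (by norm_num) y)]
    simp
  unfold lapx
  rw [Finset.mul_sum]
  refine Finset.sum_congr rfl fun i _ => ?_
  have hφi : ContDiff ℝ 1 (fun z : ℝ × Z => fderiv ℝ (fun z : ℝ × Z => ρ z.1 * Φ z.2) z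
      (0, ι (b i))) :=
    (hφ.fderiv_right (m := 1) (by norm_num)).clm_apply contDiff_const
  have hΦi : ContDiff ℝ 1 (fun z => fderiv ℝ Φ z (ι (b i))) :=
    (hΦ.fderiv_right (m := 1) (by norm_num)).clm_apply contDiff_const
  show fderiv ℝ (fun z : ℝ × Z => fderiv ℝ (fun z : ℝ × Z => ρ z.1 * Φ z.2) z
      (0, ι (b i))) (r, y) (0, ι (b i)) = _
  rw [← fderiv_slice hφi]
  simp only [hd]
  rw [fderiv_const_mul (hΦi.differentiable (by norm_num) y)]
  simp

lemma r4 {n : ℕ} (b : OrthonormalBasis (Fin n) ℝ E)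
    {u₁ u₂ f₁ f₂ : ℝ × E → ℝ} {g₁ g₂ : ℝ × E → E} {m M : ℝ} (hm : 1 < m)
    (h₁ : WE ((volume : Measure ℝ).prod η) (ContinuousLinearMap.inr ℝ ℝ E) (1, 0) u₁ g₁ f₁)
    (h₂ : WE ((volume : Measure ℝ).prod η) (ContinuousLinearMap.inr ℝ ℝ E) (1, 0) u₂ g₂ f₂)
    (hu₁ : ∀ z, u₁ z ∈ Icc 0 M) (hu₂ : ∀ z, u₂ z ∈ Icc 0 M)
    (w₁ : WG ((volume : Measure ℝ).prod η) (ContinuousLinearMap.inr ℝ ℝ E) {z | 0 < z.1}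
      (fun z => u₁ z ^ m) g₁)
    (w₂ : WG ((volume : Measure ℝ).prod η) (ContinuousLinearMap.inr ℝ ℝ E) {z | 0 < z.1}
      (fun z => u₂ z ^ m) g₂)
    (hf : ∀ t s x, 0 < t → 0 < s → u₂ (s, x) ≤ u₁ (t, x) → f₂ (s, x) ≤ f₁ (t, x))
    {Φ : ℝ × E → ℝ} (hΦ : ContDiff ℝ 2 Φ) (hc : HasCompactSupport Φ)
    (hs : tsupport Φ ⊆ {z | 0 < z.1}) (hΦ0 : ∀ z, 0 ≤ Φ z) :
    0 ≤ ∫ z, max (u₁ z - u₂ z) 0 * fderiv ℝ Φ z (1, 0) ∂((volume : Measure ℝ).prod η)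
      + ∫ z, max (u₁ z ^ m - u₂ z ^ m) 0 * lapx (ContinuousLinearMap.inr ℝ ℝ E) b Φ z
        ∂((volume : Measure ℝ).prod η) := by
  set ι := ContinuousLinearMap.inr ℝ ℝ E with hι
  have hI0 : ((volume : Measure ℝ).prod ((volume : Measure ℝ).prod η)).IsAddHaarMeasure :=
    Measure.prod.instIsAddHaarMeasure _ _
  set μ₀ := (volume : Measure ℝ).prod η with hμ₀
  have hΦ1 : ContDiff ℝ 1 Φ := hΦ.of_le (by norm_num)
  obtain ⟨M₁, hM₁⟩ := w₁.2.1
  obtain ⟨M₂, hM₂⟩ := w₂.2.1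
  have hua₁ : ∀ z, |u₁ z| ≤ M := fun z => by rw [abs_of_nonneg (hu₁ z).1]; exact (hu₁ z).2
  have hua₂ : ∀ z, |u₂ z| ≤ M := fun z => by rw [abs_of_nonneg (hu₂ z).1]; exact (hu₂ z).2
  set L : ℝ → ℝ := fun r => ∫ z, max (u₁ z - u₂ (z + r • (1, 0))) 0 * fderiv ℝ Φ z (1, 0) ∂μ₀
      + ∫ z, max (u₁ z ^ m - u₂ (z + r • (1, 0)) ^ m) 0 * lapx ι b Φ z ∂μ₀ with hL
  have hLt := (tr_cont2 (μ := μ₀) h₂.1 hua₂ h₁.1 hua₁ (fderiv_cpt hΦ1 hc (1, 0)).1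
    (fderiv_cpt hΦ1 hc (1, 0)).2 ((1:ℝ), (0:E))).add
    (tr_cont2 (μ := μ₀) w₂.1 hM₂ w₁.1 hM₁ (lapx_cpt ι b hΦ hc).1
    (lapx_cpt ι b hΦ hc).2 ((1:ℝ), (0:E)))
  by_contra! hneg
  set L0 := ∫ z, max (u₁ z - u₂ z) 0 * fderiv ℝ Φ z (1, 0) ∂μ₀
      + ∫ z, max (u₁ z ^ m - u₂ z ^ m) 0 * lapx ι b Φ z ∂μ₀ with hL0
  have hev : ∀ᶠ r in 𝓝 (0:ℝ), L r < L0 / 2 := hLt.eventually_lt_const (by linarith)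
  -- margin
  have hmarg : ∃ δ > 0, ∀ z ∈ tsupport Φ, δ ≤ z.1 := by
    rcases (tsupport Φ).eq_empty_or_nonempty with he | hne
    · exact ⟨1, one_pos, by simp [he]⟩
    · obtain ⟨z, hz, hmin⟩ := hc.isCompact.exists_isMinOn hne continuous_fst.continuousOn
      exact ⟨z.1, hs hz, fun y hy => hmin hy⟩
  obtain ⟨δ, hδ, hδs⟩ := hmarg
  obtain ⟨δ', hδ', hb'⟩ := Metric.eventually_nhds_iff_ball.1 hev
  set d := min δ δ' / 2 with hd
  have hmin : 0 < min δ δ' := lt_min hδ hδ'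
  have hd0 : 0 < d := by positivity
  have hdδ : d < δ := by have := min_le_left δ δ'; linarith
  have hdδ' : d < δ' := by have := min_le_right δ δ'; linarith
  let β : ContDiffBump (0:ℝ) := ⟨d / 2, d, by positivity, by linarith⟩
  have hβ : ContDiff ℝ 2 β := β.contDiff
  have hβs : ∀ r, β r ≠ 0 → |r| < d := fun r hr => by
    have : r ∈ Function.support β := hr
    rw [β.support_eq] at this
    simpa using this
  set φ : ℝ × (ℝ × E) → ℝ := fun z => β z.1 * Φ z.2 with hφ
  have hφc2 : ContDiff ℝ 2 φ := (hβ.comp contDiff_fst).mul (hΦ.comp contDiff_snd)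
  have hφts : tsupport φ ⊆ (Metric.closedBall 0 d) ×ˢ tsupport Φ := by
    refine closure_minimal ?_ (Metric.isClosed_closedBall.prod (isClosed_tsupport Φ))
    intro z hz
    have h1 : β z.1 ≠ 0 := left_ne_zero_of_mul hz
    have h2 : Φ z.2 ≠ 0 := right_ne_zero_of_mul hz
    exact ⟨by simpa using (hβs _ h1).le, subset_tsupport _ h2⟩
  have hφc : HasCompactSupport φ :=
    ((isCompact_closedBall (0:ℝ) d).prod hc).of_isClosed_subset (isClosed_tsupport _) hφts
  set Ω : Set (ℝ × (ℝ × E)) := {z | 0 < z.2.1 ∧ 0 < z.2.1 + z.1} with hΩ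
  have hΩo : IsOpen Ω := by
    have c1 : Continuous (fun z : ℝ × (ℝ × E) => z.2.1) := by fun_prop
    have c2 : Continuous (fun z : ℝ × (ℝ × E) => z.2.1 + z.1) := by fun_prop
    exact (isOpen_lt continuous_const c1).inter (isOpen_lt continuous_const c2)
  have hφΩ : tsupport φ ⊆ Ω := fun z hz => by
    obtain ⟨h1, h2⟩ := hφts hz
    have h3 := hδs _ h2
    have h4 : |z.1| ≤ d := by simpa using h1
    have h5 := abs_le.1 h4
    exact ⟨by linarith, by linarith⟩
  set ι' := (ContinuousLinearMap.inr ℝ ℝ (ℝ × E)).comp ι with hι'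
  have k1 : ∀ v, kap1 (ι' v) = ι' v := fun v => by
    simp [hι', hι, kap1]
  have k2 : ∀ v, kap2 (ι' v) = ι' v := fun v => by
    simp [hι', hι, kap2]
  have H₁ := h₁.lift.map (ι := ι') (e := (-1, (1, 0))) kap1 kap1_mp (by simp [kap1]) k1
  have H₂ := h₂.lift.map (ι := ι') (e := (1, (0, 0))) kap2 kap2_mp (by simp [kap2]) k2
  have W₁ := w₁.lift.map (ι := ι') (Ω' := Ω) kap1 kap1_mp k1 (fun z hz => hz.1)
  have W₂ := w₂.lift.map (ι := ι') (Ω' := Ω) kap2 kap2_mp k2 (fun z hz => hz.2)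
  have hK := kato b hΩo hm H₁ H₂ (fun z => hu₁ _) (fun z => hu₂ _) W₁ W₂
    (fun r z => by
      have : (kap1 (z + r • ((1:ℝ), ((0:ℝ), (0:E))))).2 = (kap1 z).2 := by
        ext <;> simp [kap1]
      simp only [this])
    (fun r z => by
      have : (kap2 (z + r • ((-1:ℝ), ((1:ℝ), (0:E))))).2 = (kap2 z).2 := by
        ext
        · simp [kap2]; ring
        · simp [kap2]
      simp only [this])
    (fun z hz h => hf _ _ _ hz.1 hz.2 h) hφc2 hφc hφΩ
    (fun z => mul_nonneg β.nonneg (hΦ0 _))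
  have hφ1 : ContDiff ℝ 1 φ := hφc2.of_le (by norm_num)
  have z1 : ∀ z : ℝ × (ℝ × E), (kap1 z).2 = z.2 := fun z => rfl
  have z2 : ∀ z : ℝ × (ℝ × E), (kap2 z).2 = z.2 + z.1 • ((1:ℝ), (0:E)) := fun z => by
    ext <;> simp [kap2]
  simp only [z1, z2] at hK
  set μ' := (volume : Measure ℝ).prod μ₀ with hμ'
  have mA : Measurable (fun z : ℝ × (ℝ × E) => u₂ (z.2 + z.1 • ((1:ℝ), (0:E)))) :=
    h₂.1.comp (by fun_prop)
  have mB : Measurable (fun z : ℝ × (ℝ × E) => u₂ (z.2 + z.1 • ((1:ℝ), (0:E))) ^ m) :=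
    w₂.1.comp (by fun_prop)
  have lA : LocallyIntegrable (fun z : ℝ × (ℝ × E) =>
      max (u₁ z.2 - u₂ (z.2 + z.1 • ((1:ℝ), (0:E)))) 0) μ' := by
    refine pm_locint (M := M) (((h₁.1.comp measurable_snd).sub mA).max measurable_const) fun z => ?_
    rw [abs_of_nonneg (le_max_right _ _)]
    have := (hu₁ z.2)
    have := (hu₂ (z.2 + z.1 • ((1:ℝ), (0:E))))
    exact max_le (by linarith [this.1, (hu₁ z.2).2]) ((hu₁ z.2).1.trans (hu₁ z.2).2)
  have lB : LocallyIntegrable (fun z : ℝ × (ℝ × E) =>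
      max (u₁ z.2 ^ m - u₂ (z.2 + z.1 • ((1:ℝ), (0:E))) ^ m) 0) μ' := by
    refine pm_locint (M := M₁ + M₂) (((w₁.1.comp measurable_snd).sub mB).max measurable_const)
      fun z => ?_
    rw [abs_of_nonneg (le_max_right _ _)]
    have h1 := abs_le.1 (hM₁ z.2)
    have h2 := abs_le.1 (hM₂ (z.2 + z.1 • ((1:ℝ), (0:E))))
    exact max_le (by linarith) (by linarith)
  have iA : ∀ e, Integrable (fun z : ℝ × (ℝ × E) =>
      max (u₁ z.2 - u₂ (z.2 + z.1 • ((1:ℝ), (0:E)))) 0 * fderiv ℝ φ z e) μ' := fun e =>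
    pm_int1 lA (fderiv_cpt hφ1 hφc e).1 (fderiv_cpt hφ1 hφc e).2
  have iB : Integrable (fun z : ℝ × (ℝ × E) =>
      max (u₁ z.2 ^ m - u₂ (z.2 + z.1 • ((1:ℝ), (0:E))) ^ m) 0 * lapx ι' b φ z) μ' :=
    pm_int1 lB (lapx_cpt ι' b hφc2 hφc).1 (lapx_cpt ι' b hφc2 hφc).2
  rw [← integral_add (iA _) (iA _)] at hK
  have e12 : ∀ z, fderiv ℝ φ z (-1, (1, 0)) + fderiv ℝ φ z (1, (0, 0))
      = fderiv ℝ φ z (0, (1, 0)) := fun z => by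
    rw [← map_add]; simp
  simp only [← mul_add, e12] at hK
  rw [integral_prod _ (iA _), integral_prod _ iB,
    ← integral_add (iA _).integral_prod_left iB.integral_prod_left] at hK
  have hsl : ∀ r y, fderiv ℝ φ (r, y) (0, (1, 0)) = β r * fderiv ℝ Φ y (1, 0) := by
    intro r y
    rw [← fderiv_slice hφ1]
    show fderiv ℝ (fun y => β r * Φ y) y _ = _
    rw [fderiv_const_mul (hΦ.differentiable (by norm_num) y)]
    simp
  have hLr : ∀ r, (∫ y, max (u₁ y - u₂ (y + r • ((1:ℝ), (0:E)))) 0 * fderiv ℝ φ (r, y) (0, (1, 0)) ∂μ₀)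
      + (∫ y, max (u₁ y ^ m - u₂ (y + r • ((1:ℝ), (0:E))) ^ m) 0 * lapx ι' b φ (r, y) ∂μ₀)
      = β r * L r := by
    intro r
    simp only [hL, mul_add, ← integral_const_mul]
    congr 1
    · congr 1; ext y; rw [hsl]; ring
    · congr 1; ext y; rw [hφ, hι', lapx_slice ι b hβ hΦ]; ring
  have hint := (iA (0, (1, 0))).integral_prod_left.add iB.integral_prod_left
  have hint' : Integrable (fun r => β r * L r) := by
    refine hint.congr (ae_of_all _ fun r => ?_)
    exact hLr r
  simp only [hLr] at hK
  have hle : ∫ r, β r * L r ≤ ∫ r, β r * (L0 / 2) := by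
    refine integral_mono hint' (β.integrable.mul_const _) fun r => ?_
    by_cases h0 : β r = 0
    · simp [h0]
    · refine mul_le_mul_of_nonneg_left (hb' r ?_).le β.nonneg
      simpa using (hβs r h0).trans hdδ'
  rw [integral_mul_const] at hle
  have := β.integral_pos (μ := (volume : Measure ℝ))
  nlinarith
end R4

lemma wg_C1 (ι : E →L[ℝ] Z) (Ω : Set Z) {F : Z → ℝ} (hF : ContDiff ℝ 1 F) (hb : ∃ M, ∀ z, |F z| ≤ M) :
    WG μ ι Ω F (gx ι F) := by
  have hgc := continuous_gx ι hF
  refine ⟨hF.continuous.measurable, hb, hgc.measurable, fun K hK => ?_, fun ζ hζ hc _ v => ?_⟩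
  · have : IsFiniteMeasure (μ.restrict K) := ⟨by simpa using hK.measure_lt_top⟩
    obtain ⟨C, hC⟩ := hK.exists_bound_of_continuousOn hgc.continuousOn
    exact MemLp.of_bound hgc.aestronglyMeasurable C
      ((ae_restrict_iff' hK.isClosed.measurableSet).2 (ae_of_all _ hC))
  · simp only [inner_gx]
    have hd : Continuous (fun z => fderiv ℝ F z (ι v)) :=
      (hF.continuous_fderiv (by norm_num)).clm_apply continuous_const
    have hdζ := fderiv_cpt hζ hc (ι v)
    refine integral_mul_fderiv_eq_neg_fderiv_mul_of_integrable ?_ ?_ ?_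
      (fun x _ => hF.differentiable (by norm_num) x) (fun x _ => hζ.differentiable (by norm_num) x)
    · exact pm_int1 hd.locallyIntegrable hζ.continuous hc
    · exact pm_int1 hF.continuous.locallyIntegrable hdζ.1 hdζ.2
    · exact pm_int1 hF.continuous.locallyIntegrable hζ.continuous hc

section R5
variable {η : Measure E} [η.IsAddHaarMeasure]

lemma gx_slice {ρ : ℝ → ℝ} {ϕ : E → ℝ} (hρ : ContDiff ℝ 1 ρ) (hϕ : ContDiff ℝ 1 ϕ) (z : ℝ × E) :
    gx (ContinuousLinearMap.inr ℝ ℝ E) (fun z : ℝ × E => ρ z.1 * ϕ z.2) z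
      = ρ z.1 • gx (ContinuousLinearMap.id ℝ E) ϕ z.2 := by
  refine ext_inner_right ℝ fun v => ?_
  rw [inner_gx, inner_smul_left, inner_gx]
  have hφ : ContDiff ℝ 1 (fun z : ℝ × E => ρ z.1 * ϕ z.2) :=
    (hρ.comp contDiff_fst).mul (hϕ.comp contDiff_snd)
  show fderiv ℝ (fun z : ℝ × E => ρ z.1 * ϕ z.2) (z.1, z.2) (0, v) = _
  rw [← fderiv_slice hφ]
  show fderiv ℝ (fun y => ρ z.1 * ϕ y) z.2 v = _
  rw [fderiv_const_mul (hϕ.differentiable (by norm_num) z.2)]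
  simp

lemma r5a {u f : ℝ × E → ℝ} {g : ℝ × E → E} {u0 : E → ℝ} {m M : ℝ}
    (h : WE ((volume : Measure ℝ).prod η) (ContinuousLinearMap.inr ℝ ℝ E) (1, 0) u g f)
    (w : WG ((volume : Measure ℝ).prod η) (ContinuousLinearMap.inr ℝ ℝ E) {z | 0 < z.1}
      (fun z => u z ^ m) g)
    (hu : ∀ z, u z ∈ Icc 0 M) (hu0 : ∀ t x, t ≤ 0 → u (t, x) = u0 x)
    (hg0 : ∀ z, z.1 ≤ 0 → g z = 0)
    {K ϕ : E → ℝ} (hK : ContDiff ℝ 1 K) (hKc : HasCompactSupport K)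
    (hϕ : ContDiff ℝ 1 ϕ) (hϕc : HasCompactSupport ϕ) :
    ∃ A : ℝ → ℝ, Tendsto A (𝓝[>] 0) (𝓝 0) ∧ ∀ τ, 0 < τ → τ ≤ 1 → ∀ θ : ℝ → ℝ, ContDiff ℝ 1 θ →
      (∀ t, θ t ∈ Icc (0:ℝ) 1) → (∀ t, θ t ≠ 0 → t ∈ Icc (τ / 4) (2 * τ)) →
      |∫ z, (u z - u0 z.2) * ((u z ^ m - K z.2) * (θ z.1 * ϕ z.2))
        ∂((volume : Measure ℝ).prod η)| ≤ τ * A τ := by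
  set ι := ContinuousLinearMap.inr ℝ ℝ E with hι
  set μ₀ := (volume : Measure ℝ).prod η with hμ₀
  have hM0 : 0 ≤ M := (hu 0).1.trans (hu 0).2
  have hua : ∀ z, |u z| ≤ M := fun z => by rw [abs_of_nonneg (hu z).1]; exact (hu z).2
  obtain ⟨M₁, hM₁⟩ := w.2.1
  obtain ⟨BK, hBK⟩ := hKc.exists_bound_of_continuous hK.continuous
  obtain ⟨Bϕ, hBϕ⟩ := hϕc.exists_bound_of_continuous hϕ.continuous
  obtain ⟨BK', hBK'⟩ := (gx_cpt_memLp (μ := η) (ContinuousLinearMap.id ℝ E) hK hKc).1.exists_bound_of_continuous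
    (continuous_gx (ContinuousLinearMap.id ℝ E) hK)
  obtain ⟨Bϕ', hBϕ'⟩ := (gx_cpt_memLp (μ := η) (ContinuousLinearMap.id ℝ E) hϕ hϕc).1.exists_bound_of_continuous
    (continuous_gx (ContinuousLinearMap.id ℝ E) hϕ)
  have hBK0 : 0 ≤ BK := (norm_nonneg _).trans (hBK 0)
  have hBK0' : 0 ≤ BK' := (norm_nonneg _).trans (hBK' 0)
  have hBϕ0 : 0 ≤ Bϕ := (norm_nonneg _).trans (hBϕ 0)
  have hBϕ0' : 0 ≤ Bϕ' := (norm_nonneg _).trans (hBϕ' 0)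
  have hM₁0 : 0 ≤ M₁ := (abs_nonneg _).trans (hM₁ 0)
  set BU := M₁ + BK with hBU
  have hUK : ∀ z, |u z ^ m - K z.2| ≤ BU := fun z =>
    (abs_sub _ _).trans (add_le_add (hM₁ z) (hBK _))
  set c2 := Bϕ * BK' + BU * Bϕ' with hc2
  have hc20 : 0 ≤ c2 := by positivity
  set c3 := BU * Bϕ with hc3
  have hc30 : 0 ≤ c3 := by positivity
  set Kc := tsupport ϕ with hKcdef
  have hKcc : IsCompact Kc := hϕc
  obtain ⟨Cf', hCf'⟩ := h.2.2.2.2.2.1 _ ((isCompact_Icc (a := (-2:ℝ)) (b := 2)).prod hKcc)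
  set Cf := max Cf' 0 with hCfd
  have hCf0 : 0 ≤ Cf := le_max_right _ _
  have hCf : ∀ z ∈ (Icc (-2:ℝ) 2) ×ˢ Kc, |f z| ≤ Cf := fun z hz => (hCf' z hz).trans (le_max_left _ _)
  let S : ℝ → Set (ℝ × E) := fun τ => Icc 0 (2 * τ) ×ˢ Kc
  have hSc : ∀ τ, IsCompact (S τ) := fun τ => isCompact_Icc.prod hKcc
  have hSm : ∀ τ, MeasurableSet (S τ) := fun τ => (hSc τ).isClosed.measurableSet
  let H : ℝ → ℝ × E → ℝ := fun τ => (S τ).indicator (fun z => ‖g z‖ ^ 2)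
  have hHi : ∀ τ, Integrable (H τ) μ₀ := fun τ => by
    have := w.2.2.2.1 _ (hSc τ)
    exact (integrable_indicator_iff (hSm τ)).2 ((memLp_two_iff_integrable_sq_norm this.1).1 this)
  have hH0 : ∀ τ z, 0 ≤ H τ z := fun τ z => indicator_nonneg (fun z _ => by positivity) z
  have hγ : Tendsto (fun τ => ∫ z, H τ z ∂μ₀) (𝓝[>] 0) (𝓝 0) := by
    have e0 : ∫ z : ℝ × E, (0:ℝ) ∂μ₀ = 0 := by simp
    suffices hs : Tendsto (fun τ => ∫ z, H τ z ∂μ₀) (𝓝[>] 0) (𝓝 (∫ z : ℝ × E, (0:ℝ) ∂μ₀)) by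
      simpa only [e0] using hs
    refine tendsto_integral_filter_of_dominated_convergence (f := fun _ => (0:ℝ)) (F := H)
      (l := 𝓝[>] (0:ℝ)) (μ := μ₀) (H 1) ?_ ?_ (hHi 1) ?_
    · exact Eventually.of_forall fun τ => (hHi τ).1
    · have h1 : ∀ᶠ τ : ℝ in 𝓝[>] 0, τ ≤ 1 :=
        nhdsWithin_le_nhds (Iic_mem_nhds one_pos)
      filter_upwards [h1] with τ hτ
      refine ae_of_all _ fun z => ?_
      rw [Real.norm_eq_abs, abs_of_nonneg (hH0 _ _)]
      refine indicator_le_indicator_of_subset ?_ (fun z => by positivity) z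
      exact prod_mono (Icc_subset_Icc le_rfl (by linarith)) le_rfl
    · refine ae_of_all _ fun z => ?_
      rcases le_or_gt z.1 0 with hz | hz
      · have : ∀ τ, H τ z = 0 := fun τ => by
          simp [H, indicator, hg0 z hz]
        simp only [this]
        exact tendsto_const_nhds
      · refine tendsto_const_nhds.congr' ?_
        have h1 : ∀ᶠ τ : ℝ in 𝓝[>] 0, τ < z.1 / 2 :=
          nhdsWithin_le_nhds (Iio_mem_nhds (by positivity))
        filter_upwards [h1] with τ hτ
        refine (indicator_of_notMem (fun hzS => ?_) _).symm
        have := hzS.1.2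
        linarith
  have hvol : ∀ τ, 0 < τ → μ₀.real (S τ) = 2 * τ * η.real Kc := fun τ hτ => by
    simp only [S, hμ₀]
    rw [measureReal_prod_prod]
    simp [hτ.le]
  refine ⟨fun τ => 2 * ((Bϕ + c2) * (2 * ∫ z, H τ z ∂μ₀) + (c2 + Cf * c3) * (2 * τ * η.real Kc)),
    ?_, ?_⟩
  · have t0 : Tendsto (fun τ : ℝ => τ) (𝓝[>] 0) (𝓝 0) := tendsto_nhdsWithin_of_tendsto_nhds tendsto_id
    have := (((hγ.const_mul 2).const_mul (Bϕ + c2)).add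
      (((t0.const_mul 2).mul_const (η.real Kc)).const_mul (c2 + Cf * c3))).const_mul 2
    simpa using this
  intro τ hτ hτ1 θ hθ hθ1 hθs
  set φ : ℝ × E → ℝ := fun z => θ z.1 * ϕ z.2 with hφ
  have hφ1 : ContDiff ℝ 1 φ := (hθ.comp contDiff_fst).mul (hϕ.comp contDiff_snd)
  have hφts : tsupport φ ⊆ Icc (τ / 4) (2 * τ) ×ˢ Kc := by
    refine closure_minimal ?_ (isClosed_Icc.prod (isClosed_tsupport ϕ))
    intro z hz
    exact ⟨hθs _ (left_ne_zero_of_mul hz), subset_tsupport _ (right_ne_zero_of_mul hz)⟩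
  have hφc : HasCompactSupport φ :=
    (isCompact_Icc.prod hKcc).of_isClosed_subset (isClosed_tsupport _) hφts
  have hφΩ : tsupport φ ⊆ {z | 0 < z.1} := fun z hz => by
    have := (hφts hz).1.1
    show 0 < z.1
    linarith
  have hφS : tsupport φ ⊆ S τ := fun z hz => by
    have h1 := hφts hz
    exact ⟨⟨by linarith [h1.1.1], h1.1.2⟩, h1.2⟩
  have hφb : ∀ z, |φ z| ≤ Bϕ := fun z => by
    rw [hφ, abs_mul, abs_of_nonneg (hθ1 _).1]
    exact (mul_le_of_le_one_left (abs_nonneg _) (hθ1 _).2).trans (hBϕ _)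
  have hΩo : IsOpen {z : ℝ × E | 0 < z.1} := isOpen_lt continuous_const continuous_fst
  have hK2 : ContDiff ℝ 1 (fun z : ℝ × E => K z.2) := hK.comp contDiff_snd
  have wK : WG μ₀ ι {z : ℝ × E | 0 < z.1} (fun z => K z.2) (gx ι (fun z : ℝ × E => K z.2)) :=
    wg_C1 ι _ hK2 ⟨BK, fun z => hBK _⟩
  have hgK : ∀ z, ‖gx ι (fun z : ℝ × E => K z.2) z‖ ≤ BK' := fun z => by
    have := gx_slice (ρ := fun _ => 1) contDiff_const hK z
    simp only [one_mul, one_smul] at this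
    rw [hι, this]
    exact hBK' _
  have hgφ : ∀ z, ‖gx ι φ z‖ ≤ Bϕ' := fun z => by
    rw [hι, hφ, gx_slice hθ hϕ z, norm_smul, Real.norm_eq_abs, abs_of_nonneg (hθ1 _).1]
    exact (mul_le_of_le_one_left (norm_nonneg _) (hθ1 _).2).trans (hBϕ' _)
  have hA := adm_main hΩo w wK contDiff_id hφ1 hφc hφΩ
  simp only [id, deriv_id', one_mul] at hA
  set Ψ : ℝ × E → ℝ := fun z => (u z ^ m - K z.2) * φ z with hΨ
  set G : ℝ × E → E := fun z => φ z • (g z - gx ι (fun z : ℝ × E => K z.2) z)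
    + (u z ^ m - K z.2) • gx ι φ z with hG
  have hGb : ∀ z, ‖G z‖ ≤ Bϕ * ‖g z‖ + c2 := fun z => by
    refine (norm_add_le _ _).trans ?_
    rw [norm_smul, norm_smul]
    have a1 : ‖φ z‖ * ‖g z - gx ι (fun z : ℝ × E => K z.2) z‖ ≤ Bϕ * (‖g z‖ + BK') :=
      mul_le_mul (hφb z) ((norm_sub_le _ _).trans (by linarith [hgK z])) (norm_nonneg _) hBϕ0
    have a2 : ‖u z ^ m - K z.2‖ * ‖gx ι φ z‖ ≤ BU * Bϕ' :=
      mul_le_mul (hUK z) (hgφ z) (norm_nonneg _) (by positivity)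
    rw [hc2]; linarith
  have hG0 : ∀ z, z ∉ S τ → G z = 0 := fun z hz => by
    have hz' : z ∉ tsupport φ := fun h => hz (hφS h)
    simp [hG, image_eq_zero_of_notMem_tsupport hz', gx_zero ι hz']
  have hΨ0 : ∀ z, z ∉ S τ → Ψ z = 0 := fun z hz => by
    have hz' : z ∉ tsupport φ := fun h => hz (hφS h)
    simp [hΨ, image_eq_zero_of_notMem_tsupport hz']
  have hΨb : ∀ z, |Ψ z| ≤ c3 := fun z => by
    rw [hΨ, abs_mul]
    exact mul_le_mul (hUK z) (hφb z) (abs_nonneg _) (by positivity)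
  have h1S : Integrable ((S τ).indicator (fun _ => (1:ℝ))) μ₀ :=
    (integrable_indicator_iff (hSm τ)).2 (integrableOn_const (hSc τ).measure_lt_top.ne)
  have h1Sv : ∫ z, (S τ).indicator (fun _ => (1:ℝ)) z ∂μ₀ = 2 * τ * η.real Kc := by
    rw [integral_indicator (hSm τ), ← hvol τ hτ]; simp
  set I : ℝ → ℝ := fun r => ∫ z, u (z + r • ((1:ℝ), (0:E))) * Ψ z ∂μ₀ with hI
  have hder : ∀ r ∈ Icc (-(2 * τ)) 0, ‖-(∫ z, inner ℝ (g (z + r • ((1:ℝ), (0:E)))) (G z) ∂μ₀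
      + ∫ z, f (z + r • ((1:ℝ), (0:E))) * Ψ z ∂μ₀)‖
      ≤ (Bϕ + c2) * (2 * ∫ z, H τ z ∂μ₀) + (c2 + Cf * c3) * (2 * τ * η.real Kc) := by
    intro r hr
    have e1 : ‖∫ z, inner ℝ (g (z + r • ((1:ℝ), (0:E)))) (G z) ∂μ₀‖
        ≤ (Bϕ + c2) * (2 * ∫ z, H τ z ∂μ₀) + c2 * (2 * τ * η.real Kc) := by
      have : (Bϕ + c2) * (2 * ∫ z, H τ z ∂μ₀) + c2 * (2 * τ * η.real Kc)
          = ∫ z, ((Bϕ + c2) * (H τ (z + r • ((1:ℝ), (0:E))) + H τ z)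
            + c2 * (S τ).indicator (fun _ => (1:ℝ)) z) ∂μ₀ := by
        have i1 := (hHi τ).comp_add_right (r • ((1:ℝ), (0:E)))
        have i12 : Integrable (fun z => H τ (z + r • ((1:ℝ), (0:E))) + H τ z) μ₀ := i1.add (hHi τ)
        rw [integral_add (i12.const_mul _) (h1S.const_mul _), integral_const_mul,
          integral_const_mul, h1Sv]
        rw [integral_add i1 (hHi τ), integral_add_right_eq_self (H τ)]
        ring
      rw [this]
      refine norm_integral_le_of_norm_le ?_ (ae_of_all _ fun z => ?_)
      · exact ((((hHi τ).comp_add_right (r • ((1:ℝ), (0:E)))).add (hHi τ)).const_mul _).add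
          (h1S.const_mul _)
      · by_cases hz : z ∈ S τ
        · have a1 : H τ z = ‖g z‖ ^ 2 := indicator_of_mem hz _
          have a2 : ‖g (z + r • ((1:ℝ), (0:E)))‖ ^ 2 ≤ H τ (z + r • ((1:ℝ), (0:E))) := by
            rcases le_or_gt (z + r • ((1:ℝ), (0:E))).1 0 with hz' | hz'
            · rw [hg0 _ hz']; simpa using hH0 _ _
            · have : z + r • ((1:ℝ), (0:E)) ∈ S τ := by
                refine ⟨⟨hz'.le, ?_⟩, ?_⟩
                · have := hz.1.2; have := hr.2; simp; linarith
                · simpa using hz.2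
              exact (indicator_of_mem this (fun z => ‖g z‖ ^ 2)).ge
          rw [indicator_of_mem hz, mul_one]
          refine (norm_inner_le_norm _ _).trans ?_
          refine (mul_le_mul_of_nonneg_left (hGb z) (norm_nonneg _)).trans ?_
          rw [a1]
          set a := ‖g (z + r • ((1:ℝ), (0:E)))‖
          set b := ‖g z‖
          have b1 := mul_nonneg hBϕ0 (sq_nonneg (a - b))
          have b2 := mul_nonneg hc20 (sq_nonneg (a - 1))
          have b3 := mul_nonneg hBϕ0 (sq_nonneg a)
          have b4 := mul_nonneg hBϕ0 (sq_nonneg b)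
          have b5 := mul_nonneg hc20 (sq_nonneg a)
          have b6 := mul_nonneg hc20 (sq_nonneg b)
          have b7 := mul_le_mul_of_nonneg_left a2 (by positivity : 0 ≤ Bϕ + c2)
          nlinarith
        · rw [hG0 z hz, inner_zero_right, norm_zero, indicator_of_notMem hz]
          have := hH0 τ z
          have := hH0 τ (z + r • ((1:ℝ), (0:E)))
          positivity
    have e2 : ‖∫ z, f (z + r • ((1:ℝ), (0:E))) * Ψ z ∂μ₀‖ ≤ Cf * c3 * (2 * τ * η.real Kc) := by
      rw [← h1Sv, ← integral_const_mul]
      refine norm_integral_le_of_norm_le (h1S.const_mul _) (ae_of_all _ fun z => ?_)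
      by_cases hz : z ∈ S τ
      · rw [indicator_of_mem hz, mul_one, norm_mul]
        refine mul_le_mul (hCf _ ⟨⟨?_, ?_⟩, ?_⟩) (hΨb z) (norm_nonneg _) hCf0
        · have := hz.1.1; have := hr.1; simp; linarith
        · have := hz.1.2; have := hr.2; simp; linarith
        · simpa using hz.2
      · rw [hΨ0 z hz, indicator_of_notMem hz]; simp
    rw [norm_neg]
    refine (norm_add_le _ _).trans ?_
    linarith
  have hmv := Convex.norm_image_sub_le_of_norm_hasDerivWithin_le (f := I)
    (s := Icc (-(2 * τ)) 0) (x := -(2 * τ)) (y := 0)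
    (fun r _ => (h.deriv hA r).hasDerivWithinAt) hder (convex_Icc _ _)
    ⟨le_rfl, by linarith⟩ ⟨by linarith, le_rfl⟩
  have hIi : ∀ q, Integrable (fun z => u (z + q) * Ψ z) μ₀ := fun q => by
    have hUm : Measurable (fun z : ℝ × E => u z ^ m - K z.2) := w.1.sub hK2.continuous.measurable
    have : Integrable (fun z => (u (z + q) * (u z ^ m - K z.2)) * φ z) μ₀ :=
      pm_int1 (pm_locint (M := M * BU) ((h.1.comp (measurable_id.add_const q)).mul hUm)
        (fun z => by
          rw [abs_mul]
          exact mul_le_mul (hua _) (hUK z) (abs_nonneg _) hM0)) hφ1.continuous hφc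
    simpa only [hΨ, mul_assoc] using this
  have hdiff : I 0 - I (-(2 * τ)) = ∫ z, (u z - u0 z.2) * Ψ z ∂μ₀ := by
    simp only [hI]
    rw [← integral_sub (hIi _) (hIi _)]
    congr 1; ext z
    by_cases hz : z ∈ S τ
    · have : u (z + (-(2 * τ)) • ((1:ℝ), (0:E))) = u0 z.2 := by
        have e : z + (-(2 * τ)) • ((1:ℝ), (0:E)) = (z.1 - 2 * τ, z.2) := by
          ext
          · simp; ring
          · simp
        rw [e]
        exact hu0 _ _ (by have := hz.1.2; linarith)
      rw [this]; simp; ring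
    · rw [hΨ0 z hz]; simp
  rw [hdiff] at hmv
  have e3 : ‖(0:ℝ) - -(2 * τ)‖ = 2 * τ := by
    rw [Real.norm_eq_abs, abs_of_nonneg (by linarith)]; ring
  rw [e3] at hmv
  refine hmv.trans (le_of_eq ?_)
  ring
end R5

lemma rp_sup {x y m : ℝ} (hm : 1 < m) (hy : 0 ≤ y) (hxy : y ≤ x) : (x - y) ^ m ≤ x ^ m - y ^ m := by
  have := Real.add_rpow_le_rpow_add (a := x - y) (b := y) (sub_nonneg.2 hxy) hy hm.le
  rw [sub_add_cancel] at this
  linarith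

lemma rp_young {x y m κ : ℝ} (hm : 1 < m) (hx : 0 ≤ x) (hy : 0 ≤ y) (hκ : 0 < κ) :
    |x - y| ≤ κ + (κ ^ m)⁻¹ * ((x - y) * (x ^ m - y ^ m)) := by
  have key : ∀ x y : ℝ, 0 ≤ y → y ≤ x → |x - y| ≤ κ + (κ ^ m)⁻¹ * ((x - y) * (x ^ m - y ^ m)) := by
    intro x y hy hxy
    have h1 := rp_sup hm hy hxy
    have h2 : 0 ≤ x - y := sub_nonneg.2 hxy
    have hp : 0 < κ ^ m := Real.rpow_pos_of_pos hκ m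
    have h3 : 0 ≤ (x - y) ^ m := Real.rpow_nonneg h2 m
    rw [abs_of_nonneg h2]
    rcases le_or_gt (x - y) κ with h | h
    · have : 0 ≤ (κ ^ m)⁻¹ * ((x - y) * (x ^ m - y ^ m)) :=
        mul_nonneg (inv_nonneg.2 hp.le) (mul_nonneg h2 (h3.trans h1))
      linarith
    · have h4 : κ ^ m ≤ x ^ m - y ^ m := (Real.rpow_le_rpow hκ.le h.le (by linarith)).trans h1
      have h5 : (x - y) * κ ^ m ≤ (x - y) * (x ^ m - y ^ m) := mul_le_mul_of_nonneg_left h4 h2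
      have h6 := mul_le_mul_of_nonneg_left h5 (inv_nonneg.2 hp.le)
      have h7 : (κ ^ m)⁻¹ * ((x - y) * κ ^ m) = x - y := by field_simp
      linarith
  rcases le_total y x with h | h
  · exact key x y hy h
  · have := key y x hx h
    rw [abs_sub_comm]
    refine this.trans (le_of_eq ?_)
    ring

section R5b
variable {η : Measure E} [η.IsAddHaarMeasure]

lemma r5b {u f : ℝ × E → ℝ} {g : ℝ × E → E} {u0 : E → ℝ} {m M : ℝ} (hm : 1 < m)
    (h : WE ((volume : Measure ℝ).prod η) (ContinuousLinearMap.inr ℝ ℝ E) (1, 0) u g f)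
    (w : WG ((volume : Measure ℝ).prod η) (ContinuousLinearMap.inr ℝ ℝ E) {z | 0 < z.1}
      (fun z => u z ^ m) g)
    (hu : ∀ z, u z ∈ Icc 0 M) (hu0 : ∀ t x, t ≤ 0 → u (t, x) = u0 x)
    (hg0 : ∀ z, z.1 ≤ 0 → g z = 0)
    {ϕ : E → ℝ} (hϕ : ContDiff ℝ 1 ϕ) (hϕc : HasCompactSupport ϕ) (hϕ0 : ∀ x, 0 ≤ ϕ x)
    {ε : ℝ} (hε : 0 < ε) :
    ∀ᶠ τ in 𝓝[>] (0:ℝ), ∀ θ : ℝ → ℝ, ContDiff ℝ 1 θ →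
      (∀ t, θ t ∈ Icc (0:ℝ) 1) → (∀ t, θ t ≠ 0 → t ∈ Icc (τ / 4) (2 * τ)) →
      ∫ z, |u z - u0 z.2| * (θ z.1 * ϕ z.2) ∂((volume : Measure ℝ).prod η) ≤ ε * τ := by
  set μ₀ := (volume : Measure ℝ).prod η with hμ₀
  have hM0 : 0 ≤ M := (hu 0).1.trans (hu 0).2
  have hu0' : ∀ x, u0 x = u (0, x) := fun x => (hu0 0 x le_rfl).symm
  have hu0m : Measurable u0 := by
    have : u0 = fun x => u (0, x) := funext hu0'
    rw [this]; exact h.1.comp (measurable_const.prodMk measurable_id)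
  have hu0I : ∀ x, u0 x ∈ Icc 0 M := fun x => by rw [hu0']; exact hu _
  obtain ⟨Bϕ, hBϕ⟩ := hϕc.exists_bound_of_continuous hϕ.continuous
  have hBϕ0 : 0 ≤ Bϕ := (norm_nonneg _).trans (hBϕ 0)
  have hϕi : Integrable ϕ η := hϕ.continuous.integrable_of_hasCompactSupport hϕc
  set Cϕ := ∫ x, ϕ x ∂η with hCϕ
  have hCϕ0 : 0 ≤ Cϕ := integral_nonneg hϕ0
  set κ := ε / (8 * (Cϕ + 1)) with hκd
  have hκ : 0 < κ := by positivity
  have hκC : κ * Cϕ ≤ ε / 8 := by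
    rw [hκd, div_mul_eq_mul_div, div_le_div_iff₀ (by positivity) (by norm_num)]
    nlinarith
  set k := (κ ^ m)⁻¹ with hk
  have hk0 : 0 < k := inv_pos.2 (Real.rpow_pos_of_pos hκ m)
  set δ := ε / (8 * (k * M * Bϕ + 1)) with hδd
  have hδ : 0 < δ := by positivity
  have hδC : k * M * Bϕ * δ ≤ ε / 8 := by
    rw [hδd, mul_div_assoc', div_le_div_iff₀ (by positivity) (by norm_num)]
    nlinarith
  -- choice of K
  set v : E → ℝ := (tsupport ϕ).indicator (fun x => u0 x ^ m) with hv
  have hts : MeasurableSet (tsupport ϕ) := (isClosed_tsupport ϕ).measurableSet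
  have hvi : Integrable v η := by
    refine (integrable_indicator_iff hts).2 ?_
    refine Measure.integrableOn_of_bounded (M := M ^ m) (IsCompact.measure_lt_top hϕc).ne
      (hu0m.pow_const m).aestronglyMeasurable (ae_of_all _ fun x => ?_)
    rw [Real.norm_eq_abs, abs_of_nonneg (Real.rpow_nonneg (hu0I x).1 _)]
    exact Real.rpow_le_rpow (hu0I x).1 (hu0I x).2 (by linarith)
  obtain ⟨K, hKc, hK, hKδ⟩ := (memLp_one_iff_integrable.2 hvi).exist_eLpNorm_sub_le
    ENNReal.one_ne_top le_rfl hδ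
  have hK1 : ContDiff ℝ 1 K := hK.of_le (by exact_mod_cast le_top)
  have hKi : Integrable K η := hK1.continuous.integrable_of_hasCompactSupport hKc
  have hKδ' : ∫ x, |v x - K x| ∂η ≤ δ := by
    rw [eLpNorm_one_eq_lintegral_enorm, ← ofReal_integral_norm_eq_lintegral_enorm (hvi.sub hKi)] at hKδ
    exact (ENNReal.ofReal_le_ofReal_iff hδ.le).1 hKδ
  obtain ⟨A, hA, hA2⟩ := r5a h w hu hu0 hg0 hK1 hKc hϕ hϕc
  have hkA : ∀ᶠ τ in 𝓝[>] (0:ℝ), k * A τ < ε / 4 := by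
    have := hA.const_mul k
    rw [mul_zero] at this
    exact this.eventually (Iio_mem_nhds (by positivity))
  have h1 : ∀ᶠ τ : ℝ in 𝓝[>] 0, τ ≤ 1 := nhdsWithin_le_nhds (Iic_mem_nhds one_pos)
  have h0 : ∀ᶠ τ : ℝ in 𝓝[>] 0, 0 < τ := self_mem_nhdsWithin
  filter_upwards [hkA, h1, h0] with τ hτA hτ1 hτ θ hθ hθ1 hθs
  have hA3 := hA2 τ hτ hτ1 θ hθ hθ1 hθs
  have hθc : HasCompactSupport θ := HasCompactSupport.intro isCompact_Icc
    (fun t ht => by by_contra hne; exact ht (hθs t hne))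
  have hθi : Integrable θ volume := hθ.continuous.integrable_of_hasCompactSupport hθc
  have hθI : ∫ t, θ t ≤ 2 * τ := by
    have i1 : Integrable ((Icc 0 (2 * τ)).indicator (fun _ => (1:ℝ))) volume :=
      (integrable_indicator_iff measurableSet_Icc).2 (integrableOn_const isCompact_Icc.measure_lt_top.ne)
    have : ∫ t, (Icc 0 (2 * τ)).indicator (fun _ => (1:ℝ)) t = 2 * τ := by
      rw [integral_indicator measurableSet_Icc]; simp [hτ.le]
    rw [← this]
    refine integral_mono hθi i1 fun t => ?_
    by_cases ht : θ t = 0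
    · show θ t ≤ _
      rw [ht]; exact indicator_nonneg (fun _ _ => zero_le_one) _
    · have := hθs t ht
      have h2 : t ∈ Icc 0 (2 * τ) := ⟨by linarith [this.1], this.2⟩
      show θ t ≤ _
      rw [indicator_of_mem h2]; exact (hθ1 t).2
  have hθI0 : 0 ≤ ∫ t, θ t := integral_nonneg fun t => (hθ1 t).1
  set R : E → ℝ := fun x => κ * ϕ x + k * M * (|v x - K x| * ϕ x) with hR
  have hvKi : Integrable (fun x => |v x - K x| * ϕ x) η := by
    refine (hvi.sub hKi).abs.mul_bdd (c := Bϕ) hϕ.continuous.aestronglyMeasurable (ae_of_all _ hBϕ)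
  have hRi : Integrable R η := (hϕi.const_mul _).add (hvKi.const_mul _)
  have hRI : ∫ x, R x ∂η ≤ ε / 4 := by
    rw [hR, integral_add (hϕi.const_mul _) (hvKi.const_mul _), integral_const_mul, integral_const_mul]
    have : ∫ x, |v x - K x| * ϕ x ∂η ≤ Bϕ * δ := by
      refine le_trans ?_ (mul_le_mul_of_nonneg_left hKδ' hBϕ0)
      rw [← integral_const_mul]
      refine integral_mono hvKi ((hvi.sub hKi).abs.const_mul _) fun x => ?_
      show |v x - K x| * ϕ x ≤ Bϕ * |v x - K x|
      rw [mul_comm]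
      exact mul_le_mul_of_nonneg_right ((le_abs_self _).trans (hBϕ x)) (abs_nonneg _)
    have := mul_le_mul_of_nonneg_left this (by positivity : 0 ≤ k * M)
    linarith
  have hφc : HasCompactSupport (fun z : ℝ × E => θ z.1 * ϕ z.2) :=
    HasCompactSupport.intro (hθc.prod hϕc) (fun z hz => by
      by_contra hne
      exact hz ⟨subset_tsupport _ (left_ne_zero_of_mul hne), subset_tsupport _ (right_ne_zero_of_mul hne)⟩)
  have hφ : Continuous (fun z : ℝ × E => θ z.1 * ϕ z.2) :=
    (hθ.continuous.comp continuous_fst).mul (hϕ.continuous.comp continuous_snd)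
  have hum : Measurable (fun z : ℝ × E => u z - u0 z.2) := h.1.sub (hu0m.comp measurable_snd)
  have hub : ∀ z : ℝ × E, |u z - u0 z.2| ≤ M := fun z => by
    have h1 := hu z; have h2 := hu0I z.2
    rw [abs_le]; constructor <;> linarith [h1.1, h1.2, h2.1, h2.2]
  obtain ⟨M₁, hM₁⟩ := w.2.1
  obtain ⟨BK, hBK⟩ := hKc.exists_bound_of_continuous hK1.continuous
  have iL : Integrable (fun z : ℝ × E => |u z - u0 z.2| * (θ z.1 * ϕ z.2)) μ₀ :=
    pm_int1 (pm_locint (M := M) hum.abs (fun z => by rw [abs_abs]; exact hub z)) hφ hφc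
  have i2 : Integrable (fun z : ℝ × E => (u z - u0 z.2) * ((u z ^ m - K z.2) * (θ z.1 * ϕ z.2))) μ₀ := by
    have : Integrable (fun z : ℝ × E => ((u z - u0 z.2) * (u z ^ m - K z.2)) * (θ z.1 * ϕ z.2)) μ₀ :=
      pm_int1 (pm_locint (M := M * (M₁ + BK))
        (hum.mul (w.1.sub (hK1.continuous.measurable.comp measurable_snd)))
        (fun z => by
          rw [abs_mul]
          exact mul_le_mul (hub z) ((abs_sub _ _).trans (add_le_add (hM₁ z) (hBK _)))
            (abs_nonneg _) hM0)) hφ hφc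
    simpa only [mul_assoc] using this
  have i3 : Integrable (fun z : ℝ × E => θ z.1 * R z.2) μ₀ := hθi.mul_prod hRi
  have hle : ∫ z, |u z - u0 z.2| * (θ z.1 * ϕ z.2) ∂μ₀
      ≤ ∫ z, (θ z.1 * R z.2 + k * ((u z - u0 z.2) * ((u z ^ m - K z.2) * (θ z.1 * ϕ z.2)))) ∂μ₀ := by
    refine integral_mono iL (i3.add (i2.const_mul k)) fun z => ?_
    show |u z - u0 z.2| * (θ z.1 * ϕ z.2) ≤ θ z.1 * R z.2 + k * ((u z - u0 z.2) * ((u z ^ m - K z.2) * (θ z.1 * ϕ z.2)))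
    by_cases hz : ϕ z.2 = 0
    · simp [hR, hz]
    have hvz : v z.2 = u0 z.2 ^ m := indicator_of_mem (subset_tsupport _ hz) _
    have hy := rp_young hm (hu z).1 (hu0I z.2).1 hκ
    have hp : 0 ≤ θ z.1 * ϕ z.2 := mul_nonneg (hθ1 _).1 (hϕ0 _)
    have e1 : (u z - u0 z.2) * (u z ^ m - u0 z.2 ^ m)
        ≤ (u z - u0 z.2) * (u z ^ m - K z.2) + M * |v z.2 - K z.2| := by
      rw [hvz]
      have : (u z - u0 z.2) * (K z.2 - u0 z.2 ^ m) ≤ M * |u0 z.2 ^ m - K z.2| := by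
        refine (le_abs_self _).trans ?_
        rw [abs_mul, abs_sub_comm (K z.2)]
        exact mul_le_mul_of_nonneg_right (hub z) (abs_nonneg _)
      linarith
    have e2 := mul_le_mul_of_nonneg_left e1 hk0.le
    have e3 := mul_le_mul_of_nonneg_right (hy.trans (add_le_add le_rfl e2)) hp
    refine e3.trans (le_of_eq ?_)
    simp only [hR]; ring
  refine hle.trans ?_
  rw [integral_add i3 (i2.const_mul k), integral_const_mul]
  have e4 : ∫ z : ℝ × E, θ z.1 * R z.2 ∂μ₀ = (∫ t, θ t) * ∫ x, R x ∂η := integral_prod_mul θ R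
  have e5 := (le_abs_self _).trans hA3
  have e6 := mul_le_mul_of_nonneg_left e5 hk0.le
  have e7 : (∫ t, θ t) * ∫ x, R x ∂η ≤ 2 * τ * (ε / 4) :=
    (mul_le_mul_of_nonneg_left hRI hθI0).trans (mul_le_mul_of_nonneg_right hθI (by positivity))
  have e8 := mul_le_mul_of_nonneg_left hτA.le hτ.le
  rw [e4]
  nlinarith

lemma r5 {u f : ℝ × E → ℝ} {g : ℝ × E → E} {u0 : E → ℝ} {m M : ℝ} (hm : 1 < m)
    (h : WE ((volume : Measure ℝ).prod η) (ContinuousLinearMap.inr ℝ ℝ E) (1, 0) u g f)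
    (w : WG ((volume : Measure ℝ).prod η) (ContinuousLinearMap.inr ℝ ℝ E) {z | 0 < z.1}
      (fun z => u z ^ m) g)
    (hu : ∀ z, u z ∈ Icc 0 M) (hu0 : ∀ t x, t ≤ 0 → u (t, x) = u0 x)
    (hg0 : ∀ z, z.1 ≤ 0 → g z = 0)
    {ϕ : E → ℝ} (hϕ : ContDiff ℝ 1 ϕ) (hϕc : HasCompactSupport ϕ) (hϕ0 : ∀ x, 0 ≤ ϕ x)
    {ε : ℝ} (hε : 0 < ε) :
    ∀ᶠ τ in 𝓝[>] (0:ℝ), ∫ z, |u z - u0 z.2| * ((Icc (τ / 2) τ).indicator (fun _ => 1) z.1 * ϕ z.2)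
      ∂((volume : Measure ℝ).prod η) ≤ ε * τ := by
  have h0 : ∀ᶠ τ : ℝ in 𝓝[>] 0, 0 < τ := self_mem_nhdsWithin
  filter_upwards [r5b hm h w hu hu0 hg0 hϕ hϕc hϕ0 hε, h0] with τ hτb hτ
  let B : ContDiffBump (3 * τ / 4 : ℝ) := ⟨τ / 4, τ / 2, by linarith, by linarith⟩
  have hBs : ∀ t, B t ≠ 0 → t ∈ Icc (τ / 4) (2 * τ) := fun t ht => by
    have : t ∈ Function.support B := ht
    rw [B.support_eq, Real.ball_eq_Ioo] at this
    have h1 := this.1; have h2 := this.2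
    simp only [B] at h1 h2
    constructor <;> linarith
  have hB01 : ∀ t, B t ∈ Icc (0:ℝ) 1 := fun t => ⟨B.nonneg, B.le_one⟩
  refine le_trans ?_ (hτb B B.contDiff hB01 hBs)
  refine integral_mono_of_nonneg (ae_of_all _ fun z => ?_) ?_ (ae_of_all _ fun z => ?_)
  · exact mul_nonneg (abs_nonneg _) (mul_nonneg (indicator_nonneg (fun _ _ => zero_le_one) _) (hϕ0 _))
  · have hu0' : ∀ x, u0 x = u (0, x) := fun x => (hu0 0 x le_rfl).symm
    have hu0m : Measurable u0 := by
      have : u0 = fun x => u (0, x) := funext hu0'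
      rw [this]; exact h.1.comp (measurable_const.prodMk measurable_id)
    refine pm_int1 (pm_locint (M := M) (h.1.sub (hu0m.comp measurable_snd)).abs (fun z => ?_)) ?_ ?_
    · rw [abs_abs]
      have h1 := hu z; have h2 := hu (0, z.2)
      show |u z - u0 z.2| ≤ M
      rw [hu0', abs_le]; constructor <;> linarith [h1.1, h1.2, h2.1, h2.2]
    · exact (B.continuous.comp continuous_fst).mul (hϕ.continuous.comp continuous_snd)
    · exact HasCompactSupport.intro (B.hasCompactSupport.prod hϕc) (fun z hz => by
        by_contra hne
        exact hz ⟨subset_tsupport _ (left_ne_zero_of_mul hne), subset_tsupport _ (right_ne_zero_of_mul hne)⟩)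
  · refine mul_le_mul_of_nonneg_left (mul_le_mul_of_nonneg_right ?_ (hϕ0 _)) (abs_nonneg _)
    by_cases ht : z.1 ∈ Icc (τ / 2) τ
    · rw [indicator_of_mem ht, B.one_of_mem_closedBall]
      rw [Real.closedBall_eq_Icc]
      simp only [B]
      constructor <;> linarith [ht.1, ht.2]
    · rw [indicator_of_notMem ht]; exact (hB01 _).1
end R5b

lemma mp_deriv (k : ℕ) (s : ℝ) :
    HasDerivAt (fun s : ℝ => max s 0 ^ (k + 2)) ((k + 2 : ℝ) * max s 0 ^ (k + 1)) s := by
  rcases lt_trichotomy s 0 with h | h | h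
  · rw [max_eq_right h.le, zero_pow (by omega), mul_zero]
    refine (hasDerivAt_const s (0:ℝ)).congr_of_eventuallyEq ?_
    filter_upwards [Iio_mem_nhds h] with t ht
    simp [max_eq_right (show t < 0 from ht).le]
  · subst h
    simp only [max_self, zero_pow (Nat.succ_ne_zero k), mul_zero]
    rw [hasDerivAt_iff_isLittleO_nhds_zero]
    simp only [zero_add, max_self, smul_zero, sub_zero, zero_pow (Nat.succ_ne_zero (k + 1))]
    have h1 : (fun t : ℝ => max t 0 ^ (k + 2)) =O[𝓝 0] fun t : ℝ => t ^ (k + 2) := by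
      refine Asymptotics.IsBigO.of_bound 1 (Eventually.of_forall fun t => ?_)
      rw [one_mul, norm_pow, norm_pow]
      refine pow_le_pow_left₀ (norm_nonneg _) ?_ _
      rw [Real.norm_eq_abs, Real.norm_eq_abs, abs_of_nonneg (le_max_right _ _)]
      exact max_le (le_abs_self _) (abs_nonneg _)
    exact h1.trans_isLittleO (Asymptotics.isLittleO_pow_id (by omega))
  · have := hasDerivAt_pow (k + 2) s
    rw [max_eq_left h.le]
    refine HasDerivAt.congr_of_eventuallyEq (f := fun s : ℝ => s ^ (k + 2)) ?_ ?_
    · refine this.congr_deriv ?_; push_cast; rfl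
    · filter_upwards [Ioi_mem_nhds h] with t ht
      simp [max_eq_left (show 0 < t from ht).le]

lemma mp_contDiff : ∀ k : ℕ, ContDiff ℝ k (fun s : ℝ => max s 0 ^ (k + 1))
  | 0 => by
    simp only [Nat.cast_zero, contDiff_zero]
    fun_prop
  | k + 1 => by
    have hd : deriv (fun s : ℝ => max s 0 ^ (k + 2)) = fun s => (k + 2 : ℝ) * max s 0 ^ (k + 1) :=
      funext fun s => (mp_deriv k s).deriv
    show ContDiff ℝ (((k + 1 : ℕ)) : WithTop ℕ∞) (fun s : ℝ => max s 0 ^ (k + 2))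
    push_cast
    rw [contDiff_succ_iff_deriv]
    refine ⟨fun s => (mp_deriv k s).differentiableAt, fun h => ?_, ?_⟩
    · exact absurd h (by simp)
    · rw [hd]; exact contDiff_const.mul (mp_contDiff k)

lemma wt_lap {n : ℕ} (b : OrthonormalBasis (Fin n) ℝ E) (k : ℕ) (c : ℝ) (x : E) :
    lapx (ContinuousLinearMap.id ℝ E) b (fun x => max ((1 + ‖x‖ ^ 2)⁻¹ - c) 0 ^ (k + 3)) x
      = 4 * ((k + 3) * (k + 2)) * (max ((1 + ‖x‖ ^ 2)⁻¹ - c) 0 ^ (k + 1)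
          * (1 + ‖x‖ ^ 2)⁻¹ ^ 4 * ‖x‖ ^ 2)
        - 2 * (k + 3) * (max ((1 + ‖x‖ ^ 2)⁻¹ - c) 0 ^ (k + 2)
          * (n * (1 + ‖x‖ ^ 2)⁻¹ ^ 2 - 4 * (1 + ‖x‖ ^ 2)⁻¹ ^ 3 * ‖x‖ ^ 2)) := by
  set y : E → ℝ := fun x => (1 + ‖x‖ ^ 2)⁻¹ with hy
  have hyd : ∀ x, HasFDerivAt y (-((y x) ^ 2) • ((2:ℝ) • innerSL ℝ x)) x := fun x => by
    have h1 : HasFDerivAt (fun x : E => 1 + ‖x‖ ^ 2) ((2:ℝ) • innerSL ℝ x) x :=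
      ((hasStrictFDerivAt_norm_sq x).hasFDerivAt.const_add 1).congr_fderiv (by
        ext v; simp [two_mul])
    have h0 : (1 + ‖x‖ ^ 2 : ℝ) ≠ 0 := by positivity
    have := (hasDerivAt_inv h0).comp_hasFDerivAt x h1
    rw [← inv_pow] at this
    exact this
  have h1 : ∀ x v, fderiv ℝ (fun x => max (y x - c) 0 ^ (k + 3)) x v
      = (k + 3) * max (y x - c) 0 ^ (k + 2) * (-(y x ^ 2) * (2 * inner ℝ x v)) := fun x v => by
    have := (mp_deriv (k + 1) (y x - c)).comp_hasFDerivAt x ((hyd x).sub_const c)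
    have e : (fun x => max (y x - c) 0 ^ (k + 3))
      = (fun s : ℝ => max s 0 ^ (k + 1 + 2)) ∘ fun x => y x - c := rfl
    rw [e, this.fderiv]
    simp only [_root_.smul_apply, smul_eq_mul, innerSL_apply_apply]
    push_cast
    ring
  have h2 : ∀ v, fderiv ℝ (fun x => fderiv ℝ (fun x => max (y x - c) 0 ^ (k + 3)) x v) x v
      = 4 * ((k + 3) * (k + 2)) * (max (y x - c) 0 ^ (k + 1) * y x ^ 4) * (inner ℝ x v) ^ 2
        - 2 * (k + 3) * max (y x - c) 0 ^ (k + 2) * (y x ^ 2 * (inner ℝ v v)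
          - 4 * y x ^ 3 * (inner ℝ x v) ^ 2) := fun v => by
    simp only [h1]
    have a1 := ((mp_deriv k (y x - c)).comp_hasFDerivAt x ((hyd x).sub_const c)).const_mul (k + 3 : ℝ)
    have a2 := ((hyd x).pow 2).neg
    have a3 : HasFDerivAt (fun x : E => 2 * inner ℝ x v) ((2:ℝ) • innerSL ℝ v) x := by
      have := (((innerSL ℝ v).hasFDerivAt (x := x)).const_mul (2:ℝ))
      refine this.congr_of_eventuallyEq (Eventually.of_forall fun z => ?_)
      simp [real_inner_comm v]
    have := a1.mul (a2.mul a3)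
    have e := this.fderiv
    refine (congrArg (fun L : E →L[ℝ] ℝ => L v) e).trans ?_
    simp
    ring
  unfold lapx
  simp only [ContinuousLinearMap.coe_id', id]
  rw [Finset.sum_congr rfl fun i _ => h2 (b i)]
  have s1 : ∑ i, (inner ℝ x (b i)) ^ 2 = ‖x‖ ^ 2 := by
    simpa using b.sum_sq_norm_inner_left x
  have s2 : ∑ i, inner ℝ (b i) (b i) = (n : ℝ) := by simp
  rw [Finset.sum_sub_distrib, ← Finset.mul_sum, ← Finset.mul_sum, Finset.sum_sub_distrib,
    ← Finset.mul_sum, ← Finset.mul_sum, s1, s2]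
  ring

lemma weights {n : ℕ} (b : OrthonormalBasis (Fin n) ℝ E) (η : Measure E) [η.IsAddHaarMeasure] :
    ∃ (a : E → ℝ) (C : ℝ) (ϕ : ℕ → E → ℝ), Integrable a η ∧ Continuous a ∧ (∀ x, 0 < a x) ∧ 0 ≤ C ∧
      (∀ l, ContDiff ℝ 2 (ϕ l)) ∧ (∀ l, HasCompactSupport (ϕ l)) ∧
      (∀ l x, ϕ l x ∈ Icc 0 (a x)) ∧
      (∀ l x, |lapx (ContinuousLinearMap.id ℝ E) b (ϕ l) x| ≤ C * a x) ∧
      ∀ x, Tendsto (fun l => ϕ l x) atTop (𝓝 (a x)) := by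
  have hy0 : ∀ x : E, 0 < (1 + ‖x‖ ^ 2)⁻¹ := fun x => by positivity
  have hyc : ContDiff ℝ 2 (fun x : E => (1 + ‖x‖ ^ 2)⁻¹) :=
    (contDiff_const.add (contDiff_norm_sq ℝ)).inv fun x => by positivity
  have hc0 : ∀ l : ℕ, (0:ℝ) < (1 + (l:ℝ))⁻¹ := fun l => by positivity
  have hmy : ∀ (l : ℕ) (x : E), max ((1 + ‖x‖ ^ 2)⁻¹ - (1 + (l:ℝ))⁻¹) 0 ≤ (1 + ‖x‖ ^ 2)⁻¹ := fun l x =>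
    max_le (by linarith [hc0 l]) (hy0 x).le
  refine ⟨fun x => (1 + ‖x‖ ^ 2)⁻¹ ^ (n + 3), 4 * ((n + 3) * (n + 2)) + 2 * (n + 3) * (n + 4),
    fun l x => max ((1 + ‖x‖ ^ 2)⁻¹ - (1 + (l:ℝ))⁻¹) 0 ^ (n + 3), ?_, hyc.continuous.pow _,
    fun x => pow_pos (hy0 x) _, by positivity, fun l => ?_, fun l => ?_, fun l x => ?_, fun l x => ?_,
    fun x => ?_⟩
  · have hn : Module.finrank ℝ E = n := by
      rw [Module.finrank_eq_card_basis b.toBasis, Fintype.card_fin]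
    have := integrable_rpow_neg_one_add_norm_sq (E := E) (μ := η) (r := 2 * (n + 3 : ℕ)) (by
      rw [hn]; push_cast; linarith [(Nat.cast_nonneg n : (0:ℝ) ≤ n)])
    refine this.congr (ae_of_all _ fun x => ?_)
    show (1 + ‖x‖ ^ 2) ^ (-(2 * ((n + 3 : ℕ) : ℝ)) / 2) = (1 + ‖x‖ ^ 2)⁻¹ ^ (n + 3)
    rw [show -(2 * ((n + 3 : ℕ) : ℝ)) / 2 = -((n + 3 : ℕ) : ℝ) by ring,
      Real.rpow_neg (by positivity), Real.rpow_natCast, inv_pow]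
  · have h3 : ContDiff ℝ 2 (fun s : ℝ => max s 0 ^ (n + 3)) :=
      (mp_contDiff (n + 2)).of_le (by exact_mod_cast (by omega : 2 ≤ n + 2))
    exact h3.comp (hyc.sub contDiff_const)
  · refine HasCompactSupport.intro (isCompact_closedBall (0:E) (Real.sqrt l)) fun x hx => ?_
    rw [mem_closedBall_zero_iff, not_le] at hx
    have hx2 := (Real.sqrt_lt' ((Real.sqrt_nonneg _).trans_lt hx)).1 hx
    have : (1 + ‖x‖ ^ 2)⁻¹ ≤ (1 + (l:ℝ))⁻¹ := inv_anti₀ (by positivity) (by linarith)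
    show max ((1 + ‖x‖ ^ 2)⁻¹ - (1 + (l:ℝ))⁻¹) 0 ^ (n + 3) = 0
    rw [max_eq_right (by linarith), zero_pow (by omega)]
  · exact ⟨pow_nonneg (le_max_right _ _) _, pow_le_pow_left₀ (le_max_right _ _) (hmy l x) _⟩
  · rw [wt_lap]
    have p0 := le_max_right ((1 + ‖x‖ ^ 2)⁻¹ - (1 + (l:ℝ))⁻¹) 0
    have p1 := hmy l x
    set p := max ((1 + ‖x‖ ^ 2)⁻¹ - (1 + (l:ℝ))⁻¹) 0
    have y0 := hy0 x
    have y1 : (1 + ‖x‖ ^ 2)⁻¹ ≤ 1 := inv_le_one_of_one_le₀ (by nlinarith [norm_nonneg x])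
    have y2 : (1 + ‖x‖ ^ 2)⁻¹ * ‖x‖ ^ 2 ≤ 1 := by
      rw [inv_mul_le_iff₀ (by positivity)]; linarith
    have y3 : 0 ≤ (1 + ‖x‖ ^ 2)⁻¹ * ‖x‖ ^ 2 := by positivity
    set y := (1 + ‖x‖ ^ 2)⁻¹
    have q1 : p ^ (n + 1) ≤ y ^ (n + 1) := pow_le_pow_left₀ p0 p1 _
    have q2 : p ^ (n + 2) ≤ y ^ (n + 2) := pow_le_pow_left₀ p0 p1 _
    have e1 : p ^ (n + 1) * y ^ 4 * ‖x‖ ^ 2 ∈ Icc 0 (y ^ (n + 3)) := by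
      refine ⟨by positivity, ?_⟩
      calc p ^ (n + 1) * y ^ 4 * ‖x‖ ^ 2 = p ^ (n + 1) * (y ^ 3 * (y * ‖x‖ ^ 2)) := by ring
        _ ≤ y ^ (n + 1) * (y ^ 2 * 1) := by
          refine mul_le_mul q1 (mul_le_mul ?_ y2 y3 (by positivity)) (by positivity) (by positivity)
          exact pow_le_pow_of_le_one y0.le y1 (by norm_num)
        _ = y ^ (n + 3) := by ring
    have e2 : |n * y ^ 2 - 4 * y ^ 3 * ‖x‖ ^ 2| ≤ (n + 4) * y := by
      have r1 : 4 * y ^ 3 * ‖x‖ ^ 2 = 4 * (y ^ 2 * (y * ‖x‖ ^ 2)) := by ring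
      have r2 : y ^ 2 * (y * ‖x‖ ^ 2) ≤ y ^ 2 := mul_le_of_le_one_right (by positivity) y2
      have r3 : 0 ≤ y ^ 2 * (y * ‖x‖ ^ 2) := by positivity
      have r4 : y ^ 2 ≤ y := by nlinarith
      have r5 : (n:ℝ) * y ^ 2 ≤ n * y := mul_le_mul_of_nonneg_left r4 (Nat.cast_nonneg n)
      have r6 : 0 ≤ (n:ℝ) * y ^ 2 := by positivity
      have r7 : 0 ≤ (n:ℝ) * y := by positivity
      rw [r1, abs_le]; constructor <;> linarith
    have e3 : |p ^ (n + 2) * (n * y ^ 2 - 4 * y ^ 3 * ‖x‖ ^ 2)| ≤ (n + 4) * y ^ (n + 3) := by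
      rw [abs_mul, abs_of_nonneg (pow_nonneg p0 _)]
      refine (mul_le_mul q2 e2 (abs_nonneg _) (by positivity)).trans (le_of_eq ?_)
      ring
    refine (abs_sub _ _).trans ?_
    rw [abs_mul, abs_mul (2 * ((n:ℝ) + 3)), abs_of_nonneg e1.1,
      abs_of_nonneg (by positivity : (0:ℝ) ≤ 4 * ((n + 3) * (n + 2))),
      abs_of_nonneg (by positivity : (0:ℝ) ≤ 2 * (n + 3))]
    have f1 := mul_le_mul_of_nonneg_left e1.2 (by positivity : (0:ℝ) ≤ 4 * ((n + 3) * (n + 2)))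
    have f2 := mul_le_mul_of_nonneg_left e3 (by positivity : (0:ℝ) ≤ 2 * (n + 3))
    refine (add_le_add f1 f2).trans (le_of_eq ?_)
    ring
  · have h1 : Tendsto (fun l : ℕ => (1 + (l:ℝ))⁻¹) atTop (𝓝 0) :=
      tendsto_inv_atTop_zero.comp (tendsto_atTop_add_const_left _ _ tendsto_natCast_atTop_atTop)
    have h2 := (((tendsto_const_nhds (x := (1 + ‖x‖ ^ 2)⁻¹)).sub h1).max
      (tendsto_const_nhds (x := (0:ℝ)))).pow (n + 3)
    rw [sub_zero, max_eq_left (hy0 x).le] at h2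
    exact h2

lemma tcut {lam T : ℝ} (hl : 0 ≤ lam) {χ : ℝ → ℝ}
    (hχ : χ = fun t => Real.exp (-lam * t) * Real.smoothTransition (T - t)) :
    ContDiff ℝ 2 χ ∧ (∀ t, deriv χ t ≤ -lam * χ t) ∧ (∀ t, 0 ≤ χ t) ∧ (∀ t, 0 ≤ t → χ t ≤ 1) ∧
      (∀ t, T ≤ t → χ t = 0) ∧ ∀ t, t < T → 0 < χ t := by
  subst hχ
  have hS : ContDiff ℝ 2 Real.smoothTransition := Real.smoothTransition.contDiff
  refine ⟨(Real.contDiff_exp.comp (contDiff_const.mul contDiff_id)).mul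
    (hS.comp (contDiff_const.sub contDiff_id)), fun t => ?_, fun t => ?_, fun t ht => ?_, fun t ht => ?_,
    fun t ht => ?_⟩
  · have h1 : HasDerivAt (fun t => Real.exp (-lam * t)) (Real.exp (-lam * t) * (-lam * 1)) t :=
      ((hasDerivAt_id t).const_mul (-lam)).exp
    have h2 : HasDerivAt (fun t => Real.smoothTransition (T - t))
        (deriv Real.smoothTransition (T - t) * (-1)) t :=
      ((hS.differentiable (by norm_num)) (T - t)).hasDerivAt.comp t ((hasDerivAt_id t).const_sub T)
    refine (h1.mul h2).deriv.le.trans ?_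
    have h3 : 0 ≤ deriv Real.smoothTransition (T - t) := Real.smoothTransition.monotone.deriv_nonneg
    have h4 := mul_nonneg (Real.exp_pos (-lam * t)).le h3
    show _ ≤ -lam * (Real.exp (-lam * t) * Real.smoothTransition (T - t))
    nlinarith
  · exact mul_nonneg (Real.exp_pos _).le (Real.smoothTransition.nonneg _)
  · refine mul_le_one₀ ?_ (Real.smoothTransition.nonneg _) (Real.smoothTransition.le_one _)
    rw [Real.exp_le_one_iff]; nlinarith
  · show _ * Real.smoothTransition (T - t) = 0
    rw [Real.smoothTransition.zero_of_nonpos (by linarith), mul_zero]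
  · exact mul_pos (Real.exp_pos _) (Real.smoothTransition.pos_of_pos (by linarith))

lemma rcut : ∃ C : ℝ, 0 ≤ C ∧ ∀ τ : ℝ, 0 < τ → ∀ t,
    deriv (fun t => Real.smoothTransition (2 * t / τ - 1)) t
      ≤ C / τ * (Icc (τ / 2) τ).indicator (fun _ => 1) t := by
  have hS : ContDiff ℝ 2 Real.smoothTransition := Real.smoothTransition.contDiff
  obtain ⟨C, hC⟩ := (isCompact_Icc (a := (0:ℝ)) (b := 1)).exists_bound_of_continuousOn
    (hS.continuous_deriv (by norm_num)).continuousOn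
  have hC0 : 0 ≤ C := (norm_nonneg _).trans (hC 0 (by simp))
  refine ⟨2 * C, by positivity, fun τ hτ t => ?_⟩
  have h1 : HasDerivAt (fun t : ℝ => 2 * t / τ - 1) (2 * 1 / τ) t :=
    (((hasDerivAt_id t).const_mul 2).div_const τ).sub_const 1
  have h2 : HasDerivAt (fun t => Real.smoothTransition (2 * t / τ - 1))
      (deriv Real.smoothTransition (2 * t / τ - 1) * (2 * 1 / τ)) t :=
    HasDerivAt.comp (h₂ := Real.smoothTransition) t
      ((hS.differentiable (by norm_num)) (2 * t / τ - 1)).hasDerivAt h1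
  rw [h2.deriv]
  by_cases ht : t ∈ Icc (τ / 2) τ
  · rw [indicator_of_mem ht]
    have : 2 * t / τ - 1 ∈ Icc (0:ℝ) 1 := by
      constructor
      · rw [sub_nonneg, le_div_iff₀ hτ]; linarith [ht.1]
      · rw [sub_le_iff_le_add, div_le_iff₀ hτ]; linarith [ht.2]
    have h3 := (le_abs_self _).trans (hC _ this)
    refine (mul_le_mul_of_nonneg_right h3 (by positivity)).trans (le_of_eq ?_)
    ring
  · rw [indicator_of_notMem ht, mul_zero]
    have : deriv Real.smoothTransition (2 * t / τ - 1) = 0 := by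
      rw [mem_Icc, not_and_or, not_le, not_le] at ht
      rcases ht with ht | ht
      · have h4 : 2 * t / τ - 1 < 0 := by rw [sub_neg, div_lt_iff₀ hτ]; linarith
        have : Real.smoothTransition =ᶠ[𝓝 (2 * t / τ - 1)] fun _ => 0 := by
          filter_upwards [Iio_mem_nhds h4] with s hs
          exact Real.smoothTransition.zero_of_nonpos (show s < 0 from hs).le
        rw [this.deriv_eq]; simp
      · have h4 : 1 < 2 * t / τ - 1 := by rw [lt_sub_iff_add_lt, lt_div_iff₀ hτ]; linarith
        have : Real.smoothTransition =ᶠ[𝓝 (2 * t / τ - 1)] fun _ => 1 := by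
          filter_upwards [Ioi_mem_nhds h4] with s hs
          exact Real.smoothTransition.one_of_one_le (show 1 < s from hs).le
        rw [this.deriv_eq]; simp
    rw [this, zero_mul]

section R6
variable {η : Measure E} [η.IsAddHaarMeasure]

lemma bint {w : ℝ × E → ℝ} {M : ℝ} (hw : Measurable w) (hM : ∀ z, |w z| ≤ M) {X : ℝ → ℝ} {ϕ : E → ℝ}
    (hX : Integrable X volume) (hϕ : Integrable ϕ η) :
    Integrable (fun z : ℝ × E => w z * (X z.1 * ϕ z.2)) ((volume : Measure ℝ).prod η) :=
  (hX.mul_prod hϕ).bdd_mul (c := M) hw.aestronglyMeasurable (ae_of_all _ hM)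

lemma fderiv_t {θ : ℝ → ℝ} {ϕ : E → ℝ} (hθ : Differentiable ℝ θ) (hϕ : Differentiable ℝ ϕ) (z : ℝ × E) :
    fderiv ℝ (fun z : ℝ × E => θ z.1 * ϕ z.2) z (1, 0) = deriv θ z.1 * ϕ z.2 := by
  have h1 := (hθ z.1).hasDerivAt.comp_hasFDerivAt z (hasFDerivAt_fst (𝕜 := ℝ) (E := ℝ) (F := E) (p := z))
  have h2 := (hϕ z.2).hasFDerivAt.comp z (hasFDerivAt_snd (𝕜 := ℝ) (E := ℝ) (F := E) (p := z))
  have := (h1.mul h2).fderiv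
  refine (congrArg (fun L : ℝ × E →L[ℝ] ℝ => L (1, 0)) this).trans ?_
  simp
  ring

lemma r6a {n : ℕ} (b : OrthonormalBasis (Fin n) ℝ E) {w U : ℝ × E → ℝ} {M : ℝ}
    (hw : Measurable w) (hU : Measurable U) (hwM : ∀ z, w z ∈ Icc 0 M) (hUM : ∀ z, U z ∈ Icc 0 M)
    (h4 : ∀ Φ : ℝ × E → ℝ, ContDiff ℝ 2 Φ → HasCompactSupport Φ → tsupport Φ ⊆ {z | 0 < z.1} →
      (∀ z, 0 ≤ Φ z) → 0 ≤ ∫ z, w z * fderiv ℝ Φ z (1, 0) ∂((volume : Measure ℝ).prod η)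
      + ∫ z, U z * lapx (ContinuousLinearMap.inr ℝ ℝ E) b Φ z ∂((volume : Measure ℝ).prod η))
    (h5 : ∀ ϕ : E → ℝ, ContDiff ℝ 1 ϕ → HasCompactSupport ϕ → (∀ x, 0 ≤ ϕ x) → ∀ ε > 0,
      ∀ᶠ τ in 𝓝[>] (0:ℝ), ∫ z, w z * ((Icc (τ / 2) τ).indicator (fun _ => 1) z.1 * ϕ z.2)
        ∂((volume : Measure ℝ).prod η) ≤ ε * τ)
    {lam T : ℝ} (hl : 0 ≤ lam) {χ : ℝ → ℝ}
    (hχ : χ = fun t => Real.exp (-lam * t) * Real.smoothTransition (T - t))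
    {ϕ : E → ℝ} (hϕ : ContDiff ℝ 2 ϕ) (hϕc : HasCompactSupport ϕ) (hϕ0 : ∀ x, 0 ≤ ϕ x) :
    Integrable ((Ioi 0).indicator χ) volume ∧
    lam * ∫ z, w z * ((Ioi 0).indicator χ z.1 * ϕ z.2) ∂((volume : Measure ℝ).prod η)
      ≤ ∫ z, U z * ((Ioi 0).indicator χ z.1 * |lapx (ContinuousLinearMap.id ℝ E) b ϕ z.2|)
        ∂((volume : Measure ℝ).prod η) := by
  set μ₀ := (volume : Measure ℝ).prod η with hμ₀
  obtain ⟨c1, c2, c3, c4, c5, -⟩ := tcut hl hχ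
  clear hχ
  set X := (Ioi (0:ℝ)).indicator χ with hX
  have hX01 : ∀ t, X t ∈ Icc (0:ℝ) 1 := fun t => by
    by_cases ht : t ∈ Ioi (0:ℝ)
    · rw [hX, indicator_of_mem ht]; exact ⟨c3 t, c4 t (le_of_lt (show 0 < t from ht))⟩
    · rw [hX, indicator_of_notMem ht]; simp
  have hI1 : ∀ s t : ℝ, Integrable ((Icc s t).indicator (fun _ => (1:ℝ))) volume := fun s t =>
    (integrable_indicator_iff measurableSet_Icc).2 (integrableOn_const isCompact_Icc.measure_lt_top.ne)
  have hXT : ∀ t, X t ≤ (Icc 0 T).indicator (fun _ => (1:ℝ)) t := fun t => by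
    by_cases ht : t ∈ Icc 0 T
    · rw [indicator_of_mem ht]; exact (hX01 t).2
    · rw [indicator_of_notMem ht]
      by_cases h0 : t ∈ Ioi (0:ℝ)
      · rw [hX, indicator_of_mem h0, c5]
        by_contra hT
        exact ht ⟨le_of_lt h0, (not_le.1 hT).le⟩
      · rw [hX, indicator_of_notMem h0]
  have hXm : Measurable X := c1.continuous.measurable.indicator measurableSet_Ioi
  have hXi : Integrable X volume := (hI1 0 T).mono' hXm.aestronglyMeasurable (ae_of_all _ fun t => by
    rw [Real.norm_eq_abs, abs_of_nonneg (hX01 t).1]; exact hXT t)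
  refine ⟨hXi, ?_⟩
  have hwa : ∀ z, |w z| ≤ M := fun z => by rw [abs_of_nonneg (hwM z).1]; exact (hwM z).2
  have hUa : ∀ z, |U z| ≤ M := fun z => by rw [abs_of_nonneg (hUM z).1]; exact (hUM z).2
  have hϕ1 : ContDiff ℝ 1 ϕ := hϕ.of_le (by norm_num)
  have hϕi : Integrable ϕ η := hϕ.continuous.integrable_of_hasCompactSupport hϕc
  obtain ⟨hLc, hLs⟩ := lapx_cpt (ContinuousLinearMap.id ℝ E) b hϕ hϕc
  set Lϕ := lapx (ContinuousLinearMap.id ℝ E) b ϕ with hLϕ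
  have hLi : Integrable (fun x => |Lϕ x|) η := (hLc.integrable_of_hasCompactSupport hLs).abs
  have hLi' : Integrable Lϕ η := hLc.integrable_of_hasCompactSupport hLs
  obtain ⟨C, hC0, hC⟩ := rcut
  let ρ : ℝ → ℝ → ℝ := fun τ t => Real.smoothTransition (2 * t / τ - 1)
  have hρ : ∀ τ, ContDiff ℝ 2 (ρ τ) := fun τ =>
    (Real.smoothTransition.contDiff (n := 2)).comp
      (((contDiff_const.mul contDiff_id).div_const τ).sub contDiff_const)
  have hρ0 : ∀ τ t, 0 ≤ ρ τ t := fun τ t => Real.smoothTransition.nonneg _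
  have hρ1 : ∀ τ t, ρ τ t ≤ 1 := fun τ t => Real.smoothTransition.le_one _
  have hρz : ∀ τ, 0 < τ → ∀ t, t < τ / 2 → ρ τ t = 0 := fun τ hτ t ht =>
    Real.smoothTransition.zero_of_nonpos (by
      rw [sub_nonpos, div_le_iff₀ hτ]; linarith)
  have hρX : ∀ τ, 0 < τ → ∀ t, ρ τ t * χ t ∈ Icc 0 (X t) := fun τ hτ t => by
    refine ⟨mul_nonneg (hρ0 _ _) (c3 t), ?_⟩
    by_cases h0 : t ∈ Ioi (0:ℝ)
    · rw [hX, indicator_of_mem h0]; exact mul_le_of_le_one_left (c3 t) (hρ1 _ _)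
    · have : ρ τ t = 0 := hρz τ hτ t (by have : t ≤ 0 := not_lt.1 h0; linarith)
      rw [this, zero_mul]; exact (hX01 t).1
  have hρc : ∀ τ, Continuous (fun t => ρ τ t * χ t) := fun τ => (hρ τ).continuous.mul c1.continuous
  have hρi : ∀ τ, 0 < τ → Integrable (fun t => ρ τ t * χ t) volume := fun τ hτ =>
    hXi.mono' (hρc τ).aestronglyMeasurable (ae_of_all _ fun t => by
      rw [Real.norm_eq_abs, abs_of_nonneg (hρX τ hτ t).1]; exact (hρX τ hτ t).2)
  have h0 : ∀ᶠ τ : ℝ in 𝓝[>] 0, 0 < τ := self_mem_nhdsWithin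
  have hlim : Tendsto (fun τ => ∫ z, w z * (ρ τ z.1 * χ z.1 * ϕ z.2) ∂μ₀) (𝓝[>] 0)
      (𝓝 (∫ z, w z * (X z.1 * ϕ z.2) ∂μ₀)) := by
    refine tendsto_integral_filter_of_dominated_convergence (fun z => w z * (X z.1 * ϕ z.2)) ?_ ?_
      (bint hw hwa hXi hϕi) (ae_of_all _ fun z => ?_)
    · filter_upwards [h0] with τ hτ
      exact (bint hw hwa (hρi τ hτ) hϕi).1
    · filter_upwards [h0] with τ hτ
      refine ae_of_all _ fun z => ?_
      have a1 := hρX τ hτ z.1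
      rw [Real.norm_eq_abs, abs_of_nonneg (mul_nonneg (hwM z).1 (mul_nonneg a1.1 (hϕ0 _)))]
      exact mul_le_mul_of_nonneg_left (mul_le_mul_of_nonneg_right a1.2 (hϕ0 _)) (hwM z).1
    · refine tendsto_const_nhds.congr' ?_
      by_cases hz : z.1 ∈ Ioi (0:ℝ)
      · have h1 : ∀ᶠ τ : ℝ in 𝓝[>] 0, τ < z.1 := nhdsWithin_le_nhds (Iio_mem_nhds hz)
        filter_upwards [h0, h1] with τ hτ hτz
        have : ρ τ z.1 = 1 := Real.smoothTransition.one_of_one_le (by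
          rw [le_sub_iff_add_le, le_div_iff₀ hτ]; linarith)
        rw [this, one_mul, hX, indicator_of_mem hz]
      · filter_upwards [h0] with τ hτ
        have := hρz τ hτ z.1 (by have : z.1 ≤ 0 := not_lt.1 hz; linarith)
        rw [this, hX, indicator_of_notMem hz]; simp
  refine le_of_forall_pos_le_add fun ε hε => ?_
  refine le_of_tendsto (hlim.const_mul lam) ?_
  filter_upwards [h0, h5 ϕ hϕ1 hϕc hϕ0 (ε / (C + 1)) (by positivity)] with τ hτ hJ
  set Φ : ℝ × E → ℝ := fun z => (ρ τ z.1 * χ z.1) * ϕ z.2 with hΦ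
  have hθ2 : ContDiff ℝ 2 (fun t => ρ τ t * χ t) := (hρ τ).mul c1
  have hΦts : tsupport Φ ⊆ Icc (τ / 2) T ×ˢ tsupport ϕ := by
    refine closure_minimal ?_ (isClosed_Icc.prod (isClosed_tsupport ϕ))
    intro z hz
    have z1 : ρ τ z.1 * χ z.1 ≠ 0 := left_ne_zero_of_mul hz
    refine ⟨⟨?_, ?_⟩, subset_tsupport _ (right_ne_zero_of_mul hz)⟩
    · by_contra h; exact left_ne_zero_of_mul z1 (hρz τ hτ _ (not_le.1 h))
    · by_contra h; exact right_ne_zero_of_mul z1 (c5 _ (not_le.1 h).le)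
  have hr := h4 Φ ((hθ2.comp contDiff_fst).mul (hϕ.comp contDiff_snd))
    ((isCompact_Icc.prod hϕc).of_isClosed_subset (isClosed_tsupport _) hΦts)
    (fun z hz => by have := (hΦts hz).1.1; show 0 < z.1; linarith)
    (fun z => mul_nonneg (hρX τ hτ z.1).1 (hϕ0 _))
  have hlap : ∀ z : ℝ × E, lapx (ContinuousLinearMap.inr ℝ ℝ E) b Φ z = ρ τ z.1 * χ z.1 * Lϕ z.2 :=
    fun z => lapx_slice (ContinuousLinearMap.id ℝ E) b hθ2 hϕ z.1 z.2
  have hdt : ∀ z : ℝ × E, fderiv ℝ Φ z (1, 0) = deriv (fun t => ρ τ t * χ t) z.1 * ϕ z.2 :=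
    fun z => fderiv_t (hθ2.differentiable (by norm_num)) (hϕ.differentiable (by norm_num)) z
  simp only [hlap, hdt] at hr
  have hθd : ∀ t, deriv (fun t => ρ τ t * χ t) t
      ≤ C / τ * (Icc (τ / 2) τ).indicator (fun _ => 1) t - lam * (ρ τ t * χ t) := fun t => by
    have := (((hρ τ).differentiable (by norm_num) t).hasDerivAt.mul
      ((c1.differentiable (by norm_num)) t).hasDerivAt).deriv
    refine this.le.trans ?_
    have e1 := mul_le_mul_of_nonneg_left (c2 t) (hρ0 τ t)
    have e2 : deriv (ρ τ) t * χ t ≤ C / τ * (Icc (τ / 2) τ).indicator (fun _ => 1) t := by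
      refine (mul_le_mul_of_nonneg_right (hC τ hτ t) (c3 t)).trans ?_
      by_cases ht : t ∈ Icc (τ / 2) τ
      · rw [indicator_of_mem ht]
        exact mul_le_of_le_one_right (by positivity) (c4 t (by linarith [ht.1]))
      · rw [indicator_of_notMem ht]; simp
    linarith
  have hθ'i : Integrable (deriv (fun t => ρ τ t * χ t)) volume := by
    have hcs : HasCompactSupport (fun t => ρ τ t * χ t) :=
      HasCompactSupport.intro (isCompact_Icc (a := τ / 2) (b := T)) fun t ht => by
        by_contra hne
        refine ht ⟨?_, ?_⟩
        · by_contra h; exact left_ne_zero_of_mul hne (hρz τ hτ _ (not_le.1 h))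
        · by_contra h; exact right_ne_zero_of_mul hne (c5 _ (not_le.1 h).le)
    exact (hθ2.continuous_deriv (by norm_num)).integrable_of_hasCompactSupport hcs.deriv
  have iw := bint hw hwa (hI1 (τ / 2) τ) hϕi
  have iρ := bint hw hwa (hρi τ hτ) hϕi
  have k1 : ∫ z, w z * (deriv (fun t => ρ τ t * χ t) z.1 * ϕ z.2) ∂μ₀
      ≤ C / τ * ∫ z, w z * ((Icc (τ / 2) τ).indicator (fun _ => 1) z.1 * ϕ z.2) ∂μ₀
        - lam * ∫ z, w z * (ρ τ z.1 * χ z.1 * ϕ z.2) ∂μ₀ := by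
    rw [← integral_const_mul, ← integral_const_mul, ← integral_sub (iw.const_mul _) (iρ.const_mul _)]
    refine integral_mono (bint hw hwa hθ'i hϕi) ((iw.const_mul _).sub (iρ.const_mul _)) fun z => ?_
    have := mul_le_mul_of_nonneg_left (mul_le_mul_of_nonneg_right (hθd z.1) (hϕ0 z.2)) (hwM z).1
    refine this.trans (le_of_eq ?_)
    show _ = C / τ * (w z * ((Icc (τ / 2) τ).indicator (fun _ => 1) z.1 * ϕ z.2))
      - lam * (w z * (ρ τ z.1 * χ z.1 * ϕ z.2))
    ring
  have k2 : ∫ z, U z * (ρ τ z.1 * χ z.1 * Lϕ z.2) ∂μ₀ ≤ ∫ z, U z * (X z.1 * |Lϕ z.2|) ∂μ₀ := by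
    refine integral_mono (bint hU hUa (hρi τ hτ) hLi') (bint hU hUa hXi hLi) fun z => ?_
    have a1 := hρX τ hτ z.1
    refine mul_le_mul_of_nonneg_left ?_ (hUM z).1
    exact (mul_le_mul_of_nonneg_left (le_abs_self _) a1.1).trans
      (mul_le_mul_of_nonneg_right a1.2 (abs_nonneg _))
  have k3 := mul_le_mul_of_nonneg_left hJ (by positivity : 0 ≤ C / τ)
  have k4 : C / τ * (ε / (C + 1) * τ) ≤ ε := by
    have : C / τ * (ε / (C + 1) * τ) = C * ε / (C + 1) := by field_simp
    rw [this, div_le_iff₀ (by positivity)]; nlinarith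
  linarith

lemma r6 {n : ℕ} (b : OrthonormalBasis (Fin n) ℝ E) {w U : ℝ × E → ℝ} {M L : ℝ}
    (hw : Measurable w) (hU : Measurable U) (hwM : ∀ z, w z ∈ Icc 0 M) (hUM : ∀ z, U z ∈ Icc 0 M)
    (hL0 : 0 ≤ L) (hL : ∀ z, U z ≤ L * w z)
    (h4 : ∀ Φ : ℝ × E → ℝ, ContDiff ℝ 2 Φ → HasCompactSupport Φ → tsupport Φ ⊆ {z | 0 < z.1} →
      (∀ z, 0 ≤ Φ z) → 0 ≤ ∫ z, w z * fderiv ℝ Φ z (1, 0) ∂((volume : Measure ℝ).prod η)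
      + ∫ z, U z * lapx (ContinuousLinearMap.inr ℝ ℝ E) b Φ z ∂((volume : Measure ℝ).prod η))
    (h5 : ∀ ϕ : E → ℝ, ContDiff ℝ 1 ϕ → HasCompactSupport ϕ → (∀ x, 0 ≤ ϕ x) → ∀ ε > 0,
      ∀ᶠ τ in 𝓝[>] (0:ℝ), ∫ z, w z * ((Icc (τ / 2) τ).indicator (fun _ => 1) z.1 * ϕ z.2)
        ∂((volume : Measure ℝ).prod η) ≤ ε * τ) :
    ∀ᵐ z ∂((volume : Measure ℝ).prod η), 0 < z.1 → w z = 0 := by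
  set μ₀ := (volume : Measure ℝ).prod η with hμ₀
  obtain ⟨a, C, ϕ, ai, -, a0, C0, p1, p2, p3, p4, p5⟩ := weights b η
  have hwa : ∀ z, |w z| ≤ M := fun z => by rw [abs_of_nonneg (hwM z).1]; exact (hwM z).2
  have hUa : ∀ z, |U z| ≤ M := fun z => by rw [abs_of_nonneg (hUM z).1]; exact (hUM z).2
  have key : ∀ T : ℕ, ∀ᵐ z ∂μ₀, 0 < z.1 → z.1 < (T:ℝ) → w z = 0 := by
    intro T
    set lam := L * C + 1 with hlam
    have hl : 0 ≤ lam := by positivity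
    set χ : ℝ → ℝ := fun t => Real.exp (-lam * t) * Real.smoothTransition (T - t) with hχ
    obtain ⟨c1, c2, c3, c4, c5, c6⟩ := tcut hl hχ
    have H := fun l => r6a b hw hU hwM hUM h4 h5 hl hχ (p1 l) (p2 l) (fun x => (p3 l x).1)
    have hXi := (H 0).1
    set X := (Ioi (0:ℝ)).indicator χ with hX
    have hX0 : ∀ t, 0 ≤ X t := fun t => indicator_nonneg (fun t _ => c3 t) t
    have ia := bint hw hwa hXi ai
    have hn : ∀ z : ℝ × E, 0 ≤ w z * (X z.1 * a z.2) := fun z =>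
      mul_nonneg (hwM z).1 (mul_nonneg (hX0 _) (a0 _).le)
    have hlim : Tendsto (fun l => ∫ z, w z * (X z.1 * ϕ l z.2) ∂μ₀) atTop
        (𝓝 (∫ z, w z * (X z.1 * a z.2) ∂μ₀)) := by
      refine tendsto_integral_of_dominated_convergence (fun z => w z * (X z.1 * a z.2)) (fun l => ?_) ia
        (fun l => ae_of_all _ fun z => ?_) (ae_of_all _ fun z => ?_)
      · exact (bint hw hwa hXi ((p1 l).continuous.integrable_of_hasCompactSupport (p2 l))).1
      · rw [Real.norm_eq_abs, abs_of_nonneg (mul_nonneg (hwM z).1 (mul_nonneg (hX0 _) (p3 l _).1))]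
        exact mul_le_mul_of_nonneg_left (mul_le_mul_of_nonneg_left (p3 l _).2 (hX0 _)) (hwM z).1
      · exact ((p5 z.2).const_mul _).const_mul _
    have hle : lam * ∫ z, w z * (X z.1 * a z.2) ∂μ₀ ≤ L * C * ∫ z, w z * (X z.1 * a z.2) ∂μ₀ := by
      refine le_of_tendsto (hlim.const_mul lam) (Eventually.of_forall fun l => ?_)
      refine (H l).2.trans ?_
      rw [← integral_const_mul]
      refine integral_mono_of_nonneg (ae_of_all _ fun z => ?_) (ia.const_mul _) (ae_of_all _ fun z => ?_)
      · exact mul_nonneg (hUM z).1 (mul_nonneg (hX0 _) (abs_nonneg _))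
      · have e1 := mul_le_mul_of_nonneg_left (p4 l z.2) (hX0 z.1)
        have e2 := mul_le_mul (hL z) e1 (mul_nonneg (hX0 _) (abs_nonneg _)) (mul_nonneg hL0 (hwM z).1)
        refine e2.trans (le_of_eq ?_)
        ring
    have hz : ∫ z, w z * (X z.1 * a z.2) ∂μ₀ = 0 := by
      have := integral_nonneg (μ := μ₀) (f := fun z : ℝ × E => w z * (X z.1 * a z.2)) hn
      rw [hlam] at hle
      linarith
    rw [integral_eq_zero_iff_of_nonneg (show 0 ≤ fun z : ℝ × E => w z * (X z.1 * a z.2) from hn) ia] at hz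
    filter_upwards [hz] with z hz0 hz1 hz2
    have hXp : 0 < X z.1 := by
      rw [hX, indicator_of_mem (show z.1 ∈ Ioi (0:ℝ) from hz1)]; exact c6 _ hz2
    exact (mul_eq_zero.1 hz0).resolve_right (mul_pos hXp (a0 _)).ne'
  filter_upwards [ae_all_iff.2 key] with z hz hz0
  obtain ⟨T, hT⟩ := exists_nat_gt z.1
  exact hz T hz0 hT
end R6

lemma iter {η : Measure E} [SFinite η] {F : ℝ → E → ℝ} {G : ℝ × E → ℝ} {T : ℝ}
    (hG : Integrable G ((volume : Measure ℝ).prod η)) (h0 : ∀ z, z.1 ∉ Ioo 0 T → G z = 0)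
    (h1 : ∀ s x, s ∈ Ioo 0 T → G (s, x) = F s x) :
    ∫ s in Ioo 0 T, ∫ x, F s x ∂η = ∫ z, G z ∂((volume : Measure ℝ).prod η) := by
  rw [integral_prod _ hG]
  refine Eq.trans ?_ (setIntegral_eq_integral_of_forall_compl_eq_zero (s := Ioo 0 T) ?_)
  · exact setIntegral_congr_fun measurableSet_Ioo fun s hs =>
      integral_congr_ae (ae_of_all _ fun x => (h1 s x hs).symm)
  · intro s hs
    simp [fun x => h0 (s, x) hs]

lemma step0 {N : ℕ} {m q σ : ℝ} (hm : 1 < m) (hq : 0 < q) (hσ : 0 < σ)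
    {u0 : EuclideanSpace ℝ (Fin N) → ℝ} {u : ℝ → EuclideanSpace ℝ (Fin N) → ℝ}
    (h0 : IsBddNonneg N u0) (h : IsWeakSolution N m q (fun x => ‖x‖ ^ σ) u0 u) :
    ∃ (g : ℝ × EuclideanSpace ℝ (Fin N) → EuclideanSpace ℝ (Fin N)) (M : ℝ),
      WE ((volume : Measure ℝ).prod volume) (ContinuousLinearMap.inr ℝ ℝ _) (1, 0)
        (fun z => if 0 < z.1 then u z.1 z.2 else u0 z.2) g
        (fun z => if 0 < z.1 then ‖z.2‖ ^ σ * u z.1 z.2 ^ q else 0) ∧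
      WG ((volume : Measure ℝ).prod volume) (ContinuousLinearMap.inr ℝ ℝ _) {z | 0 < z.1}
        (fun z => (if 0 < z.1 then u z.1 z.2 else u0 z.2) ^ m) g ∧
      (∀ z : ℝ × EuclideanSpace ℝ (Fin N),
        (if 0 < z.1 then u z.1 z.2 else u0 z.2) ∈ Icc 0 M) ∧ ∀ z, z.1 ≤ 0 → g z = 0 := by
  obtain ⟨a1, a2, C0, a3⟩ := h0
  obtain ⟨b1, b2, ⟨C1, b3⟩, g, b4, b5⟩ := h
  have hpos : MeasurableSet {z : ℝ × EuclideanSpace ℝ (Fin N) | 0 < z.1} :=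
    measurableSet_lt measurable_const measurable_fst
  set U : ℝ × EuclideanSpace ℝ (Fin N) → ℝ :=
    fun z => if 0 < z.1 then u z.1 z.2 else u0 z.2 with hU
  set G : ℝ × EuclideanSpace ℝ (Fin N) → EuclideanSpace ℝ (Fin N) :=
    fun z => if 0 < z.1 then g z.1 z.2 else 0 with hGd
  set f : ℝ × EuclideanSpace ℝ (Fin N) → ℝ :=
    fun z => if 0 < z.1 then ‖z.2‖ ^ σ * u z.1 z.2 ^ q else 0 with hfd
  have mU : Measurable U := Measurable.ite hpos b1 (a1.comp measurable_snd)
  have mG : Measurable G := Measurable.ite hpos b4 measurable_const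
  have mf : Measurable f := Measurable.ite hpos
    ((measurable_snd.norm.pow_const σ).mul (b1.pow_const q)) measurable_const
  set M := max C0 C1
  have hUM : ∀ z, U z ∈ Icc 0 M := fun z => by
    simp only [hU]; split_ifs
    · exact ⟨b2 _ _, (b3 _ _).trans (le_max_right _ _)⟩
    · exact ⟨a2 _, (a3 _).trans (le_max_left _ _)⟩
  have hUa : ∀ z, |U z| ≤ M := fun z => by rw [abs_of_nonneg (hUM z).1]; exact (hUM z).2
  have hUm : ∀ z, |U z ^ m| ≤ M ^ m := fun z => by
    rw [abs_of_nonneg (Real.rpow_nonneg (hUM z).1 _)]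
    exact Real.rpow_le_rpow (hUM z).1 (hUM z).2 (by linarith)
  have hfK : ∀ K, IsCompact K → ∃ C, ∀ z ∈ K, |f z| ≤ C := by
    intro K hK
    obtain ⟨R, hR⟩ := hK.isBounded.exists_norm_le
    refine ⟨(max R 0) ^ σ * M ^ q, fun z hz => ?_⟩
    have hM := (hUM z).1.trans (hUM z).2
    simp only [hfd]; split_ifs with hz0
    · have h1 := hUM z
      simp only [hU, hz0, if_true] at h1
      rw [abs_of_nonneg (mul_nonneg (Real.rpow_nonneg (norm_nonneg _) _) (Real.rpow_nonneg h1.1 _))]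
      exact mul_le_mul (Real.rpow_le_rpow (norm_nonneg _)
        (((norm_snd_le z).trans (hR z hz)).trans (le_max_left _ _)) hσ.le)
        (Real.rpow_le_rpow h1.1 h1.2 hq.le) (Real.rpow_nonneg h1.1 _) (by positivity)
    · rw [abs_zero]; positivity
  have hGL : ∀ K, IsCompact K → MemLp G 2 (((volume : Measure ℝ).prod volume).restrict K) := by
    intro K hK
    obtain ⟨R, hR⟩ := hK.isBounded.exists_norm_le
    have hT : 0 < max R 0 + 1 := by positivity
    refine ⟨mG.aestronglyMeasurable, ?_⟩
    rw [eLpNorm_lt_top_iff_lintegral_rpow_enorm_lt_top (by norm_num) (by norm_num)]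
    have e1 : ∀ z, z ∈ K → ‖G z‖ₑ ^ (ENNReal.toReal 2) ≤
        (Ioo 0 (max R 0 + 1) ×ˢ (Prod.snd '' K)).indicator
          (fun z => ENNReal.ofReal (‖g z.1 z.2‖ ^ 2)) z := by
      intro z hz
      simp only [hGd]; split_ifs with hz0
      · have hz1 : z ∈ Ioo 0 (max R 0 + 1) ×ˢ (Prod.snd '' K) := by
          refine ⟨⟨hz0, ?_⟩, mem_image_of_mem _ hz⟩
          have := (le_abs_self z.1).trans ((norm_fst_le z).trans (hR z hz))
          linarith [le_max_left R 0]
        rw [indicator_of_mem hz1, ← ofReal_norm, ENNReal.toReal_ofNat, ENNReal.rpow_ofNat,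
          ENNReal.ofReal_pow (norm_nonneg _)]
      · simp
    have hS : MeasurableSet (Ioo 0 (max R 0 + 1) ×ˢ (Prod.snd '' K)) :=
      measurableSet_Ioo.prod (hK.image continuous_snd).measurableSet
    refine (setLIntegral_mono' hK.measurableSet e1).trans_lt ?_
    refine (setLIntegral_le_lintegral _ _).trans_lt ?_
    rw [lintegral_indicator hS, ← Measure.prod_restrict,
      lintegral_prod _ (by have := b4.norm.pow_const 2; exact this.ennreal_ofReal.aemeasurable)]
    exact (b5 _ hT).1 _ (hK.image continuous_snd)
  have bigT : ∀ ζ : ℝ × EuclideanSpace ℝ (Fin N) → ℝ, HasCompactSupport ζ →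
      ∃ T > (0:ℝ), ∀ z, T ≤ z.1 → z ∉ tsupport ζ := by
    intro ζ hc
    obtain ⟨R, hR⟩ := hc.isCompact.isBounded.exists_norm_le
    refine ⟨max R 0 + 1, by positivity, fun z hz hz' => ?_⟩
    have := (le_abs_self z.1).trans ((norm_fst_le z).trans (hR z hz'))
    linarith [le_max_left R 0]
  have lG := l2loc_locint (μ := (volume : Measure ℝ).prod volume) hGL
  refine ⟨G, M, ⟨mU, ⟨M, hUa⟩, mG, hGL, mf, hfK, ?_⟩, ⟨mU.pow_const m, ⟨_, hUm⟩, mG, hGL, ?_⟩,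
    hUM, fun z hz => by simp [hGd, not_lt.2 hz]⟩
  · intro ζ hζ hc
    obtain ⟨T, hT, hTs⟩ := bigT ζ hc
    have k := (b5 T hT).2.2 ζ hζ hc fun s x hs => image_eq_zero_of_notMem_tsupport (hTs (s, x) hs)
    obtain ⟨d1, d2⟩ := fderiv_cpt hζ hc (1, 0)
    have ma : Measurable fun z : ℝ × EuclideanSpace ℝ (Fin N) => u0 z.2 := a1.comp measurable_snd
    have hab : ∀ z : ℝ × EuclideanSpace ℝ (Fin N), |u0 z.2| ≤ C0 := fun z => by
      rw [abs_of_nonneg (a2 _)]; exact a3 _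
    have la := pm_locint (μ := (volume : Measure ℝ).prod volume) ma hab
    have i1 := pm_int1 la d1 d2
    have i2 := pm_int1 (pm_locint (μ := (volume : Measure ℝ).prod volume) mU hUa) d1 d2
    have i3 := l2_inner_int (μ := (volume : Measure ℝ).prod volume) hc.isCompact
      (hGL _ hc.isCompact) (gx_cpt_memLp (ContinuousLinearMap.inr ℝ ℝ _) hζ hc).2
      (ae_of_all _ fun z hz => gx_zero _ hz)
    obtain ⟨C, hC⟩ := hfK _ hc.isCompact
    have i4 := (lb_int (μ := (volume : Measure ℝ).prod volume) mf.aestronglyMeasurable hC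
      (hζ.continuous.integrable_of_hasCompactSupport hc)
      (ae_of_all _ fun z hz => image_eq_zero_of_notMem_tsupport hz)).1
    have i5 : ∫ z : ℝ × EuclideanSpace ℝ (Fin N), u0 z.2 * fderiv ℝ ζ z (1, 0)
        ∂((volume : Measure ℝ).prod volume) = 0 := by
      have k1 := deriv_shift la hζ hc (1, 0) 0
      simp only [Prod.snd_add, Prod.smul_snd, smul_zero, add_zero, zero_smul, sub_zero] at k1
      simpa using k1.unique (hasDerivAt_const _ _)
    have j1 : Integrable (fun z : ℝ × EuclideanSpace ℝ (Fin N) =>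
        u0 z.2 * fderiv ℝ ζ z (1, 0) - U z * fderiv ℝ ζ z (1, 0))
        ((volume : Measure ℝ).prod volume) := i1.sub i2
    have j2 : Integrable (fun z : ℝ × EuclideanSpace ℝ (Fin N) =>
        (u0 z.2 * fderiv ℝ ζ z (1, 0) - U z * fderiv ℝ ζ z (1, 0))
        + inner ℝ (G z) (gx (ContinuousLinearMap.inr ℝ ℝ _) ζ z))
        ((volume : Measure ℝ).prod volume) := j1.add i3
    rw [iter (G := fun z => (u0 z.2 * fderiv ℝ ζ z (1, 0) - U z * fderiv ℝ ζ z (1, 0))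
      + inner ℝ (G z) (gx (ContinuousLinearMap.inr ℝ ℝ _) ζ z) + f z * ζ z)
      (j2.add i4), integral_add j2 i4, integral_add j1 i3, integral_sub i1 i2, i5] at k
    · linarith
    · intro z hz
      by_cases hz0 : 0 < z.1
      · have hz1 : z ∉ tsupport ζ := hTs z (not_lt.1 fun h => hz ⟨hz0, h⟩)
        rw [gx_zero _ hz1, image_eq_zero_of_notMem_tsupport hz1,
          fderiv_of_notMem_tsupport ℝ hz1]; simp
      · simp [hU, hGd, hfd, hz0]
    · intro s x hs
      rw [real_inner_comm, inner_gx]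
      simp only [hU, hGd, hfd, hs.1, if_true, ContinuousLinearMap.inr_apply]; ring
  · intro ζ hζ hc hs v
    obtain ⟨T, hT, hTs⟩ := bigT ζ hc
    have hz0 : ∀ z : ℝ × EuclideanSpace ℝ (Fin N), z.1 ∉ Ioo 0 T → z ∉ tsupport ζ := fun z hz hz' =>
      hTs z (not_lt.1 fun h => hz ⟨hs hz', h⟩) hz'
    have lm := pm_locint (μ := (volume : Measure ℝ).prod volume) (mU.pow_const m) hUm
    have i1 := fun i : Fin N => pm_int1 lm
      (fderiv_cpt hζ hc (0, EuclideanSpace.single i 1)).1 (fderiv_cpt hζ hc _).2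
    have i2 : ∀ i : Fin N, Integrable (fun z => G z i * ζ z) ((volume : Measure ℝ).prod volume) := by
      intro i
      have := (lG.integrable_smul_left_of_hasCompactSupport hζ.continuous hc)
      have := ((EuclideanSpace.proj i : EuclideanSpace ℝ (Fin N) →L[ℝ] ℝ)).integrable_comp this
      simpa [mul_comm] using this
    have k : ∀ i : Fin N, _ := fun i => (b5 T hT).2.1 ζ hζ hc
      (fun s x hs => image_eq_zero_of_notMem_tsupport (hz0 (s, x) hs)) i
    have k2 : ∀ i : Fin N, ∫ z, U z ^ m * fderiv ℝ ζ z (0, EuclideanSpace.single i 1)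
        ∂((volume : Measure ℝ).prod volume) = - ∫ z, G z i * ζ z ∂((volume : Measure ℝ).prod volume) := by
      intro i
      rw [← iter (i1 i) _ _, ← iter (i2 i) _ _]
      · exact k i
      · intro z hz
        rw [image_eq_zero_of_notMem_tsupport (hz0 z hz), mul_zero]
      · intro s x hs
        simp [hGd, hs.1]
      · intro z hz
        rw [fderiv_of_notMem_tsupport ℝ (hz0 z hz)]; simp
      · intro s x hs
        simp [hU, hs.1]
    have hv : ContinuousLinearMap.inr ℝ ℝ (EuclideanSpace ℝ (Fin N)) v
        = ∑ i, v i • ((0:ℝ), (EuclideanSpace.single i 1 : EuclideanSpace ℝ (Fin N))) := by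
      have := (EuclideanSpace.basisFun (Fin N) ℝ).sum_repr v
      conv_lhs => rw [← this, map_sum]
      simp
    have e1 : ∀ z, U z ^ m * fderiv ℝ ζ z (ContinuousLinearMap.inr ℝ ℝ _ v)
        = ∑ i, v i * (U z ^ m * fderiv ℝ ζ z (0, EuclideanSpace.single i 1)) := by
      intro z
      rw [hv, map_sum, Finset.mul_sum]
      exact Finset.sum_congr rfl fun i _ => by rw [map_smul, smul_eq_mul]; ring
    have e2 : ∀ z, inner ℝ (G z) v * ζ z = ∑ i, v i * (G z i * ζ z) := by
      intro z
      rw [PiLp.inner_apply, Finset.sum_mul]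
      exact Finset.sum_congr rfl fun i _ => by simp; ring
    refine (integral_congr_ae (ae_of_all _ e1)).trans (Eq.trans ?_ (congrArg Neg.neg
      (integral_congr_ae (ae_of_all _ e2))).symm)
    rw [integral_finsetSum _ fun i _ => (i1 i).const_mul _,
      integral_finsetSum _ fun i _ => (i2 i).const_mul _, ← Finset.sum_neg_distrib]
    exact Finset.sum_congr rfl fun i _ => by
      rw [integral_const_mul, integral_const_mul, k2 i]; ring

lemma rpow_lip {m M a b : ℝ} (hm : 1 < m) (ha : a ∈ Icc 0 M) (hb : b ∈ Icc 0 M) :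
    max (a ^ m - b ^ m) 0 ≤ m * M ^ (m - 1) * max (a - b) 0 := by
  have hM : 0 ≤ M := ha.1.trans ha.2
  have hL : 0 ≤ m * M ^ (m - 1) := mul_nonneg (by linarith) (Real.rpow_nonneg hM _)
  rcases le_total a b with h | h
  · rw [max_eq_right (sub_nonpos.2 (Real.rpow_le_rpow ha.1 h (by linarith))),
      max_eq_right (sub_nonpos.2 h), mul_zero]
  · rw [max_eq_left (sub_nonneg.2 (Real.rpow_le_rpow hb.1 h (by linarith))),
      max_eq_left (sub_nonneg.2 h)]
    have := Convex.norm_image_sub_le_of_norm_hasDerivWithin_le (C := m * M ^ (m - 1))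
      (f := fun x : ℝ => x ^ m) (f' := fun x => m * x ^ (m - 1)) (s := Icc 0 M)
      (fun x hx => (Real.hasDerivAt_rpow_const (Or.inr hm.le)).hasDerivWithinAt)
      (fun x hx => by
        rw [Real.norm_of_nonneg (mul_nonneg (by linarith) (Real.rpow_nonneg hx.1 _))]
        exact mul_le_mul_of_nonneg_left (Real.rpow_le_rpow hx.1 hx.2 (by linarith)) (by linarith))
      (convex_Icc 0 M) hb ha
    rw [Real.norm_eq_abs, Real.norm_eq_abs, abs_of_nonneg (sub_nonneg.2 h)] at this
    exact (le_abs_self _).trans this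

end generic

/-- **Comparison principle (part of Theorem 2.1).**
If `u₀,₁ ≤ u₀,₂` a.e. and `u₁, u₂` are non-negative weak solutions of
`∂ₜ u = Δ(uᵐ) − |x|^σ u^q` with initial conditions `u₀,₁` and `u₀,₂` respectively,
then `u₁ ≤ u₂` a.e. on `(0,∞)×ℝᴺ`. -/
theorem comparison_principle
    (N : ℕ) (hN : 1 ≤ N) (m q σ : ℝ) (hm : 1 < m) (hq0 : 0 < q) (hq1 : q < 1)
    (hσ0 : 0 < σ)
    (u01 u02 : EuclideanSpace ℝ (Fin N) → ℝ)
    (hu01 : IsBddNonneg N u01) (hu02 : IsBddNonneg N u02)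
    (h0 : ∀ᵐ x : EuclideanSpace ℝ (Fin N), u01 x ≤ u02 x)
    (u1 u2 : ℝ → EuclideanSpace ℝ (Fin N) → ℝ)
    (hu1 : IsWeakSolution N m q (fun x => ‖x‖ ^ σ) u01 u1)
    (hu2 : IsWeakSolution N m q (fun x => ‖x‖ ^ σ) u02 u2) :
    ∀ᵐ p : ℝ × EuclideanSpace ℝ (Fin N), 0 < p.1 → u1 p.1 p.2 ≤ u2 p.1 p.2 := by
  obtain ⟨g1, M1, E1, G1, B1, Z1⟩ := step0 hm hq0 hσ0 hu01 hu1
  obtain ⟨g2, M2, E2, G2, B2, Z2⟩ := step0 hm hq0 hσ0 hu02 hu2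
  set v1 : ℝ × EuclideanSpace ℝ (Fin N) → ℝ :=
    fun z => if 0 < z.1 then u1 z.1 z.2 else u01 z.2 with hv1
  set v2 : ℝ × EuclideanSpace ℝ (Fin N) → ℝ :=
    fun z => if 0 < z.1 then u2 z.1 z.2 else u02 z.2 with hv2
  set M := max M1 M2
  have C1 : ∀ z, v1 z ∈ Icc 0 M := fun z => ⟨(B1 z).1, (B1 z).2.trans (le_max_left _ _)⟩
  have C2 : ∀ z, v2 z ∈ Icc 0 M := fun z => ⟨(B2 z).1, (B2 z).2.trans (le_max_right _ _)⟩
  have mv1 : Measurable v1 := E1.1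
  have mv2 : Measurable v2 := E2.1
  have m01 : Measurable fun z : ℝ × EuclideanSpace ℝ (Fin N) => u01 z.2 :=
    hu01.1.comp measurable_snd
  have m02 : Measurable fun z : ℝ × EuclideanSpace ℝ (Fin N) => u02 z.2 :=
    hu02.1.comp measurable_snd
  have hM0 : 0 ≤ M := (C1 0).1.trans (C1 0).2
  have D1 : ∀ z : ℝ × EuclideanSpace ℝ (Fin N), u01 z.2 ∈ Icc 0 M := fun z => by
    simpa [hv1] using C1 (0, z.2)
  have D2 : ∀ z : ℝ × EuclideanSpace ℝ (Fin N), u02 z.2 ∈ Icc 0 M := fun z => by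
    simpa [hv2] using C2 (0, z.2)
  have hf : ∀ t s x, 0 < t → 0 < s → v2 (s, x) ≤ v1 (t, x) →
      (if 0 < s then ‖x‖ ^ σ * u2 s x ^ q else 0) ≤ (if 0 < t then ‖x‖ ^ σ * u1 t x ^ q else 0) := by
    intro t s x ht hs h
    simp only [hv1, hv2, ht, hs, if_true] at h ⊢
    exact mul_le_mul_of_nonneg_left (Real.rpow_le_rpow (hu2.2.1 _ _) h hq0.le)
      (Real.rpow_nonneg (norm_nonneg _) _)
  have key := r6 (EuclideanSpace.basisFun (Fin N) ℝ) (η := volume)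
    (w := fun z => max (v1 z - v2 z) 0) (U := fun z => max (v1 z ^ m - v2 z ^ m) 0)
    (M := max M (M ^ m)) (L := m * M ^ (m - 1))
    ((mv1.sub mv2).max measurable_const)
    (((mv1.pow_const m).sub (mv2.pow_const m)).max measurable_const)
    (fun z => ⟨le_max_right _ _, max_le (by linarith [(C1 z).2, (C2 z).1, le_max_left M (M ^ m)])
      (le_max_of_le_left hM0)⟩)
    (fun z => ⟨le_max_right _ _, max_le (by
      linarith [Real.rpow_le_rpow (C1 z).1 (C1 z).2 (by linarith : 0 ≤ m),
        Real.rpow_nonneg (C2 z).1 m, le_max_right M (M ^ m)])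
      (le_max_of_le_left hM0)⟩)
    (mul_nonneg (by linarith) (Real.rpow_nonneg hM0 _))
    (fun z => rpow_lip hm (C1 z) (C2 z))
    (fun Φ p1 p2 p3 p4 => r4 _ hm E1 E2 C1 C2 G1 G2 hf p1 p2 p3 p4) ?_
  · filter_upwards [key] with z hz hz0
    have := hz hz0
    simp only [hv1, hv2, hz0, if_true] at this
    linarith [le_max_left (u1 z.1 z.2 - u2 z.1 z.2) 0]
  · intro ϕ p1 p2 p3 ε hε
    filter_upwards [r5 hm E1 G1 C1 (u0 := u01) (fun t x ht => by simp [hv1, not_lt.2 ht]) Z1 p1 p2 p3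
      (half_pos hε), r5 hm E2 G2 C2 (u0 := u02) (fun t x ht => by simp [hv2, not_lt.2 ht]) Z2 p1 p2 p3
      (half_pos hε)] with τ k1 k2
    have iX : Integrable ((Icc (τ / 2) τ).indicator (fun _ => (1:ℝ))) volume :=
      (integrable_indicator_iff measurableSet_Icc).2 (by simp)
    have iϕ : Integrable ϕ volume := p1.continuous.integrable_of_hasCompactSupport p2
    have bd : ∀ {a b : ℝ}, a ∈ Icc 0 M → b ∈ Icc 0 M → |(|a - b|)| ≤ M := fun ha hb => by
      rw [abs_abs, abs_le]; constructor <;> linarith [ha.1, ha.2, hb.1, hb.2]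
    have i1 := bint (η := volume) (w := fun z => |v1 z - u01 z.2|) (mv1.sub m01).abs
      (fun z => bd (C1 z) (D1 z)) iX iϕ
    have i2 := bint (η := volume) (w := fun z => |v2 z - u02 z.2|) (mv2.sub m02).abs
      (fun z => bd (C2 z) (D2 z)) iX iϕ
    have h0' : ∀ᵐ z ∂((volume : Measure ℝ).prod (volume : Measure (EuclideanSpace ℝ (Fin N)))),
        u01 z.2 ≤ u02 z.2 := Measure.quasiMeasurePreserving_snd.ae h0
    have i3 := integral_mono_of_nonneg (μ := (volume : Measure ℝ).prod volume)
      (f := fun z => max (v1 z - v2 z) 0 * ((Icc (τ / 2) τ).indicator (fun _ => 1) z.1 * ϕ z.2))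
      (ae_of_all _ fun z => mul_nonneg (le_max_right _ _)
        (mul_nonneg (indicator_nonneg (fun _ _ => zero_le_one) _) (p3 _))) (i1.add i2) (by
        filter_upwards [h0'] with z hz
        rw [Pi.add_apply, ← add_mul]
        refine mul_le_mul_of_nonneg_right (max_le ?_ (by positivity))
          (mul_nonneg (indicator_nonneg (fun _ _ => zero_le_one) _) (p3 _))
        linarith [le_abs_self (v1 z - u01 z.2), neg_abs_le (v2 z - u02 z.2)])
    rw [integral_add' i1 i2] at i3
    linarith
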